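/- arXiv:2311.01381 — 7 statements merged into one kernel-verified Lean document; each statement's English description precedes it below -/
import Mathlib

section
/- Let N ≥ 1 be an integer and p a real with 1 < p < p_*(N). Then every smooth function u : ℝ × EuclideanSpace ℝ (Fin N) → ℝ with u ≥ 0 everywhere and ∂_t u = Δu + u^p on all of ℝ × ℝ^N is identically zero. -/
/-- Second partial derivative `∂ᵢ∂ⱼ f` with respect to the standard coordinates. -/
noncomputable def pd2 {N : ℕ} (f : EuclideanSpace ℝ (Fin N) → ℝ) (i j : Fin N)
    (x : EuclideanSpace ℝ (Fin N)) : ℝ :=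
  fderiv ℝ (fun y => fderiv ℝ f y (EuclideanSpace.single i 1)) x (EuclideanSpace.single j 1)

/-- Laplacian: sum of the second partial derivatives `∂ᵢ∂ᵢ f`. -/
noncomputable def lap {N : ℕ} (f : EuclideanSpace ℝ (Fin N) → ℝ)
    (x : EuclideanSpace ℝ (Fin N)) : ℝ :=
  ∑ i, pd2 f i i x

/-- Spatial Laplacian of a function of `(t, x)`. -/
noncomputable def slap {N : ℕ} (u : ℝ × EuclideanSpace ℝ (Fin N) → ℝ) (t : ℝ)
    (x : EuclideanSpace ℝ (Fin N)) : ℝ :=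
  lap (fun y => u (t, y)) x

/-- Time derivative `∂ₜ u` of a function of `(t, x)`. -/
noncomputable def partialT {N : ℕ} (u : ℝ × EuclideanSpace ℝ (Fin N) → ℝ) (t : ℝ)
    (x : EuclideanSpace ℝ (Fin N)) : ℝ :=
  deriv (fun s => u (s, x)) t

/-- The critical exponent `p_*(N)`: `(N+2+√(N²+8N))/(2(N−1))` for `N ≥ 2`, and `8` for `N = 1`. -/
noncomputable def pStar (N : ℕ) : ℝ :=
  if 2 ≤ N then ((N : ℝ) + 2 + Real.sqrt ((N : ℝ) ^ 2 + 8 * N)) / (2 * ((N : ℝ) - 1)) else 8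


/-- Directional derivative operator. -/
noncomputable def dD {E : Type*} [NormedAddCommGroup E] [NormedSpace ℝ E] (v : E) (F : E → ℝ) :
    E → ℝ := fun z => fderiv ℝ F z v

/-- Linearised operator. -/
noncomputable def opL {E : Type*} [NormedAddCommGroup E] [NormedSpace ℝ E] {N : ℕ}
    (τ : E) (e : Fin N → E) (f F : E → ℝ) : E → ℝ :=
  fun z => dD τ F z - ∑ i, dD (e i) (dD (e i) F) z - 2 * ∑ i, dD (e i) f z * dD (e i) F z

section dcalc
variable {E : Type*} [NormedAddCommGroup E] [NormedSpace ℝ E]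

lemma dD_smooth {F : E → ℝ} (hF : ContDiff ℝ (⊤ : ℕ∞) F) (v : E) :
    ContDiff ℝ (⊤ : ℕ∞) (dD v F) := by
  have h1 : ContDiff ℝ (⊤ : ℕ∞) (fderiv ℝ F) := hF.fderiv_right (m := ((⊤ : ℕ∞) : WithTop ℕ∞)) (by simp)
  exact h1.clm_apply contDiff_const

lemma sm_diff {F : E → ℝ} (hF : ContDiff ℝ (⊤ : ℕ∞) F) : Differentiable ℝ F :=
  hF.differentiable (by simp)

lemma dD_add {F G : E → ℝ} (hF : ContDiff ℝ (⊤ : ℕ∞) F) (hG : ContDiff ℝ (⊤ : ℕ∞) G) (v : E) :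
    dD v (fun z => F z + G z) = fun z => dD v F z + dD v G z := by
  funext z
  simp only [dD]
  rw [fderiv_fun_add (sm_diff hF z) (sm_diff hG z)]; rfl

lemma dD_sub {F G : E → ℝ} (hF : ContDiff ℝ (⊤ : ℕ∞) F) (hG : ContDiff ℝ (⊤ : ℕ∞) G) (v : E) :
    dD v (fun z => F z - G z) = fun z => dD v F z - dD v G z := by
  funext z
  simp only [dD]
  rw [fderiv_fun_sub (sm_diff hF z) (sm_diff hG z)]; rfl

lemma dD_mul {F G : E → ℝ} (hF : ContDiff ℝ (⊤ : ℕ∞) F) (hG : ContDiff ℝ (⊤ : ℕ∞) G) (v : E) :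
    dD v (fun z => F z * G z) = fun z => F z * dD v G z + G z * dD v F z := by
  funext z
  simp only [dD]
  rw [fderiv_fun_mul (sm_diff hF z) (sm_diff hG z)]; simp

lemma dD_cmul (c : ℝ) {G : E → ℝ} (hG : ContDiff ℝ (⊤ : ℕ∞) G) (v : E) :
    dD v (fun z => c * G z) = fun z => c * dD v G z := by
  funext z
  simp only [dD]
  rw [fderiv_const_mul (sm_diff hG z)]; simp

lemma dD_const (c : ℝ) (v : E) : dD v (fun _ : E => c) = fun _ => 0 := by
  funext z; simp [dD]

lemma dD_sum {ι : Type*} (s : Finset ι) {F : ι → E → ℝ} (hF : ∀ i, ContDiff ℝ (⊤ : ℕ∞) (F i)) (v : E) :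
    dD v (fun z => ∑ i ∈ s, F i z) = fun z => ∑ i ∈ s, dD v (F i) z := by
  funext z
  simp only [dD]
  rw [fderiv_fun_sum (fun i _ => sm_diff (hF i) z)]; simp

lemma dD_comm {F : E → ℝ} (hF : ContDiff ℝ (⊤ : ℕ∞) F) (v w : E) :
    dD v (dD w F) = dD w (dD v F) := by
  have h1 : ContDiff ℝ (⊤ : ℕ∞) (fderiv ℝ F) := hF.fderiv_right (m := ((⊤ : ℕ∞) : WithTop ℕ∞)) (by simp)
  have h1d : Differentiable ℝ (fderiv ℝ F) := h1.differentiable (by simp)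
  have key : ∀ z (a b : E), dD a (dD b F) z = fderiv ℝ (fderiv ℝ F) z a b := by
    intro z a b
    show fderiv ℝ (fun y => fderiv ℝ F y b) z a = _
    rw [fderiv_clm_apply (h1d z) (differentiableAt_const b)]
    simp
  funext z
  rw [key, key]
  have := hF.contDiffAt (x := z) |>.isSymmSndFDerivAt (by simp; exact WithTop.coe_le_coe.2 le_top)
  exact this v w

lemma dD_exp (k : ℝ) {f : E → ℝ} (hf : ContDiff ℝ (⊤ : ℕ∞) f) (v : E) :
    dD v (fun z => Real.exp (k * f z)) = fun z => k * Real.exp (k * f z) * dD v f z := by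
  funext z
  simp only [dD]
  have h := ((sm_diff hf z).hasFDerivAt.const_mul k).exp
  rw [h.fderiv]; simp; ring

lemma sm_exp (k : ℝ) {f : E → ℝ} (hf : ContDiff ℝ (⊤ : ℕ∞) f) :
    ContDiff ℝ (⊤ : ℕ∞) (fun z => Real.exp (k * f z)) :=
  (contDiff_const.mul hf).exp

variable {N : ℕ} (τ : E) (e : Fin N → E)

lemma opL_add (f : E → ℝ) {F G : E → ℝ} (hF : ContDiff ℝ (⊤ : ℕ∞) F) (hG : ContDiff ℝ (⊤ : ℕ∞) G) (z : E) :
    opL τ e f (fun z => F z + G z) z = opL τ e f F z + opL τ e f G z := by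
  simp only [opL, dD_add hF hG, dD_add (dD_smooth hF _) (dD_smooth hG _), mul_add, Finset.sum_add_distrib]
  ring

lemma opL_cmul (f : E → ℝ) (c : ℝ) {G : E → ℝ} (hG : ContDiff ℝ (⊤ : ℕ∞) G) (z : E) :
    opL τ e f (fun z => c * G z) z = c * opL τ e f G z := by
  simp only [opL, dD_cmul c hG, dD_cmul c (dD_smooth hG _), mul_sub, Finset.mul_sum]
  congr 1
  apply Finset.sum_congr rfl; intros; ring

lemma opL_const (f : E → ℝ) (c : ℝ) (z : E) :
    opL τ e f (fun _ => c) z = 0 := by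
  simp [opL, dD_const]

lemma opL_sum (f : E → ℝ) {ι : Type*} (s : Finset ι) {F : ι → E → ℝ} (hF : ∀ i, ContDiff ℝ (⊤ : ℕ∞) (F i)) (z : E) :
    opL τ e f (fun z => ∑ i ∈ s, F i z) z = ∑ i ∈ s, opL τ e f (F i) z := by
  classical
  induction s using Finset.induction_on with
  | empty => simp [opL_const]
  | insert a s ha ih =>
    simp only [Finset.sum_insert ha]
    rw [opL_add τ e f (hF a) (ContDiff.sum fun i _ => hF i), ih]

lemma opL_mul (f : E → ℝ) {F G : E → ℝ} (hF : ContDiff ℝ (⊤ : ℕ∞) F) (hG : ContDiff ℝ (⊤ : ℕ∞) G) (z : E) :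
    opL τ e f (fun z => F z * G z) z = F z * opL τ e f G z + G z * opL τ e f F z
      - 2 * ∑ i, dD (e i) F z * dD (e i) G z := by
  have h2 : ∀ i, dD (e i) (dD (e i) (fun z => F z * G z)) z =
      F z * dD (e i) (dD (e i) G) z + G z * dD (e i) (dD (e i) F) z + 2 * (dD (e i) F z * dD (e i) G z) := by
    intro i
    rw [dD_mul hF hG, dD_add (hF.mul (dD_smooth hG _)) (hG.mul (dD_smooth hF _)),
      dD_mul hF (dD_smooth hG _), dD_mul hG (dD_smooth hF _)]
    ring
  simp only [opL, h2]
  simp only [dD_mul hF hG, Finset.sum_add_distrib, ← Finset.mul_sum]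
  have : ∑ i, dD (e i) f z * (F z * dD (e i) G z + G z * dD (e i) F z) =
    F z * ∑ i, dD (e i) f z * dD (e i) G z + G z * ∑ i, dD (e i) f z * dD (e i) F z := by
    rw [Finset.mul_sum, Finset.mul_sum, ← Finset.sum_add_distrib]
    apply Finset.sum_congr rfl; intros; ring
  rw [this]; ring

lemma opL_exp {f : E → ℝ} (hf : ContDiff ℝ (⊤ : ℕ∞) f) (k : ℝ) (z : E) :
    opL τ e f (fun z => Real.exp (k * f z)) z =
      k * Real.exp (k * f z) * (opL τ e f f z - k * ∑ i, dD (e i) f z ^ 2) := by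
  have h2 : ∀ i, dD (e i) (dD (e i) (fun z => Real.exp (k * f z))) z =
      k * Real.exp (k * f z) * dD (e i) (dD (e i) f) z + k * Real.exp (k * f z) * k * (dD (e i) f z)^2 := by
    intro i
    rw [dD_exp k hf, dD_mul (contDiff_const.mul (sm_exp k hf)) (dD_smooth hf _),
      dD_cmul k (sm_exp k hf), dD_exp k hf]
    ring
  simp only [opL, h2]
  simp only [dD_exp k hf, Finset.sum_add_distrib, ← Finset.mul_sum]
  have : ∑ i, dD (e i) f z * (k * Real.exp (k * f z) * dD (e i) f z) =
    k * Real.exp (k * f z) * ∑ i, dD (e i) f z * dD (e i) f z := by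
    rw [Finset.mul_sum]
    apply Finset.sum_congr rfl; intros; ring
  rw [this]; ring

lemma opL_smooth {f F : E → ℝ} (hf : ContDiff ℝ (⊤ : ℕ∞) f) (hF : ContDiff ℝ (⊤ : ℕ∞) F) :
    ContDiff ℝ (⊤ : ℕ∞) (opL τ e f F) := by
  unfold opL
  refine ((dD_smooth hF _).sub (ContDiff.sum fun i _ => dD_smooth (dD_smooth hF _) _)).sub
    (contDiff_const.mul (ContDiff.sum fun i _ => (dD_smooth hf _).mul (dD_smooth hF _)))

lemma opL_dD {f F : E → ℝ} (hf : ContDiff ℝ (⊤ : ℕ∞) f) (hF : ContDiff ℝ (⊤ : ℕ∞) F) (v : E) (z : E) :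
    opL τ e f (dD v F) z = dD v (opL τ e f F) z
      + 2 * ∑ i, dD (e i) (dD v f) z * dD (e i) F z := by
  have s1 := dD_smooth hF τ
  have s2 : ∀ i, ContDiff ℝ (⊤ : ℕ∞) (dD (e i) (dD (e i) F)) := fun i => dD_smooth (dD_smooth hF _) _
  have s3 : ∀ i, ContDiff ℝ (⊤ : ℕ∞) (fun z => dD (e i) f z * dD (e i) F z) :=
    fun i => (dD_smooth hf _).mul (dD_smooth hF _)
  have s4 : ContDiff ℝ (⊤ : ℕ∞) (fun z => ∑ i, dD (e i) (dD (e i) F) z) := ContDiff.sum fun i _ => s2 i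
  have s5 : ContDiff ℝ (⊤ : ℕ∞) (fun z => ∑ i, dD (e i) f z * dD (e i) F z) := ContDiff.sum fun i _ => s3 i
  have : dD v (opL τ e f F) z = dD v (dD τ F) z - ∑ i, dD v (dD (e i) (dD (e i) F)) z
      - 2 * ∑ i, (dD (e i) f z * dD v (dD (e i) F) z + dD (e i) F z * dD v (dD (e i) f) z) := by
    unfold opL
    rw [dD_sub (s1.sub s4) (contDiff_const.mul s5), dD_sub s1 s4, dD_cmul 2 s5, dD_sum _ s2, dD_sum _ s3]
    simp only [dD_mul (dD_smooth hf _) (dD_smooth hF _)]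
  rw [this]
  have c1 : ∀ i, dD v (dD (e i) (dD (e i) F)) z = dD (e i) (dD (e i) (dD v F)) z := by
    intro i
    rw [dD_comm (dD_smooth hF _) v, dD_comm hF v]
  simp only [c1, opL]
  simp only [dD_comm hF v, dD_comm hf v, Finset.sum_add_distrib]
  have c2 : ∀ i, dD (e i) F z * dD (e i) (dD v f) z = dD (e i) (dD v f) z * dD (e i) F z := fun i => mul_comm _ _
  simp only [c2]
  ring

variable {τ e}

/-- The three basic identities. -/
lemma opL_f {f W : E → ℝ}
    (heq : ∀ z, dD τ f z = ∑ i, dD (e i) (dD (e i) f) z + ∑ i, dD (e i) f z ^ 2 + W z) (z : E) :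
    opL τ e f f z = W z - ∑ i, dD (e i) f z ^ 2 := by
  simp only [opL, heq, ← pow_two]; ring

lemma opL_dDf {f W : E → ℝ} (hf : ContDiff ℝ (⊤ : ℕ∞) f) (hW : ContDiff ℝ (⊤ : ℕ∞) W)
    (heq : ∀ z, dD τ f z = ∑ i, dD (e i) (dD (e i) f) z + ∑ i, dD (e i) f z ^ 2 + W z) (v z : E) :
    opL τ e f (dD v f) z = dD v W z := by
  rw [opL_dD τ e hf hf]
  have : opL τ e f f = fun z => W z - ∑ i, dD (e i) f z * dD (e i) f z := by
    funext z; rw [opL_f heq]; simp only [pow_two]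
  rw [this, dD_sub hW (ContDiff.sum fun i _ => (dD_smooth hf _).mul (dD_smooth hf _)),
    dD_sum _ (fun i => (dD_smooth hf _).mul (dD_smooth hf _))]
  simp only [dD_mul (dD_smooth hf _) (dD_smooth hf _), dD_comm hf v, Finset.sum_add_distrib]
  have c2 : ∀ i, dD (e i) f z * dD (e i) (dD v f) z = dD (e i) (dD v f) z * dD (e i) f z := fun i => mul_comm _ _
  simp only [c2]
  ring

lemma opL_grad {f W : E → ℝ} (hf : ContDiff ℝ (⊤ : ℕ∞) f) (hW : ContDiff ℝ (⊤ : ℕ∞) W)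
    (heq : ∀ z, dD τ f z = ∑ i, dD (e i) (dD (e i) f) z + ∑ i, dD (e i) f z ^ 2 + W z) (z : E) :
    opL τ e f (fun z => ∑ i, dD (e i) f z ^ 2) z =
      2 * ∑ i, dD (e i) f z * dD (e i) W z - 2 * ∑ i, ∑ j, dD (e j) (dD (e i) f) z ^ 2 := by
  simp only [pow_two]
  rw [opL_sum τ e f _ (fun i => (dD_smooth hf _).mul (dD_smooth hf _))]
  simp only [opL_mul τ e f (dD_smooth hf _) (dD_smooth hf _), opL_dDf hf hW heq]
  rw [Finset.mul_sum, Finset.mul_sum, ← Finset.sum_sub_distrib]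
  apply Finset.sum_congr rfl; intros; ring

lemma opL_lapl {f W : E → ℝ} (hf : ContDiff ℝ (⊤ : ℕ∞) f) (hW : ContDiff ℝ (⊤ : ℕ∞) W)
    (heq : ∀ z, dD τ f z = ∑ i, dD (e i) (dD (e i) f) z + ∑ i, dD (e i) f z ^ 2 + W z) (z : E) :
    opL τ e f (fun z => ∑ i, dD (e i) (dD (e i) f) z) z =
      ∑ i, dD (e i) (dD (e i) W) z + 2 * ∑ i, ∑ j, dD (e j) (dD (e i) f) z ^ 2 := by
  rw [opL_sum τ e f _ (fun i => dD_smooth (dD_smooth hf _) _)]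
  rw [Finset.mul_sum, ← Finset.sum_add_distrib]
  apply Finset.sum_congr rfl
  intro i _
  have : opL τ e f (dD (e i) f) = dD (e i) W := by funext z; exact opL_dDf hf hW heq _ z
  rw [opL_dD τ e hf (dD_smooth hf _), this]
  simp only [pow_two]

end dcalc

section dmax
variable {E : Type*} [NormedAddCommGroup E] [NormedSpace ℝ E]

lemma locmax_first {F : E → ℝ} {z : E} (h : IsLocalMax F z) (v : E) : dD v F z = 0 := by
  simp [dD, h.fderiv_eq_zero]

lemma line_deriv {F : E → ℝ} (hF : ContDiff ℝ (⊤ : ℕ∞) F) (z v : E) (t : ℝ) :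
    HasDerivAt (fun h : ℝ => F (z + h • v)) (dD v F (z + t • v)) t := by
  have h1 : HasDerivAt (fun h : ℝ => z + h • v) v t := by
    simpa using ((hasDerivAt_id t).smul_const v).const_add z
  exact (sm_diff hF (z + t • v)).hasFDerivAt.comp_hasDerivAt t h1

lemma locmax_second {F : E → ℝ} (hF : ContDiff ℝ (⊤ : ℕ∞) F) {z : E} (h : IsLocalMax F z) (v : E) :
    dD v (dD v F) z ≤ 0 := by
  by_contra hc
  push Not at hc
  set φ : ℝ → ℝ := fun h => F (z + h • v) with hφ
  have d1 : deriv φ = fun t => dD v F (z + t • v) := by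
    funext t; exact (line_deriv hF z v t).deriv
  have d2 : deriv (deriv φ) = fun t => dD v (dD v F) (z + t • v) := by
    rw [d1]; funext t; exact (line_deriv (dD_smooth hF v) z v t).deriv
  have hmin : IsLocalMin φ 0 := by
    apply isLocalMin_of_deriv_deriv_pos
    · rw [d2]; simpa using hc
    · rw [d1]; simpa using locmax_first h v
    · exact (line_deriv hF z v 0).continuousAt
  have hcont : Filter.Tendsto (fun h : ℝ => z + h • v) (nhds 0) (nhds z) := by
    have : Continuous (fun h : ℝ => z + h • v) := by fun_prop
    simpa using this.tendsto 0
  have hmax : IsLocalMax φ 0 := by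
    have := hcont.eventually h
    filter_upwards [this] with t ht
    simpa [hφ] using ht
  have hconst : φ =ᶠ[nhds 0] fun _ => φ 0 := by
    filter_upwards [hmin, hmax] with t h1 h2 using le_antisymm h2 h1
  have e1 : deriv φ =ᶠ[nhds 0] fun _ => 0 := by
    have := hconst.deriv
    simpa using this
  have e2 := e1.deriv_eq
  rw [d2] at e2
  simp at e2
  exact absurd e2 hc.ne'

variable {N : ℕ} {τ : E} {e : Fin N → E}

lemma opL_nonneg_of_max {f F : E → ℝ} (hF : ContDiff ℝ (⊤ : ℕ∞) F) {z : E} (h : IsLocalMax F z) :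
    0 ≤ opL τ e f F z := by
  simp only [opL, locmax_first h]
  have : ∑ i, dD (e i) (dD (e i) F) z ≤ 0 := Finset.sum_nonpos fun i _ => locmax_second hF h _
  simp; linarith

lemma opL_P {f W : E → ℝ} (hf : ContDiff ℝ (⊤ : ℕ∞) f) (hW : ContDiff ℝ (⊤ : ℕ∞) W)
    (heq : ∀ z, dD τ f z = ∑ i, dD (e i) (dD (e i) f) z + ∑ i, dD (e i) f z ^ 2 + W z)
    (α β k : ℝ) (z : E) :
    opL τ e f (fun z => (-1) * (∑ i, dD (e i) (dD (e i) f) z + α * ∑ i, dD (e i) f z ^ 2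
      + β * Real.exp (k * f z))) z =
     - (2 * (1 - α) * (∑ i, ∑ j, dD (e j) (dD (e i) f) z ^ 2) + ∑ i, dD (e i) (dD (e i) W) z
       + 2 * α * ∑ i, dD (e i) f z * dD (e i) W z
       + β * (k * Real.exp (k * f z) * (W z - ∑ i, dD (e i) f z ^ 2 - k * ∑ i, dD (e i) f z ^ 2))) := by
  have s1 : ContDiff ℝ (⊤ : ℕ∞) (fun z => ∑ i, dD (e i) (dD (e i) f) z) :=
    ContDiff.sum fun i _ => dD_smooth (dD_smooth hf _) _
  have s2 : ContDiff ℝ (⊤ : ℕ∞) (fun z => ∑ i, dD (e i) f z ^ 2) :=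
    ContDiff.sum fun i _ => (dD_smooth hf _).pow 2
  have s3 := sm_exp k hf
  rw [opL_cmul τ e f (-1) ((s1.add (contDiff_const.mul s2)).add (contDiff_const.mul s3)),
    opL_add τ e f (s1.add (contDiff_const.mul s2)) (contDiff_const.mul s3),
    opL_add τ e f s1 (contDiff_const.mul s2),
    opL_cmul τ e f α s2, opL_cmul τ e f β s3, opL_exp τ e hf, opL_f heq, opL_grad hf hW heq,
    opL_lapl hf hW heq]
  ring

lemma at_max {f W Q Φ : E → ℝ} (hf : ContDiff ℝ (⊤ : ℕ∞) f)
    (heq : ∀ z, dD τ f z = ∑ i, dD (e i) (dD (e i) f) z + ∑ i, dD (e i) f z ^ 2 + W z)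
    (hQ : ContDiff ℝ (⊤ : ℕ∞) Q) (hΦ : ContDiff ℝ (⊤ : ℕ∞) Φ) (s M : ℝ) (z : E)
    (hmax : IsLocalMax (fun z => Q z * Φ z ^ 4 + (-M) * (1 + Real.exp ((-s) * f z))) z)
    (hM : Q z * Φ z ^ 4 = M * (1 + Real.exp ((-s) * f z))) (hpos : 0 < Φ z)
    (ρ : ℝ) (hρ : ρ = Real.exp ((-s) * f z) / (1 + Real.exp ((-s) * f z))) :
    0 ≤ Φ z ^ 4 * opL τ e f Q z + Q z * (4 * Φ z ^ 3 * (dD τ Φ z - ∑ i, dD (e i) (dD (e i) Φ) z)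
      + 20 * Φ z ^ 2 * ∑ i, dD (e i) Φ z ^ 2
      - 8 * (1 - s * ρ) * Φ z ^ 3 * ∑ i, dD (e i) f z * dD (e i) Φ z)
      - Q z * Φ z ^ 4 * ρ * (s * (1 - s) * ∑ i, dD (e i) f z ^ 2 - s * W z) := by
  have hΦ2 : ContDiff ℝ (⊤ : ℕ∞) (fun z => Φ z * Φ z) := hΦ.mul hΦ
  have hX : ContDiff ℝ (⊤ : ℕ∞) (fun z => (Φ z * Φ z) * (Φ z * Φ z)) := hΦ2.mul hΦ2
  have hex := sm_exp (-s) hf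
  have e4 : (fun z => Q z * Φ z ^ 4 + (-M) * (1 + Real.exp ((-s) * f z))) =
     fun z => Q z * ((Φ z * Φ z) * (Φ z * Φ z)) + (-M) * (1 + Real.exp ((-s) * f z)) := by
    funext z; ring
  rw [e4] at hmax
  have hH : ContDiff ℝ (⊤ : ℕ∞) (fun z => Q z * ((Φ z * Φ z) * (Φ z * Φ z)) + (-M) * (1 + Real.exp ((-s) * f z))) :=
    (hQ.mul hX).add (contDiff_const.mul (contDiff_const.add hex))
  have dX : ∀ v, dD v (fun z => (Φ z * Φ z) * (Φ z * Φ z)) z = 4 * Φ z ^ 3 * dD v Φ z := by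
    intro v
    rw [dD_mul hΦ2 hΦ2, dD_mul hΦ hΦ]; ring
  have h1 : ∀ i, Q z * (4 * Φ z ^ 3 * dD (e i) Φ z) + Φ z ^ 4 * dD (e i) Q z
      + M * (s * Real.exp ((-s) * f z) * dD (e i) f z) = 0 := by
    intro i
    have := locmax_first hmax (e i)
    rw [dD_add (hQ.mul hX) (contDiff_const.mul (contDiff_const.add hex)), dD_mul hQ hX,
      dD_cmul (-M) (contDiff_const.add hex), dD_add contDiff_const hex, dD_exp (-s) hf, dD_const] at this
    simp only [dX] at this
    rw [← this]; ring
  have h2 := opL_nonneg_of_max (τ := τ) (e := e) (f := f) hH hmax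
  rw [opL_add τ e f (hQ.mul hX) (contDiff_const.mul (contDiff_const.add hex)),
    opL_mul τ e f hQ hX, opL_cmul τ e f (-M) (contDiff_const.add hex),
    opL_add τ e f contDiff_const hex, opL_const, opL_exp τ e hf, opL_f heq,
    opL_mul τ e f hΦ2 hΦ2, opL_mul τ e f hΦ hΦ] at h2
  simp only [dX, dD_mul hΦ hΦ] at h2
  set ex := Real.exp ((-s) * f z)
  have hexp : 0 < ex := Real.exp_pos _
  have hMρ : M * ex = Q z * Φ z ^ 4 * ρ := by
    rw [hM, hρ]; field_simp
  set A := ∑ i, dD (e i) f z * dD (e i) Φ z with hA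
  set B := ∑ i, dD (e i) Φ z ^ 2 with hB
  set g := ∑ i, dD (e i) f z ^ 2
  have hS : ∑ i, dD (e i) Q z * (4 * Φ z ^ 3 * dD (e i) Φ z) =
      -16 * Q z * Φ z ^ 2 * B - 4 * s * ρ * Q z * Φ z ^ 3 * A := by
    rw [hA, hB, Finset.mul_sum, Finset.mul_sum, ← Finset.sum_sub_distrib]
    apply Finset.sum_congr rfl
    intro i _
    have h3 : Φ z ^ 4 * dD (e i) Q z = - Q z * (4 * Φ z ^ 3 * dD (e i) Φ z)
      - s * dD (e i) f z * (Q z * Φ z ^ 4 * ρ) := by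
      rw [← hMρ]; linarith [h1 i]
    have h4 : Φ z * dD (e i) Q z = - Q z * (4 * dD (e i) Φ z)
      - s * dD (e i) f z * (Q z * Φ z * ρ) := by
      have : Φ z ^ 3 ≠ 0 := by positivity
      apply mul_left_cancel₀ this
      linear_combination h3
    linear_combination (4 * Φ z ^ 2 * dD (e i) Φ z) * h4
  have hB2 : ∑ i, (Φ z * dD (e i) Φ z + Φ z * dD (e i) Φ z) * (Φ z * dD (e i) Φ z + Φ z * dD (e i) Φ z) =
      4 * Φ z ^ 2 * B := by
    rw [hB, Finset.mul_sum]; apply Finset.sum_congr rfl; intros; ring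
  have hB3 : ∑ i, dD (e i) Φ z * dD (e i) Φ z = B := by
    rw [hB]; apply Finset.sum_congr rfl; intros; ring
  rw [hS, hB2, hB3] at h2
  have hL : opL τ e f Φ z = dD τ Φ z - ∑ i, dD (e i) (dD (e i) Φ) z - 2 * A := rfl
  rw [hL] at h2
  refine h2.trans_eq ?_
  linear_combination (s * (W z - g + s * g)) * hMρ

end dmax


lemma core_beta {p n : ℝ} (hp : 1 < p) (hn : 1 ≤ n) (h : n * p * (p - 1) < (p + 1) ^ 2) :
    ∃ β, 0 < β ∧ β < 1 ∧ p - 1 < 4 * (2 * ((p + 1) / 4) / n) * β ∧ (p - 1) / 2 < p * (1 - β) := by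
  have hlt : n * (p - 1) / (2 * (p + 1)) < (p + 1) / (2 * p) := by
    rw [div_lt_div_iff₀ (by linarith) (by linarith)]; nlinarith
  obtain ⟨β, h1, h2⟩ := exists_between hlt
  have h0 : 0 < n * (p - 1) / (2 * (p + 1)) := by
    apply div_pos <;> nlinarith
  have hβ0 : 0 < β := h0.trans h1
  rw [div_lt_iff₀ (by linarith)] at h1
  rw [lt_div_iff₀ (by linarith)] at h2
  refine ⟨β, hβ0, by nlinarith, ?_, by linarith⟩
  have : 4 * (2 * ((p + 1) / 4) / n) * β = (β * (2 * (p + 1))) / n := by ring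
  rw [this, lt_div_iff₀ (by linarith)]
  linarith

lemma core_quad {κ β a : ℝ} (hκ : 0 < κ) (hβ : 0 < β) (ha : 0 < a) (ha' : a < 4 * κ * β) :
    ∃ ε, 0 < ε ∧ ∀ y w : ℝ, ε * (y ^ 2 + w ^ 2) ≤ κ * (y + β * w) ^ 2 - a * w * y := by
  have hkb : 0 < κ * β := by positivity
  obtain ⟨l, hl0, hl1, hl2⟩ : ∃ l, 0 < l ∧ l * (2 * (κ * β)) ≤ a ∧ l * (2 * (κ * β)) ≤ 4 * κ * β - a := by
    refine ⟨min a (4 * κ * β - a) / (2 * (κ * β)), ?_, ?_, ?_⟩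
    · have : 0 < min a (4 * κ * β - a) := lt_min ha (by linarith)
      positivity
    · rw [div_mul_cancel₀ _ (by positivity)]; exact min_le_left _ _
    · rw [div_mul_cancel₀ _ (by positivity)]; exact min_le_right _ _
  refine ⟨l * κ * min 1 (β ^ 2), by positivity, ?_⟩
  intro y w
  have hl3 : l ≤ 1 := by nlinarith
  have h1 : l * κ * min 1 (β ^ 2) * (y ^ 2 + w ^ 2) ≤ l * κ * (y ^ 2 + β ^ 2 * w ^ 2) := by
    rw [mul_assoc (l * κ)]
    apply mul_le_mul_of_nonneg_left _ (by positivity)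
    nlinarith [min_le_left 1 (β ^ 2), min_le_right 1 (β ^ 2), sq_nonneg y, sq_nonneg w]
  refine h1.trans ?_
  -- (1-l) κ (y² + β² w²) + (2κβ - a) y w ≥ 0
  have h2 : 0 ≤ (1 - l) * κ * (y ^ 2 + β ^ 2 * w ^ 2) + (2 * κ * β - a) * (y * w) := by
    have hc1 : 2 * κ * β - a ≤ (1 - l) * κ * (2 * β) := by linarith
    have hc2 : -((1 - l) * κ * (2 * β)) ≤ 2 * κ * β - a := by linarith
    have hk : 0 ≤ (1 - l) * κ := mul_nonneg (by linarith) hκ.le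
    rcases le_total 0 (y * w) with hyw | hyw
    · nlinarith [mul_nonneg hk (sq_nonneg (y - β * w)), mul_le_mul_of_nonneg_right hc2 hyw]
    · nlinarith [mul_nonneg hk (sq_nonneg (y + β * w)), mul_le_mul_of_nonpos_right hc1 hyw]
  nlinarith

lemma core_cont {p β ε η : ℝ} (hε : 0 < ε) (hη : η < (p - 1) * (p * (1 - β) - (p - 1) / 2)) :
    ∃ r0 : ℝ, 0 < r0 ∧ r0 < 1 ∧ ∀ r, r0 ≤ r → r < 1 →
      |p * r ^ (p - 1) - r ^ p - (p - 1)| ≤ ε ∧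
      η ≤ (p - 1) * (p * (r ^ (p - 2) - β) - (p * r ^ (p - 1) - r ^ p) / 2) ∧
      β * p * (1 - r) * r ^ (p - 1) ≤ ε := by
  have cp : ∀ k : ℝ, ContinuousAt (fun r : ℝ => r ^ k) 1 := fun k =>
    Real.continuousAt_rpow_const 1 k (Or.inl one_ne_zero)
  have c1 : ContinuousAt (fun r : ℝ => |p * r ^ (p - 1) - r ^ p - (p - 1)|) 1 :=
    (((continuousAt_const.mul (cp _)).sub (cp _)).sub continuousAt_const).abs
  have c2 : ContinuousAt (fun r : ℝ => (p - 1) * (p * (r ^ (p - 2) - β) - (p * r ^ (p - 1) - r ^ p) / 2)) 1 :=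
    continuousAt_const.mul ((continuousAt_const.mul ((cp _).sub continuousAt_const)).sub
      (((continuousAt_const.mul (cp _)).sub (cp _)).div_const 2))
  have c3 : ContinuousAt (fun r : ℝ => β * p * (1 - r) * r ^ (p - 1)) 1 :=
    (continuousAt_const.mul (continuousAt_const.sub continuousAt_id)).mul (cp _)
  have e1 := c1.eventually_lt (g := fun _ => ε) continuousAt_const (by simpa using hε)
  have e2 := ContinuousAt.eventually_lt (f := fun _ => η) continuousAt_const c2 (by simpa using hη)
  have e3 := c3.eventually_lt (g := fun _ => ε) continuousAt_const (by simpa using hε)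
  obtain ⟨d, hd, hd'⟩ := Metric.eventually_nhds_iff.1 (e1.and (e2.and e3))
  refine ⟨max (1 - d / 2) (1 / 2), by positivity, max_lt (by linarith) (by norm_num), ?_⟩
  intro r hr hr1
  have hr' : 1 - d / 2 ≤ r := (le_max_left _ _).trans hr
  have : dist r 1 < d := by
    rw [Real.dist_eq, abs_lt]; constructor <;> linarith
  obtain ⟨a, b, c⟩ := hd' this
  exact ⟨a.le, b.le, c.le⟩

lemma core_bdd {p β r : ℝ} (hp : 1 < p) (hβ : 0 < β) (hr : 0 < r) (hr1 : r < 1) :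
    0 ≤ p * r ^ (p - 1) - r ^ p ∧ p * r ^ (p - 1) - r ^ p ≤ p ∧
    -(p * (p - 1) * (β + 1)) ≤ (p - 1) * (p * (r ^ (p - 2) - β) - (p * r ^ (p - 1) - r ^ p) / 2) ∧
    β * p * (1 - r) * r ^ (p - 1) ≤ β * p := by
  have h1 : r ^ (p - 1) ≤ 1 := Real.rpow_le_one hr.le hr1.le (by linarith)
  have h2 : 0 < r ^ (p - 1) := Real.rpow_pos_of_pos hr _
  have h3 : r ^ p = r * r ^ (p - 1) := by
    rw [← Real.rpow_one_add' hr.le (by linarith)]; ring_nf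
  have h4 : 0 < r ^ (p - 2) := Real.rpow_pos_of_pos hr _
  have a1 : 0 ≤ p * r ^ (p - 1) - r ^ p := by rw [h3]; nlinarith
  have a2 : p * r ^ (p - 1) - r ^ p ≤ p := by rw [h3]; nlinarith
  refine ⟨a1, a2, ?_, ?_⟩
  · have : 0 < p * r ^ (p - 2) := by positivity
    nlinarith
  · have : (1 - r) * r ^ (p - 1) ≤ 1 := by nlinarith
    have hbp : 0 < β * p := by positivity
    nlinarith

/-- case I -/
lemma core_I {κ β p ε η s α y w g q ρ a1 a2 a3 ω h m1 v : ℝ}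
    (hquad : 4 * ε * (y ^ 2 + w ^ 2) ≤ κ * (y + β * w) ^ 2 - (p - 1) * w * y)
    (hε : 0 < ε) (hη : 0 < η) (hs : 0 < s) (hs1 : s ≤ 1 / 2) (hsε : s ≤ ε) (hsα : s * |α| ≤ η / 2)
    (_hp : 1 < p) (hsp : s ≤ (p - 1) / 3)
    (ha1 : |a1 - (p - 1)| ≤ ε) (ha2 : η ≤ a2) (ha3 : a3 ≤ ε) (hω0 : 0 ≤ ω) (hω1 : ω ≤ 1)
    (hv : 0 < v) (hw : w = v ^ (p - 1)) (hρ : ρ = 1 / (1 + v ^ s)) (hg : 0 ≤ g)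
    (hm : 0 < m1) (hq : m1 ≤ q) (hy : y = q ^ 4 + α * g) (hh : κ * (y + β * w) ^ 2 ≤ h) :
    (min (min ε (η / 2)) (s / 2) * (min (min 1 m1 / 2) 1 * (min (m1 / 4) 1 / (2 * (2 * (|α| + 1)))))) * (q ^ 7 + g * q ^ 3) ≤
      h - a1 * w * y - a3 * w ^ 2 + a2 * w * g + q ^ 4 * ρ * (s * (1 - s) * g - s * (ω * w)) := by
  have hq0 : 0 < q := by linarith
  have hw0 : 0 < w := by rw [hw]; positivity
  have hvs : 0 < v ^ s := by positivity
  have hρ0 : 0 < ρ := by rw [hρ]; positivity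
  have hρ1 : ρ ≤ 1 := by rw [hρ, div_le_one (by positivity)]; linarith
  set μ := min 1 m1 with hμ
  have hμ0 : 0 < μ := lt_min one_pos hm
  have hμ1 : μ ≤ 1 := min_le_left _ _
  have hμm : μ ≤ m1 := min_le_right _ _
  -- step 1
  have st1 : ε * (y ^ 2 + w ^ 2) + η / 2 * (w * g) + s / 2 * (ρ * q ^ 4 * g) ≤
      h - a1 * w * y - a3 * w ^ 2 + a2 * w * g + q ^ 4 * ρ * (s * (1 - s) * g - s * (ω * w)) := by
    have t1 : (a1 - (p - 1)) * (w * y) ≤ ε * ((y ^ 2 + w ^ 2) / 2) := by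
      calc (a1 - (p - 1)) * (w * y) ≤ |(a1 - (p - 1)) * (w * y)| := le_abs_self _
        _ = |a1 - (p - 1)| * |w * y| := abs_mul _ _
        _ ≤ ε * ((y ^ 2 + w ^ 2) / 2) := by
          apply mul_le_mul ha1 _ (abs_nonneg _) hε.le
          have k1 := sq_nonneg (y + w)
          have k2 := sq_nonneg (y - w)
          rw [abs_le]; constructor <;> linarith
    have t2 : a3 * w ^ 2 ≤ ε * w ^ 2 := mul_le_mul_of_nonneg_right ha3 (sq_nonneg _)
    have t3 : η * (w * g) ≤ a2 * (w * g) := mul_le_mul_of_nonneg_right ha2 (by positivity)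
    have t4 : q ^ 4 * ρ * (s * (ω * w)) ≤ s * (w * (|y| + |α| * g)) := by
      have : q ^ 4 ≤ |y| + |α| * g := by
        have : q ^ 4 = y - α * g := by rw [hy]; ring
        rw [this]
        have := mul_le_mul_of_nonneg_right (neg_abs_le α) hg
        linarith [le_abs_self y]
      have h5 : ρ * ω ≤ 1 := mul_le_one₀ hρ1 hω0 hω1
      have h6 : 0 ≤ ρ * ω := by positivity
      calc q ^ 4 * ρ * (s * (ω * w)) = (ρ * ω) * (s * w * q ^ 4) := by ring
        _ ≤ 1 * (s * w * q ^ 4) := mul_le_mul_of_nonneg_right h5 (by positivity)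
        _ ≤ s * (w * (|y| + |α| * g)) := by
          rw [one_mul, mul_assoc]
          gcongr
    have t5 : s * (w * |y|) ≤ ε * ((y ^ 2 + w ^ 2) / 2) := by
      apply mul_le_mul hsε _ (by positivity) hε.le
      have k1 := sq_nonneg (|y| - w)
      have k2 := sq_abs y
      linarith
    have t6 : s * |α| * (w * g) ≤ η / 2 * (w * g) := mul_le_mul_of_nonneg_right hsα (by positivity)
    have t7 : s / 2 * (ρ * q ^ 4 * g) ≤ s * (1 - s) * (ρ * q ^ 4 * g) := by
      apply mul_le_mul_of_nonneg_right _ (by positivity)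
      have := mul_le_mul_of_nonneg_left hs1 hs.le
      linarith
    have z1 : 0 ≤ ε * y ^ 2 := by positivity
    have z2 : 0 ≤ ε * w ^ 2 := by positivity
    linarith
  -- step 2
  have st2 : μ / 2 * q ^ 3 ≤ w + ρ * q ^ 4 := by
    rcases le_total v 1 with hv1 | hv1
    · have : v ^ s ≤ 1 := Real.rpow_le_one hv.le hv1 hs.le
      have : 1 / 2 ≤ ρ := by
        rw [hρ]; apply one_div_le_one_div_of_le (by positivity); linarith
      have h3 : 0 < q ^ 3 := by positivity
      have : μ * q ^ 3 ≤ q ^ 4 := by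
        have : q ^ 4 = q * q ^ 3 := by ring
        rw [this]; apply mul_le_mul_of_nonneg_right _ h3.le; linarith
      have h9 : 1 / 2 * q ^ 4 ≤ ρ * q ^ 4 := by gcongr
      linarith
    · set x := v ^ ((p - 1) / 3) with hx
      have hx1 : 1 ≤ x := Real.one_le_rpow hv1 (by linarith)
      have hxw : w = x ^ 3 := by
        rw [hw, hx, ← Real.rpow_natCast, ← Real.rpow_mul hv.le]; norm_num
      have hvx : v ^ s ≤ x := Real.rpow_le_rpow_of_exponent_le hv1 hsp
      have hr : 1 / (2 * x) ≤ ρ := by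
        rw [hρ]; apply one_div_le_one_div_of_le (by positivity); linarith
      have h3 : 0 < q ^ 3 := by positivity
      rcases le_total q x with h | h
      · have : q ^ 3 ≤ x ^ 3 := pow_le_pow_left₀ hq0.le h 3
        have : 0 ≤ ρ * q ^ 4 := by positivity
        have : μ * q ^ 3 ≤ 1 * q ^ 3 := by gcongr
        linarith
      · have h5 : 1 / (2 * q) ≤ ρ := by
          refine le_trans ?_ hr
          apply one_div_le_one_div_of_le (by positivity); linarith
        have h6 : q ^ 3 / 2 ≤ ρ * q ^ 4 := by
          calc q ^ 3 / 2 = 1 / (2 * q) * q ^ 4 := by field_simp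
            _ ≤ _ := mul_le_mul_of_nonneg_right h5 (by positivity)
        have : μ * q ^ 3 ≤ 1 * q ^ 3 := by gcongr
        linarith
  -- step 3
  set ν := min (m1 / 4) 1 with hν
  have hν0 : 0 < ν := by positivity
  have hν1 : ν ≤ 1 := min_le_right _ _
  have hνm : ν ≤ m1 / 4 := min_le_left _ _
  have hα := abs_nonneg α
  have hgq : 0 ≤ g * q ^ 3 := by positivity
  have st3 : ν / (2 * (2 * (|α| + 1))) * (q ^ 7 + g * q ^ 3) ≤ y ^ 2 + g * q ^ 3 := by
    set A := 2 * (|α| + 1) with hA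
    have hA2 : 2 ≤ A := by linarith
    have hA0 : 0 < A := by linarith
    have k1 : ν / (2 * A) * (g * q ^ 3) ≤ g * q ^ 3 / 2 := by
      have : ν / (2 * A) ≤ 1 / 2 := by
        rw [div_le_div_iff₀ (by positivity) (by positivity)]; linarith
      have := mul_le_mul_of_nonneg_right this hgq
      linarith
    rcases le_total (A * g) (q ^ 4) with h | h
    · have hy2 : q ^ 4 / 2 ≤ y := by
        rw [hy]
        have := mul_le_mul_of_nonneg_right (neg_abs_le α) hg
        rw [hA] at h
        linarith
      have : q ^ 8 / 4 ≤ y ^ 2 := by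
        have := pow_le_pow_left₀ (by positivity) hy2 2
        refine le_trans (le_of_eq ?_) this
        ring
      have h7 : m1 * q ^ 7 ≤ q ^ 8 := by
        have : q ^ 8 = q * q ^ 7 := by ring
        rw [this]; exact mul_le_mul_of_nonneg_right hq (by positivity)
      have h8 : ν / (2 * A) * q ^ 7 ≤ m1 / 4 * q ^ 7 := by
        apply mul_le_mul_of_nonneg_right _ (by positivity)
        refine le_trans ?_ hνm
        apply div_le_self hν0.le; linarith
      linarith
    · have h7 : q ^ 7 ≤ A * (g * q ^ 3) := by
        calc q ^ 7 = q ^ 4 * q ^ 3 := by ring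
          _ ≤ A * g * q ^ 3 := mul_le_mul_of_nonneg_right h (by positivity)
          _ = _ := by ring
      have h8 : ν / (2 * A) * q ^ 7 ≤ g * q ^ 3 / 2 := by
        calc ν / (2 * A) * q ^ 7 ≤ ν / (2 * A) * (A * (g * q ^ 3)) := by gcongr
          _ = ν * (g * q ^ 3) / 2 := by field_simp
          _ ≤ _ := by
            have : ν * (g * q ^ 3) ≤ 1 * (g * q ^ 3) := mul_le_mul_of_nonneg_right hν1 hgq
            linarith
      have := sq_nonneg y
      linarith
  -- combine
  refine le_trans ?_ st1
  set c1 := min (min ε (η / 2)) (s / 2) with hc1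
  have c10 : 0 < c1 := by positivity
  have c1a : c1 ≤ ε := (min_le_left _ _).trans (min_le_left _ _)
  have c1b : c1 ≤ η / 2 := (min_le_left _ _).trans (min_le_right _ _)
  have c1c : c1 ≤ s / 2 := min_le_right _ _
  set c2 := min (μ / 2) 1 with hc2
  have c20 : 0 < c2 := by positivity
  have c2a : c2 ≤ μ / 2 := min_le_left _ _
  have c2b : c2 ≤ 1 := min_le_right _ _
  have u1 : c1 * (y ^ 2 + g * (w + ρ * q ^ 4)) ≤ ε * (y ^ 2 + w ^ 2) + η / 2 * (w * g) + s / 2 * (ρ * q ^ 4 * g) := by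
    have i1 : c1 * y ^ 2 ≤ ε * y ^ 2 := mul_le_mul_of_nonneg_right c1a (sq_nonneg _)
    have i2 : c1 * (w * g) ≤ η / 2 * (w * g) := mul_le_mul_of_nonneg_right c1b (by positivity)
    have i3 : c1 * (ρ * q ^ 4 * g) ≤ s / 2 * (ρ * q ^ 4 * g) := mul_le_mul_of_nonneg_right c1c (by positivity)
    have i4 : 0 ≤ ε * w ^ 2 := by positivity
    linarith
  refine le_trans ?_ u1
  rw [mul_assoc]
  apply mul_le_mul_of_nonneg_left _ c10.le
  rw [mul_assoc]
  calc c2 * (ν / (2 * (2 * (|α| + 1))) * (q ^ 7 + g * q ^ 3)) ≤ c2 * (y ^ 2 + g * q ^ 3) :=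
        mul_le_mul_of_nonneg_left st3 c20.le
    _ ≤ y ^ 2 + g * (μ / 2 * q ^ 3) := by
        have : c2 * (g * q ^ 3) ≤ μ / 2 * (g * q ^ 3) := mul_le_mul_of_nonneg_right c2a hgq
        have : c2 * y ^ 2 ≤ 1 * y ^ 2 := mul_le_mul_of_nonneg_right c2b (sq_nonneg y)
        linarith
    _ ≤ _ := by gcongr

/-- case II -/
lemma core_II {κ β p s α y w g q ρ a1 a2 a3 ω h m1 θ C l K : ℝ}
    (hκ : 0 < κ) (hβ : 0 < β) (hs : 0 < s) (hs1 : s ≤ 1 / 2) (hp : 1 < p)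
    (hC : 0 ≤ C) (ha1 : 0 ≤ a1) (ha1' : a1 ≤ p) (ha2 : -C ≤ a2) (ha3 : a3 ≤ β * p)
    (hω0 : 0 ≤ ω) (hω1 : ω ≤ 1) (hρ0 : 1 / 2 ≤ ρ) (hρ1 : ρ ≤ 1) (hg : 0 ≤ g)
    (hm : 0 < m1) (hq : m1 ≤ q) (hy : y = q ^ 4 + α * g) (hh : κ * (y + β * w) ^ 2 ≤ h)
    (hl : 0 < l) (hl1 : l ≤ κ / 2) (hl2 : l * (2 * |α|) ≤ s / 8)
    (hK : K = κ * β ^ 2 + p * (1 + |α|) + C + β * p + 1)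
    (hθ : 0 < θ) (hθ1 : θ ≤ 1) (hθ2 : θ * K ≤ l / 2) (hθ3 : θ * K ≤ s / 16)
    (hw : 0 < w) (hwθ : w ≤ θ * q ^ 4) :
    (min (l / 2) (s / 16) * m1) * (q ^ 7 + g * q ^ 3) ≤
      h - a1 * w * y - a3 * w ^ 2 + a2 * w * g + q ^ 4 * ρ * (s * (1 - s) * g - s * (ω * w)) := by
  have hq0 : 0 < q := by linarith
  set Q := q ^ 4 with hQ
  have hQ0 : 0 < Q := by positivity
  have hα := abs_nonneg α
  have hQg : 0 ≤ Q * g := by positivity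
  have t0 : κ * (y ^ 2 / 2 - β ^ 2 * w ^ 2) ≤ κ * (y + β * w) ^ 2 := by
    apply mul_le_mul_of_nonneg_left _ hκ.le
    have := sq_nonneg (y + 2 * β * w)
    linarith
  have hwQ : w * Q ≤ θ * Q ^ 2 := by
    have := mul_le_mul_of_nonneg_right hwθ hQ0.le
    linarith
  have hwg : w * g ≤ θ * (Q * g) := by
    have := mul_le_mul_of_nonneg_right hwθ hg
    linarith
  have hw2 : w ^ 2 ≤ θ * Q ^ 2 := by
    have : w ≤ Q := by
      have := mul_le_mul_of_nonneg_right hθ1 hQ0.le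
      linarith
    have := mul_le_mul_of_nonneg_left this hw.le
    linarith
  have t1 : a1 * w * y ≤ p * (1 + |α|) * (θ * Q ^ 2 + θ * (Q * g)) := by
    have : w * y ≤ w * Q + |α| * (w * g) := by
      rw [hy]
      have := mul_le_mul_of_nonneg_right (le_abs_self α) (mul_nonneg hw.le hg)
      linarith
    have h3 : 0 ≤ w * Q + |α| * (w * g) := by positivity
    calc a1 * w * y = a1 * (w * y) := by ring
      _ ≤ a1 * (w * Q + |α| * (w * g)) := mul_le_mul_of_nonneg_left this ha1
      _ ≤ p * (w * Q + |α| * (w * g)) := mul_le_mul_of_nonneg_right ha1' h3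
      _ ≤ p * ((1 + |α|) * (w * Q + w * g)) := by
        apply mul_le_mul_of_nonneg_left _ (by linarith)
        have := mul_nonneg hα (mul_nonneg hw.le hQ0.le)
        have := mul_nonneg hw.le hg
        linarith
      _ ≤ p * ((1 + |α|) * (θ * Q ^ 2 + θ * (Q * g))) := by gcongr
      _ = _ := by ring
  have t2 : a3 * w ^ 2 ≤ β * p * (θ * Q ^ 2) := by
    calc a3 * w ^ 2 ≤ β * p * w ^ 2 := mul_le_mul_of_nonneg_right ha3 (sq_nonneg _)
      _ ≤ _ := by gcongr
  have t3 : -(C * (θ * (Q * g))) ≤ a2 * w * g := by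
    have : -C * (w * g) ≤ a2 * (w * g) := mul_le_mul_of_nonneg_right ha2 (by positivity)
    have : C * (w * g) ≤ C * (θ * (Q * g)) := by gcongr
    linarith
  have t4 : Q * ρ * (s * (ω * w)) ≤ θ * Q ^ 2 := by
    have h5 : ρ * ω * s ≤ 1 := by
      have : ρ * ω ≤ 1 := mul_le_one₀ hρ1 hω0 hω1
      have : 0 ≤ ρ * ω := by positivity
      exact mul_le_one₀ (by assumption) hs.le (by linarith)
    calc Q * ρ * (s * (ω * w)) = (ρ * ω * s) * (w * Q) := by ring
      _ ≤ 1 * (w * Q) := mul_le_mul_of_nonneg_right h5 (by positivity)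
      _ ≤ _ := by linarith
  have t5 : s / 4 * (Q * g) ≤ Q * ρ * (s * (1 - s) * g) := by
    have : s / 4 ≤ ρ * (s * (1 - s)) := by
      have h1 : s * s ≤ s * (1 / 2) := mul_le_mul_of_nonneg_left hs1 hs.le
      have h2 : 1 / 2 * (s * (1 - s)) ≤ ρ * (s * (1 - s)) :=
        mul_le_mul_of_nonneg_right hρ0 (mul_nonneg hs.le (by linarith))
      linarith
    calc s / 4 * (Q * g) ≤ ρ * (s * (1 - s)) * (Q * g) := mul_le_mul_of_nonneg_right this hQg
      _ = _ := by ring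
  have t6 : l * Q ^ 2 - s / 8 * (Q * g) ≤ κ * (y ^ 2 / 2) := by
    have h1 : Q ^ 2 - 2 * |α| * (Q * g) ≤ y ^ 2 := by
      rw [hy]
      have h1 := mul_le_mul_of_nonneg_right (neg_abs_le α) hQg
      have h2 := sq_nonneg (α * g)
      linarith
    have h2 : l * (2 * |α|) * (Q * g) ≤ s / 8 * (Q * g) := mul_le_mul_of_nonneg_right hl2 hQg
    have h3 : l * y ^ 2 ≤ κ / 2 * y ^ 2 := mul_le_mul_of_nonneg_right hl1 (sq_nonneg _)
    have h4 := mul_le_mul_of_nonneg_left h1 hl.le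
    linarith
  have t7 : κ * (β ^ 2 * w ^ 2) ≤ κ * β ^ 2 * (θ * Q ^ 2) := by
    rw [← mul_assoc]; gcongr
  have b1 : θ * K * Q ^ 2 ≤ l / 2 * Q ^ 2 := mul_le_mul_of_nonneg_right hθ2 (sq_nonneg _)
  have b2 : θ * K * (Q * g) ≤ s / 16 * (Q * g) := mul_le_mul_of_nonneg_right hθ3 hQg
  have main : l / 2 * Q ^ 2 + s / 16 * (Q * g) ≤
      h - a1 * w * y - a3 * w ^ 2 + a2 * w * g + Q * ρ * (s * (1 - s) * g - s * (ω * w)) := by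
    rw [hK] at b1 b2
    have z1 : 0 ≤ θ * Q ^ 2 := by positivity
    have z2 : 0 ≤ θ * (Q * g) := by positivity
    have z3 : 0 ≤ κ * β ^ 2 * (θ * (Q * g)) := by positivity
    have z4 : 0 ≤ β * p * (θ * (Q * g)) := by positivity
    have z5 : 0 ≤ C * (θ * Q ^ 2) := by positivity
    linarith
  refine le_trans ?_ main
  set c := min (l / 2) (s / 16)
  have c0 : 0 < c := by positivity
  have ca : c ≤ l / 2 := min_le_left _ _
  have cb : c ≤ s / 16 := min_le_right _ _
  have q7 : m1 * q ^ 7 ≤ Q ^ 2 := by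
    have : Q ^ 2 = q * q ^ 7 := by rw [hQ]; ring
    rw [this]; exact mul_le_mul_of_nonneg_right hq (by positivity)
  have q3 : m1 * (g * q ^ 3) ≤ Q * g := by
    have : Q * g = q * (g * q ^ 3) := by rw [hQ]; ring
    rw [this]; exact mul_le_mul_of_nonneg_right hq (by positivity)
  calc c * m1 * (q ^ 7 + g * q ^ 3) = c * (m1 * q ^ 7) + c * (m1 * (g * q ^ 3)) := by ring
    _ ≤ l / 2 * Q ^ 2 + s / 16 * (Q * g) := by gcongr


lemma core_all {p n : ℝ} (hp : 1 < p) (hn : 1 ≤ n) (h : n * p * (p - 1) < (p + 1) ^ 2) :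
    ∃ β s r0 θ : ℝ, 0 < β ∧ β < 1 ∧ 0 < s ∧ s ≤ 1 / 2 ∧ 0 < r0 ∧ r0 < 1 ∧ 0 < θ ∧
    ∀ m1 : ℝ, 0 < m1 → ∃ c : ℝ, 0 < c ∧ ∀ q g w r Hs v ρ W W1 W2 Lf : ℝ, m1 ≤ q → 0 ≤ g → 0 < v →
      w = v ^ (p - 1) → 0 < r → r < 1 → ρ = 1 / (1 + v ^ s) →
      W = w * r ^ p → W1 = w * (p * r ^ (p - 1) - r ^ p) → W2 = w * (p * (p - 1) * r ^ (p - 2)) - W1 →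
      Lf = -(q ^ 4 + (3 - p) / 4 * g + β * w) → Lf ^ 2 ≤ n * Hs →
      (r0 ≤ r ∨ (w ≤ θ * q ^ 4 ∧ v ≤ 1)) →
      c * (q ^ 7 + g * q ^ 3) ≤ 2 * (1 - (3 - p) / 4) * Hs + (W2 * g + W1 * Lf) + 2 * ((3 - p) / 4) * (W1 * g)
        + β * ((p - 1) * w * (W - g - (p - 1) * g)) + q ^ 4 * ρ * (s * (1 - s) * g - s * W) := by
  obtain ⟨β, hβ, hβ1, hb1, hb2⟩ := core_beta hp hn h
  set κ := 2 * ((p + 1) / 4) / n with hκ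
  have hκ0 : 0 < κ := by rw [hκ]; apply div_pos <;> linarith
  obtain ⟨ε', hε', hquad⟩ := core_quad hκ0 hβ (by linarith : 0 < p - 1) hb1
  set ε := ε' / 4 with hε
  have hε0 : 0 < ε := by positivity
  set α := (3 - p) / 4 with hα
  set η := (p - 1) * (p * (1 - β) - (p - 1) / 2) / 2 with hη
  have hη0' : 0 < (p - 1) * (p * (1 - β) - (p - 1) / 2) := mul_pos (by linarith) (by linarith)
  have hη0 : 0 < η := by positivity
  have hαn := abs_nonneg α
  set s := min (min (1 / 2) ε) (min (η / (2 * (|α| + 1))) ((p - 1) / 3)) with hs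
  have hs0 : 0 < s := by
    have : 0 < (p - 1) / 3 := by linarith
    positivity
  have hs1 : s ≤ 1 / 2 := (min_le_left _ _).trans (min_le_left _ _)
  have hsε : s ≤ ε := (min_le_left _ _).trans (min_le_right _ _)
  have hsα : s * |α| ≤ η / 2 := by
    have : s ≤ η / (2 * (|α| + 1)) := (min_le_right _ _).trans (min_le_left _ _)
    rw [le_div_iff₀ (by positivity)] at this
    nlinarith
  have hsp : s ≤ (p - 1) / 3 := (min_le_right _ _).trans (min_le_right _ _)
  obtain ⟨r0, hr0, hr01, hcont⟩ := core_cont (p := p) (β := β) (η := η) hε0 (by rw [hη]; linarith)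
  set C := p * (p - 1) * (β + 1) with hC
  have hC0 : 0 ≤ C := by
    have : 0 < p - 1 := by linarith
    positivity
  set K := κ * β ^ 2 + p * (1 + |α|) + C + β * p + 1 with hK
  have hK0 : 0 < K := by positivity
  set l := min (κ / 2) (s / (16 * (|α| + 1))) with hl
  have hl0 : 0 < l := by positivity
  have hl1 : l ≤ κ / 2 := min_le_left _ _
  have hl2 : l * (2 * |α|) ≤ s / 8 := by
    have : l ≤ s / (16 * (|α| + 1)) := min_le_right _ _
    rw [le_div_iff₀ (by positivity)] at this
    nlinarith
  set θ := min 1 (min (l / 2 / K) (s / 16 / K)) with hθ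
  have hθ0 : 0 < θ := by positivity
  have hθ1 : θ ≤ 1 := min_le_left _ _
  have hθ2 : θ * K ≤ l / 2 := by
    rw [← le_div_iff₀ hK0]; exact (min_le_right _ _).trans (min_le_left _ _)
  have hθ3 : θ * K ≤ s / 16 := by
    rw [← le_div_iff₀ hK0]; exact (min_le_right _ _).trans (min_le_right _ _)
  refine ⟨β, s, r0, θ, hβ, hβ1, hs0, hs1, hr0, hr01, hθ0, ?_⟩
  intro m1 hm
  set cA := (min (min ε (η / 2)) (s / 2) * (min (min 1 m1 / 2) 1 * (min (m1 / 4) 1 / (2 * (2 * (|α| + 1)))))) with hcA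
  set cB := (min (l / 2) (s / 16) * m1) with hcB
  have hcA0 : 0 < cA := by positivity
  have hcB0 : 0 < cB := by positivity
  refine ⟨min cA cB, lt_min hcA0 hcB0, ?_⟩
  intro q g w r Hs v ρ W W1 W2 Lf hq hg hv hw hr hr1 hρ hW hW1 hW2 hLf hHs hcase
  have hq0 : 0 < q := by linarith
  have hh : κ * ((q ^ 4 + α * g) + β * w) ^ 2 ≤ 2 * (1 - α) * Hs := by
    have e1 : 2 * (1 - α) = κ * n := by rw [hα, hκ]; field_simp; ring
    have e2 : ((q ^ 4 + α * g) + β * w) ^ 2 = Lf ^ 2 := by rw [hLf]; ring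
    rw [e1, e2, mul_assoc]
    exact mul_le_mul_of_nonneg_left hHs hκ0.le
  have hω0 : 0 ≤ r ^ p := by positivity
  have hω1 : r ^ p ≤ 1 := Real.rpow_le_one hr.le hr1.le (by linarith)
  have hrp : r ^ p = r * r ^ (p - 1) := by
    rw [← Real.rpow_one_add' hr.le (by linarith)]; ring_nf
  set a1 := p * r ^ (p - 1) - r ^ p with ha1
  set a2 := (p - 1) * (p * (r ^ (p - 2) - β) - (p * r ^ (p - 1) - r ^ p) / 2) with ha2
  set a3 := β * p * (1 - r) * r ^ (p - 1) with ha3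
  have hid : 2 * (1 - α) * Hs + (W2 * g + W1 * Lf) + 2 * α * (W1 * g)
        + β * ((p - 1) * w * (W - g - (p - 1) * g)) + q ^ 4 * ρ * (s * (1 - s) * g - s * W) =
      2 * (1 - α) * Hs - a1 * w * (q ^ 4 + α * g) - a3 * w ^ 2 + a2 * w * g
        + q ^ 4 * ρ * (s * (1 - s) * g - s * (r ^ p * w)) := by
    rw [hLf, hW2, hW1, hW, ha3, ha2, hα, ha1, hrp]
    ring
  rw [hid]
  have hpos : 0 ≤ q ^ 7 + g * q ^ 3 := by positivity
  obtain ⟨b1, b2, b3, b4⟩ := core_bdd hp hβ hr hr1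
  rcases hcase with hcase | ⟨hc1, hc2⟩
  · obtain ⟨k1, k2, k3⟩ := hcont r hcase hr1
    refine (mul_le_mul_of_nonneg_right (min_le_left _ _) hpos).trans ?_
    refine core_I (y := q ^ 4 + α * g) (κ := κ) (β := β) (p := p) (v := v) ?_ hε0 hη0 hs0 hs1 hsε hsα hp hsp k1 k2 k3 hω0 hω1 hv hw hρ hg hm hq rfl hh
    have := hquad (q ^ 4 + α * g) w
    rw [hε]; linarith
  · refine (mul_le_mul_of_nonneg_right (min_le_right _ _) hpos).trans ?_
    have hvs : v ^ s ≤ 1 := Real.rpow_le_one hv.le hc2 hs0.le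
    have hvs0 : 0 < v ^ s := by positivity
    refine core_II (y := q ^ 4 + α * g) (κ := κ) (β := β) (p := p) (θ := θ) (K := K) (C := C) hκ0 hβ hs0 hs1 hp hC0 b1 b2 b3 b4 hω0 hω1 ?_ ?_ hg hm hq rfl hh hl0 hl1 hl2 hK hθ0 hθ1 hθ2 hθ3 ?_ hc1
    · rw [hρ]; apply one_div_le_one_div_of_le (by positivity); linarith
    · rw [hρ, div_le_one (by positivity)]; linarith
    · rw [hw]; positivity

lemma final_contra {Φ q g A B T D lam c m1 R n : ℝ} (hΦ : 0 < Φ) (hΦ1 : Φ ≤ 1) (hm : 0 < m1)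
    (hn : 0 ≤ n) (hq : 0 < q) (hg : 0 ≤ g)
    (hmq : m1 ≤ Φ * q) (hR : 1 ≤ R) (hT : T ≤ (2 + 2 * n) / R ^ 2) (hB : B ≤ 4 / R ^ 2)
    (hA : A ^ 2 ≤ g * B) (hl0 : 0 ≤ lam) (hl1 : lam ≤ 1)
    (h : Φ ^ 4 * D ≤ q ^ 4 * (4 * Φ ^ 3 * T + 20 * Φ ^ 2 * B - 8 * lam * Φ ^ 3 * A))
    (hD : c * (q ^ 7 + g * q ^ 3) ≤ D) (hc : ((88 + 8 * n) / m1 ^ 3 + 8 / m1) / R < c) : False := by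
  have hR0 : 0 < R := by linarith
  have hA' : |A| ≤ 2 * Real.sqrt g / R := by
    apply abs_le_of_sq_le_sq _ (by positivity)
    calc A ^ 2 ≤ g * B := hA
      _ ≤ g * (4 / R ^ 2) := by gcongr
      _ = (2 * Real.sqrt g / R) ^ 2 := by
        rw [div_pow, mul_pow, Real.sq_sqrt hg]; ring
  set S := Real.sqrt g with hS
  have hS0 : 0 ≤ S := Real.sqrt_nonneg _
  have hSg : S ^ 2 = g := Real.sq_sqrt hg
  have h1 : Φ ^ 2 * D ≤ q ^ 4 * (4 * Φ * T + 20 * B - 8 * lam * Φ * A) := by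
    have : 0 < Φ ^ 2 := by positivity
    apply le_of_mul_le_mul_left _ this
    calc Φ ^ 2 * (Φ ^ 2 * D) = Φ ^ 4 * D := by ring
      _ ≤ _ := h
      _ = _ := by ring
  have h2 : 4 * Φ * T + 20 * B - 8 * lam * Φ * A ≤ (88 + 8 * n) / R ^ 2 + 16 * Φ * S / R := by
    have i1 : 4 * Φ * T ≤ 4 * ((2 + 2 * n) / R ^ 2) := by
      have : 0 ≤ (2 + 2 * n) / R ^ 2 := by positivity
      calc 4 * Φ * T ≤ 4 * Φ * ((2 + 2 * n) / R ^ 2) := by gcongr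
        _ ≤ 4 * 1 * ((2 + 2 * n) / R ^ 2) := by gcongr
        _ = _ := by ring
    have i2 : -(8 * lam * Φ * A) ≤ 8 * Φ * (2 * S / R) := by
      calc -(8 * lam * Φ * A) = 8 * lam * Φ * (-A) := by ring
        _ ≤ 8 * lam * Φ * |A| := by gcongr; exact neg_le_abs A
        _ ≤ 8 * 1 * Φ * (2 * S / R) := by gcongr
        _ = _ := by ring
    have i3 : 4 * ((2 + 2 * n) / R ^ 2) + 20 * (4 / R ^ 2) = (88 + 8 * n) / R ^ 2 := by ring
    have i4 : 8 * Φ * (2 * S / R) = 16 * Φ * S / R := by ring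
    linarith
  set C := 88 + 8 * n with hC
  have hC0 : 0 < C := by positivity
  set k := Φ * q with hk
  have hk0 : 0 < k := by positivity
  have hqm : m1 ≤ q := by
    have : k ≤ 1 * q := by rw [hk]; gcongr
    linarith
  have h3 : k ^ 2 * (c * (q ^ 7 + g * q ^ 3)) ≤ q ^ 6 * (C / R ^ 2) + 16 * k * (q ^ 5 * S) / R := by
    calc k ^ 2 * (c * (q ^ 7 + g * q ^ 3)) ≤ k ^ 2 * D := by gcongr
      _ = q ^ 2 * (Φ ^ 2 * D) := by rw [hk]; ring
      _ ≤ q ^ 2 * (q ^ 4 * (C / R ^ 2 + 16 * Φ * S / R)) := 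
        mul_le_mul_of_nonneg_left (h1.trans (mul_le_mul_of_nonneg_left h2 (by positivity))) (by positivity)
      _ = _ := by rw [hk]; ring
  set X := q ^ 7 + g * q ^ 3 with hX
  have hX0 : 0 < X := by positivity
  have h4 : q ^ 5 * S ≤ X / 2 := by
    have := mul_nonneg (by positivity : 0 ≤ q ^ 3) (sq_nonneg (q ^ 2 - S))
    rw [hX, ← hSg]; linarith
  have h5 : q ^ 6 ≤ X / m1 := by
    rw [le_div_iff₀ hm, hX]
    have : q ^ 6 * m1 ≤ q ^ 6 * q := by gcongr
    have : 0 ≤ g * q ^ 3 := by positivity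
    linarith
  have h6 : q ^ 6 * (C / R ^ 2) ≤ k ^ 2 * (X * (C / m1 ^ 3 / R)) := by
    calc q ^ 6 * (C / R ^ 2) ≤ X / m1 * (C / R) := by
          gcongr
          nlinarith
      _ = m1 ^ 2 * (X * (C / m1 ^ 3 / R)) := by field_simp
      _ ≤ k ^ 2 * (X * (C / m1 ^ 3 / R)) := by gcongr
  have h7 : 16 * k * (q ^ 5 * S) / R ≤ k ^ 2 * (X * (8 / m1 / R)) := by
    calc 16 * k * (q ^ 5 * S) / R ≤ 16 * k * (X / 2) / R := by gcongr
      _ = k * m1 * (X * (8 / m1 / R)) := by field_simp; ring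
      _ ≤ k * k * (X * (8 / m1 / R)) := by gcongr
      _ = _ := by ring
  have h8 : k ^ 2 * X * c ≤ k ^ 2 * X * ((C / m1 ^ 3 + 8 / m1) / R) := by
    have : (C / m1 ^ 3 + 8 / m1) / R = C / m1 ^ 3 / R + 8 / m1 / R := by ring
    rw [this]; linarith
  have := le_of_mul_le_mul_left h8 (by positivity)
  linarith

section flem
variable {E : Type*} [NormedAddCommGroup E] [NormedSpace ℝ E]

/-- log of shifted function -/
noncomputable def lf (u : E → ℝ) (ε : ℝ) : E → ℝ := fun z => Real.log (u z + ε)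

variable {u : E → ℝ} {ε p : ℝ}

lemma lf_smooth (hu : ContDiff ℝ (⊤ : ℕ∞) u) (hnn : ∀ z, 0 ≤ u z) (hε : 0 < ε) :
    ContDiff ℝ (⊤ : ℕ∞) (lf u ε) :=
  (hu.add contDiff_const).log fun z => by have := hnn z; positivity

lemma lf_exp (hnn : ∀ z, 0 ≤ u z) (hε : 0 < ε) (z : E) : Real.exp (lf u ε z) = u z + ε :=
  Real.exp_log (by have := hnn z; positivity)

lemma dD_u (hu : ContDiff ℝ (⊤ : ℕ∞) u) (hnn : ∀ z, 0 ≤ u z) (hε : 0 < ε) (v : E) :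
    dD v u = fun z => (u z + ε) * dD v (lf u ε) z := by
  have h1 := dD_exp 1 (lf_smooth hu hnn hε) v
  simp only [one_mul, lf_exp hnn hε] at h1
  rw [dD_add hu contDiff_const, dD_const] at h1
  simpa using h1

lemma dD2_u (hu : ContDiff ℝ (⊤ : ℕ∞) u) (hnn : ∀ z, 0 ≤ u z) (hε : 0 < ε) (v z : E) :
    dD v (dD v u) z = (u z + ε) * (dD v (dD v (lf u ε)) z + dD v (lf u ε) z ^ 2) := by
  rw [dD_u hu hnn hε v, dD_mul (hu.add contDiff_const) (dD_smooth (lf_smooth hu hnn hε) _),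
    dD_add hu contDiff_const, dD_const, dD_u hu hnn hε v]
  ring

variable {N : ℕ} {τ : E} {e : Fin N → E}

lemma up_smooth (hu : ContDiff ℝ (⊤ : ℕ∞) u)
    (heq : ∀ z, dD τ u z = ∑ i, dD (e i) (dD (e i) u) z + u z ^ p) :
    ContDiff ℝ (⊤ : ℕ∞) (fun z => u z ^ p) := by
  have : (fun z => u z ^ p) = fun z => dD τ u z - ∑ i, dD (e i) (dD (e i) u) z := by
    funext z; rw [heq]; ring
  rw [this]
  exact (dD_smooth hu _).sub (ContDiff.sum fun i _ => dD_smooth (dD_smooth hu _) _)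

lemma lW_smooth (hu : ContDiff ℝ (⊤ : ℕ∞) u) (hnn : ∀ z, 0 ≤ u z) (hε : 0 < ε)
    (heq : ∀ z, dD τ u z = ∑ i, dD (e i) (dD (e i) u) z + u z ^ p) :
    ContDiff ℝ (⊤ : ℕ∞) (fun z => u z ^ p / (u z + ε)) :=
  (up_smooth hu heq).div (hu.add contDiff_const) fun z => by have := hnn z; positivity

lemma lf_eq (hu : ContDiff ℝ (⊤ : ℕ∞) u) (hnn : ∀ z, 0 ≤ u z) (hε : 0 < ε)
    (heq : ∀ z, dD τ u z = ∑ i, dD (e i) (dD (e i) u) z + u z ^ p) (z : E) :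
    dD τ (lf u ε) z = ∑ i, dD (e i) (dD (e i) (lf u ε)) z + ∑ i, dD (e i) (lf u ε) z ^ 2
      + u z ^ p / (u z + ε) := by
  have h := heq z
  rw [dD_u hu hnn hε τ] at h
  simp only [dD2_u hu hnn hε] at h
  rw [← Finset.mul_sum, Finset.sum_add_distrib] at h
  have hv : 0 < u z + ε := by have := hnn z; positivity
  apply mul_left_cancel₀ hv.ne'
  rw [h]; field_simp

lemma dD_rpow (hp : 1 < p) (hu : ContDiff ℝ (⊤ : ℕ∞) u) (v z : E) :
    dD v (fun z => u z ^ p) z = p * u z ^ (p - 1) * dD v u z := by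
  have h := (sm_diff hu z).hasFDerivAt.rpow_const (p := p) (Or.inr hp.le)
  simp only [dD]; rw [h.fderiv]; simp

lemma dD_W (hp : 1 < p) (hu : ContDiff ℝ (⊤ : ℕ∞) u) (hnn : ∀ z, 0 ≤ u z) (hε : 0 < ε)
    (heq : ∀ z, dD τ u z = ∑ i, dD (e i) (dD (e i) u) z + u z ^ p) (v : E) :
    dD v (fun z => u z ^ p / (u z + ε)) =
      fun z => (p * u z ^ (p - 1) - u z ^ p / (u z + ε)) * dD v (lf u ε) z := by
  have hW := lW_smooth hu hnn hε heq
  have h1 := dD_mul hW (hu.add (contDiff_const (c := ε))) v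
  funext z
  have h2 := congrFun h1 z
  have e : (fun z => u z ^ p / (u z + ε) * (u z + ε)) = fun z => u z ^ p := by
    funext z
    have hv : 0 < u z + ε := by have := hnn z; positivity
    field_simp
  have hv : 0 < u z + ε := by have := hnn z; positivity
  rw [e, dD_rpow hp hu, dD_add hu contDiff_const, dD_const, dD_u hu hnn hε v] at h2
  apply mul_left_cancel₀ hv.ne'
  have h3 : u z ^ p / (u z + ε) * ((u z + ε) * dD v (lf u ε) z) = u z ^ p * dD v (lf u ε) z := by field_simp
  have h4 : (u z + ε) * (u z ^ p / (u z + ε)) = u z ^ p := by field_simp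
  simp only [add_zero] at h2
  linear_combination -h2 - h3 + dD v (lf u ε) z * h4

lemma dD2_W (hp : 1 < p) (hu : ContDiff ℝ (⊤ : ℕ∞) u) (hnn : ∀ z, 0 ≤ u z) (hε : 0 < ε)
    (heq : ∀ z, dD τ u z = ∑ i, dD (e i) (dD (e i) u) z + u z ^ p) (v z : E) (hz : 0 < u z) :
    dD v (dD v (fun z => u z ^ p / (u z + ε))) z =
      (p * (p - 1) * u z ^ (p - 2) * (u z + ε) - (p * u z ^ (p - 1) - u z ^ p / (u z + ε))) * dD v (lf u ε) z ^ 2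
      + (p * u z ^ (p - 1) - u z ^ p / (u z + ε)) * dD v (dD v (lf u ε)) z := by
  have hW := lW_smooth hu hnn hε heq
  have h1 := (sm_diff hu z).hasFDerivAt.rpow_const (p := p - 1) (Or.inl hz.ne')
  have h2 := (sm_diff hW z).hasFDerivAt
  have h3 := (sm_diff (dD_smooth (lf_smooth hu hnn hε) v) z).hasFDerivAt
  have h4 := ((h1.const_mul p).sub h2).mul h3
  have e2 : fderiv ℝ (fun z => u z ^ p / (u z + ε)) z v = (p * u z ^ (p - 1) - u z ^ p / (u z + ε)) * dD v (lf u ε) z :=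
    congrFun (dD_W hp hu hnn hε heq v) z
  have e1 : fderiv ℝ u z v = (u z + ε) * dD v (lf u ε) z := congrFun (dD_u hu hnn hε v) z
  rw [dD_W hp hu hnn hε heq v]
  have e0 : dD v (fun z => (p * u z ^ (p - 1) - u z ^ p / (u z + ε)) * dD v (lf u ε) z) z = _ :=
    congrArg (fun L : E →L[ℝ] ℝ => L v) h4.fderiv
  rw [e0]
  simp only [Pi.sub_apply, add_apply, smul_apply, sub_apply, smul_eq_mul, e1, e2]
  have e3 : fderiv ℝ (dD v (lf u ε)) z v = dD v (dD v (lf u ε)) z := rfl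
  rw [e3]
  have e5 : p - 1 - 1 = p - 2 := by ring
  rw [e5]
  ring

end flem


section nomax
variable {E : Type*} [NormedAddCommGroup E] [NormedSpace ℝ E]
variable {u : E → ℝ} {ε p : ℝ} {N : ℕ} {τ : E} {e : Fin N → E}

/-- The quantity Q. -/
noncomputable def Qf (u : E → ℝ) (e : Fin N → E) (ε p α β : ℝ) : E → ℝ :=
  fun z => (-1) * (∑ i, dD (e i) (dD (e i) (lf u ε)) z + α * ∑ i, dD (e i) (lf u ε) z ^ 2
      + β * Real.exp ((p - 1) * lf u ε z))

lemma Qf_smooth (hu : ContDiff ℝ (⊤ : ℕ∞) u) (hnn : ∀ z, 0 ≤ u z) (hε : 0 < ε) (α β : ℝ) :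
    ContDiff ℝ (⊤ : ℕ∞) (Qf u e ε p α β) := by
  have hf := lf_smooth hu hnn hε
  have s1 : ContDiff ℝ (⊤ : ℕ∞) (fun z => ∑ i, dD (e i) (dD (e i) (lf u ε)) z) :=
    ContDiff.sum fun i _ => dD_smooth (dD_smooth hf _) _
  have s2 : ContDiff ℝ (⊤ : ℕ∞) (fun z => ∑ i, dD (e i) (lf u ε) z ^ 2) :=
    ContDiff.sum fun i _ => (dD_smooth hf _).pow 2
  exact contDiff_const.mul ((s1.add (contDiff_const.mul s2)).add (contDiff_const.mul (sm_exp _ hf)))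

lemma min_facts (hp : 1 < p) (hu : ContDiff ℝ (⊤ : ℕ∞) u) (hnn : ∀ z, 0 ≤ u z)
    (heq : ∀ z, dD τ u z = ∑ i, dD (e i) (dD (e i) u) z + u z ^ p) {z : E} (hz : u z = 0) :
    (∀ v, dD v u z = 0) ∧ ∑ i, dD (e i) (dD (e i) u) z = 0 := by
  have h1 : IsLocalMax (fun y => (-1) * u y) z :=
    Filter.Eventually.of_forall fun y => by have := hnn y; simp only [hz]; linarith
  have h2 : ∀ v, dD v u z = 0 := fun v => by
    have := locmax_first h1 v
    rw [dD_cmul (-1) hu] at this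
    linarith
  refine ⟨h2, ?_⟩
  have := heq z
  rw [h2, hz, Real.zero_rpow (by linarith)] at this
  linarith

lemma Qf_zero (hp : 1 < p) (hu : ContDiff ℝ (⊤ : ℕ∞) u) (hnn : ∀ z, 0 ≤ u z) (hε : 0 < ε)
    (heq : ∀ z, dD τ u z = ∑ i, dD (e i) (dD (e i) u) z + u z ^ p) {α β : ℝ} (hβ : 0 < β) {z : E}
    (hQ : 0 < Qf u e ε p α β z) : 0 < u z := by
  by_contra hc
  have hz : u z = 0 := le_antisymm (not_lt.mp hc) (hnn z)
  obtain ⟨h1, h2⟩ := min_facts hp hu hnn heq hz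
  have h3 : ∀ v, dD v (lf u ε) z = 0 := fun v => by
    have := h1 v
    rw [dD_u hu hnn hε v] at this
    beta_reduce at this
    rw [hz] at this
    simpa [hε.ne'] using this
  have h4 : ∑ i, dD (e i) (dD (e i) (lf u ε)) z = 0 := by
    simp only [dD2_u hu hnn hε, h3, hz] at h2
    rw [← Finset.mul_sum] at h2
    simpa [hε.ne'] using h2
  simp only [Qf, h3, h4] at hQ
  have : 0 < β * Real.exp ((p - 1) * lf u ε z) := by positivity
  norm_num at hQ
  linarith

set_option maxHeartbeats 1000000 in
lemma no_max (hp : 1 < p) (hu : ContDiff ℝ (⊤ : ℕ∞) u) (hnn : ∀ z, 0 ≤ u z) (hε : 0 < ε)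
    (heq : ∀ z, dD τ u z = ∑ i, dD (e i) (dD (e i) u) z + u z ^ p)
    {β s r0 θ c m1 R M : ℝ} (hβ : 0 < β) (hs : 0 < s) (hs1 : s ≤ 1 / 2) (hr0 : r0 < 1) (hm : 0 < m1)
    (hθ : 0 < θ)
    (hcore : ∀ q g w r Hs v ρ W W1 W2 Lf : ℝ, m1 ≤ q → 0 ≤ g → 0 < v →
      w = v ^ (p - 1) → 0 < r → r < 1 → ρ = 1 / (1 + v ^ s) →
      W = w * r ^ p → W1 = w * (p * r ^ (p - 1) - r ^ p) → W2 = w * (p * (p - 1) * r ^ (p - 2)) - W1 →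
      Lf = -(q ^ 4 + (3 - p) / 4 * g + β * w) → Lf ^ 2 ≤ (N : ℝ) * Hs →
      (r0 ≤ r ∨ (w ≤ θ * q ^ 4 ∧ v ≤ 1)) →
      c * (q ^ 7 + g * q ^ 3) ≤ 2 * (1 - (3 - p) / 4) * Hs + (W2 * g + W1 * Lf) + 2 * ((3 - p) / 4) * (W1 * g)
        + β * ((p - 1) * w * (W - g - (p - 1) * g)) + q ^ 4 * ρ * (s * (1 - s) * g - s * W))
    (hsmall : ∀ v : ℝ, 0 < v → v ≤ ε / (1 - r0) → v ≤ 1 ∧ v ^ (p - 1) ≤ θ * m1 ^ 4)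
    {Φ : E → ℝ} (hΦ : ContDiff ℝ (⊤ : ℕ∞) Φ) {z : E}
    (hmax : IsLocalMax (fun z => Qf u e ε p ((3 - p) / 4) β z * Φ z ^ 4
      + (-M) * (1 + Real.exp ((-s) * lf u ε z))) z)
    (hM : Qf u e ε p ((3 - p) / 4) β z * Φ z ^ 4 = M * (1 + Real.exp ((-s) * lf u ε z)))
    (hMm : m1 ^ 4 ≤ M)
    (hpos : 0 < Φ z) (hΦ1 : Φ z ≤ 1) (hR : 1 ≤ R)
    (hT : dD τ Φ z - ∑ i, dD (e i) (dD (e i) Φ) z ≤ (2 + 2 * (N : ℝ)) / R ^ 2)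
    (hB : ∑ i, dD (e i) Φ z ^ 2 ≤ 4 / R ^ 2)
    (hc : ((88 + 8 * (N : ℝ)) / m1 ^ 3 + 8 / m1) / R < c) : False := by
  have hf := lf_smooth hu hnn hε
  have hfeq := lf_eq hu hnn hε heq
  have hW := lW_smooth hu hnn hε heq
  have hQs := Qf_smooth (e := e) (p := p) hu hnn hε ((3 - p) / 4) β
  have hex : 0 < Real.exp ((-s) * lf u ε z) := Real.exp_pos _
  set ex := Real.exp ((-s) * lf u ε z) with hexd
  have key := at_max (τ := τ) (e := e) hf hfeq hQs hΦ s M z hmax hM hpos _ rfl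
  have hP := opL_P hf hW hfeq ((3 - p) / 4) β (p - 1) z
  change opL τ e (lf u ε) (Qf u e ε p ((3 - p) / 4) β) z = _ at hP
  rw [hP] at key
  clear hP
  set Q := Qf u e ε p ((3 - p) / 4) β z with hQd
  have hm4 : 0 < m1 ^ 4 := by positivity
  have hQΦ : m1 ^ 4 ≤ Q * Φ z ^ 4 := by
    rw [hM]
    nlinarith
  have hQ : 0 < Q := by
    by_contra hcon
    have : Q * Φ z ^ 4 ≤ 0 := mul_nonpos_of_nonpos_of_nonneg (not_lt.mp hcon) (by positivity)
    linarith
  have huz : 0 < u z := Qf_zero hp hu hnn hε heq hβ hQ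
  have hv : 0 < u z + ε := by positivity
  set q := Q ^ (1 / 4 : ℝ) with hq
  have hq0 : 0 < q := by positivity
  have hq4 : q ^ 4 = Q := by
    rw [hq, ← Real.rpow_natCast, ← Real.rpow_mul hQ.le]; norm_num
  have hmq : m1 ≤ Φ z * q := by
    have : m1 ^ 4 ≤ (Φ z * q) ^ 4 := by rw [mul_pow, hq4]; linarith
    exact le_of_pow_le_pow_left₀ (by norm_num) (by positivity) this
  have hmq' : m1 ≤ q := by
    have : Φ z * q ≤ 1 * q := by gcongr
    linarith
  set v := u z + ε with hvd
  set r := u z / v with hr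
  have hr0' : 0 < r := by positivity
  have hr1 : r < 1 := by rw [hr, div_lt_one hv]; linarith
  have hur : u z = v * r := by rw [hr]; field_simp
  have hlog : lf u ε z = Real.log v := rfl
  have hw : Real.exp ((p - 1) * lf u ε z) = v ^ (p - 1) := by
    rw [hlog, mul_comm, Real.exp_mul, Real.exp_log hv]
  have hexv : ex = (v ^ s)⁻¹ := by
    rw [hexd, hlog, mul_comm, Real.exp_mul, Real.exp_log hv, Real.rpow_neg hv.le]
  have hvs : 0 < v ^ s := by positivity
  have hρ : ex / (1 + ex) = 1 / (1 + v ^ s) := by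
    rw [hexv]; field_simp; ring
  set w := v ^ (p - 1) with hwd
  have hvp : v ^ p = w * v := by
    rw [hwd, ← Real.rpow_add_one hv.ne']; ring_nf
  have hvp2 : w = v ^ (p - 2) * v := by
    rw [hwd, ← Real.rpow_add_one hv.ne']; ring_nf
  have hWv : u z ^ p / v = w * r ^ p := by
    rw [hur, Real.mul_rpow hv.le hr0'.le, hvp]; field_simp
  have hu1 : u z ^ (p - 1) = w * r ^ (p - 1) := by
    rw [hur, Real.mul_rpow hv.le hr0'.le]
  have hu2 : u z ^ (p - 2) * v = w * r ^ (p - 2) := by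
    rw [hur, Real.mul_rpow hv.le hr0'.le, hvp2]; ring
  have hW1 : p * u z ^ (p - 1) - u z ^ p / v = w * (p * r ^ (p - 1) - r ^ p) := by
    rw [hWv, hu1]; ring
  set W1 := w * (p * r ^ (p - 1) - r ^ p) with hW1d
  set g := ∑ i, dD (e i) (lf u ε) z ^ 2 with hg
  have hg0 : 0 ≤ g := Finset.sum_nonneg fun i _ => sq_nonneg _
  set Lf := ∑ i, dD (e i) (dD (e i) (lf u ε)) z with hLf
  set Hs := ∑ i, ∑ j, dD (e j) (dD (e i) (lf u ε)) z ^ 2 with hHs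
  have hΔW : ∑ i, dD (e i) (dD (e i) (fun z => u z ^ p / (u z + ε))) z =
      (w * (p * (p - 1) * r ^ (p - 2)) - W1) * g + W1 * Lf := by
    rw [hg, hLf, Finset.mul_sum, Finset.mul_sum, ← Finset.sum_add_distrib]
    refine Finset.sum_congr rfl fun i _ => ?_
    rw [dD2_W hp hu hnn hε heq _ _ huz, ← hvd, hW1, mul_assoc _ _ v, hu2]
    ring
  have hgW : ∑ i, dD (e i) (lf u ε) z * dD (e i) (fun z => u z ^ p / (u z + ε)) z = W1 * g := by
    rw [hg, Finset.mul_sum]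
    refine Finset.sum_congr rfl fun i _ => ?_
    rw [dD_W hp hu hnn hε heq]
    beta_reduce
    rw [← hvd, hW1]
    ring
  have hLfQ : Lf = -(q ^ 4 + (3 - p) / 4 * g + β * w) := by
    have : Q = (-1) * (Lf + (3 - p) / 4 * g + β * Real.exp ((p - 1) * lf u ε z)) := rfl
    rw [hw] at this
    rw [hq4, this]; ring
  have hCS : Lf ^ 2 ≤ (N : ℝ) * Hs := by
    have h1 : Lf ^ 2 ≤ (N : ℝ) * ∑ i, dD (e i) (dD (e i) (lf u ε)) z ^ 2 := by
      have := sq_sum_le_card_mul_sum_sq (s := Finset.univ) (f := fun i => dD (e i) (dD (e i) (lf u ε)) z)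
      simpa using this
    have h2 : ∑ i, dD (e i) (dD (e i) (lf u ε)) z ^ 2 ≤ Hs := by
      refine Finset.sum_le_sum fun i _ => ?_
      exact Finset.single_le_sum (f := fun j => dD (e j) (dD (e i) (lf u ε)) z ^ 2)
        (fun j _ => sq_nonneg _) (Finset.mem_univ i)
    exact h1.trans (by gcongr)
  have hcase : r0 ≤ r ∨ (w ≤ θ * q ^ 4 ∧ v ≤ 1) := by
    by_cases h : r0 ≤ r
    · exact Or.inl h
    · right
      have h1 : v ≤ ε / (1 - r0) := by
        rw [le_div_iff₀ (by linarith)]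
        have h2 : v * r < v * r0 := by gcongr; exact not_le.mp h
        rw [← hur] at h2
        linarith
      obtain ⟨h3, h4⟩ := hsmall v hv h1
      refine ⟨h4.trans ?_, h3⟩
      gcongr
  have hD := hcore q g w r Hs v (ex / (1 + ex)) (w * r ^ p) W1 _ Lf hmq' hg0 hv hwd hr0' hr1 hρ rfl rfl rfl hLfQ hCS hcase
  rw [hΔW, hgW, hw, hWv, ← hq4, ← hexd] at key
  have hρ0 : 0 ≤ ex / (1 + ex) := by positivity
  have hρ1 : ex / (1 + ex) ≤ 1 := by rw [div_le_one (by positivity)]; linarith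
  refine final_contra (A := ∑ i, dD (e i) (lf u ε) z * dD (e i) Φ z) (lam := 1 - s * (ex / (1 + ex))) hpos hΦ1 hm (Nat.cast_nonneg N) hq0 hg0 hmq hR hT hB ?_ ?_ ?_ ?_ hD hc
  · exact Finset.sum_mul_sq_le_sq_mul_sq _ _ _
  · exact sub_nonneg.mpr (mul_le_one₀ (hs1.trans (by norm_num)) hρ0 hρ1)
  · exact sub_le_self _ (mul_nonneg hs.le hρ0)
  · generalize ex / (1 + ex) = ρ at key ⊢
    clear_value q
    linear_combination key

end nomax


section cutoff
variable {E : Type*} [NormedAddCommGroup E] [NormedSpace ℝ E]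
variable {N : ℕ} {τ : E} {e : Fin N → E}

/-- The cutoff function. -/
noncomputable def cutF (L0 : E →L[ℝ] ℝ) (Lx : Fin N → E →L[ℝ] ℝ) (k0 k : ℝ) (z0 : E) : E → ℝ :=
  fun z => 1 - (k0 * L0 (z - z0)) * (k0 * L0 (z - z0)) - ∑ i, (k * Lx i (z - z0)) * (k * Lx i (z - z0))

lemma aff_smooth (L : E →L[ℝ] ℝ) (k : ℝ) (z0 : E) :
    ContDiff ℝ (⊤ : ℕ∞) (fun z => k * L (z - z0)) :=
  contDiff_const.mul (L.contDiff.comp (contDiff_id.sub contDiff_const))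

lemma aff_dD (L : E →L[ℝ] ℝ) (k : ℝ) (z0 v : E) :
    dD v (fun z => k * L (z - z0)) = fun _ => k * L v := by
  funext z
  have h : (fun z => k * L (z - z0)) = fun z => (k • L) z - k * L z0 := by
    funext z; simp [mul_sub]
  rw [h]
  simp only [dD]
  rw [fderiv_sub_const, ContinuousLinearMap.fderiv]
  simp

variable (L0 : E →L[ℝ] ℝ) (Lx : Fin N → E →L[ℝ] ℝ) (k0 k : ℝ) (z0 : E)

lemma cutF_smooth : ContDiff ℝ (⊤ : ℕ∞) (cutF L0 Lx k0 k z0) :=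
  (contDiff_const.sub ((aff_smooth L0 k0 z0).mul (aff_smooth L0 k0 z0))).sub
    (ContDiff.sum fun i _ => (aff_smooth (Lx i) k z0).mul (aff_smooth (Lx i) k z0))

lemma cutF_dD (v : E) : dD v (cutF L0 Lx k0 k z0) = fun z =>
    0 - ((2 * (k0 * L0 v)) * (k0 * L0 (z - z0))) - ∑ i, (2 * (k * Lx i v)) * (k * Lx i (z - z0)) := by
  unfold cutF
  rw [dD_sub (contDiff_const.sub ((aff_smooth L0 k0 z0).mul (aff_smooth L0 k0 z0)))
    (ContDiff.sum fun i _ => (aff_smooth (Lx i) k z0).mul (aff_smooth (Lx i) k z0)),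
    dD_sub contDiff_const ((aff_smooth L0 k0 z0).mul (aff_smooth L0 k0 z0)), dD_const,
    dD_mul (aff_smooth L0 k0 z0) (aff_smooth L0 k0 z0), aff_dD,
    dD_sum _ (fun i => (aff_smooth (Lx i) k z0).mul (aff_smooth (Lx i) k z0))]
  funext z
  congr 1
  · ring
  · refine Finset.sum_congr rfl fun i _ => ?_
    rw [dD_mul (aff_smooth (Lx i) k z0) (aff_smooth (Lx i) k z0), aff_dD]
    ring

lemma cutF_dD2 (v z : E) : dD v (dD v (cutF L0 Lx k0 k z0)) z =
    - (2 * (k0 * L0 v) ^ 2) - ∑ i, 2 * (k * Lx i v) ^ 2 := by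
  rw [cutF_dD, dD_sub (contDiff_const.sub (contDiff_const.mul (aff_smooth L0 k0 z0)))
    (ContDiff.sum fun i _ => contDiff_const.mul (aff_smooth (Lx i) k z0)),
    dD_sub contDiff_const (contDiff_const.mul (aff_smooth L0 k0 z0)), dD_const,
    dD_cmul _ (aff_smooth L0 k0 z0), aff_dD,
    dD_sum _ (fun i => contDiff_const.mul (aff_smooth (Lx i) k z0))]
  beta_reduce
  have h0 : 0 - 2 * (k0 * L0 v) * (k0 * L0 v) = - (2 * (k0 * L0 v) ^ 2) := by ring
  rw [h0]
  congr 1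
  refine Finset.sum_congr rfl fun i _ => ?_
  rw [dD_cmul _ (aff_smooth (Lx i) k z0), aff_dD]
  ring

lemma cutF_le_one (z : E) : cutF L0 Lx k0 k z0 z ≤ 1 := by
  unfold cutF
  have h1 := mul_self_nonneg (k0 * L0 (z - z0))
  have h2 : 0 ≤ ∑ i, (k * Lx i (z - z0)) * (k * Lx i (z - z0)) :=
    Finset.sum_nonneg fun i _ => mul_self_nonneg _
  linarith

lemma cutF_self : cutF L0 Lx k0 k z0 z0 = 1 := by
  simp [cutF]

lemma cutF_bounds (hτ0 : L0 τ = 1) (hτx : ∀ i, Lx i τ = 0) (he0 : ∀ i, L0 (e i) = 0)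
    (hex : ∀ i j, Lx i (e j) = if i = j then 1 else 0) {R : ℝ} (hR : 0 < R) (z : E)
    (hz : 0 ≤ cutF L0 Lx (1 / R ^ 2) (1 / R) z0 z) :
    dD τ (cutF L0 Lx (1 / R ^ 2) (1 / R) z0) z
      - ∑ i, dD (e i) (dD (e i) (cutF L0 Lx (1 / R ^ 2) (1 / R) z0)) z ≤ (2 + 2 * (N : ℝ)) / R ^ 2 ∧
    ∑ i, dD (e i) (cutF L0 Lx (1 / R ^ 2) (1 / R) z0) z ^ 2 ≤ 4 / R ^ 2 := by
  have hS : 0 ≤ ∑ i, ((1 / R) * Lx i (z - z0)) * ((1 / R) * Lx i (z - z0)) :=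
    Finset.sum_nonneg fun i _ => mul_self_nonneg _
  have hT := mul_self_nonneg ((1 / R ^ 2) * L0 (z - z0))
  simp only [cutF_dD2, he0]
  simp only [cutF_dD, hτ0, hτx, he0, hex]
  unfold cutF at hz
  set a := (1 / R ^ 2) * L0 (z - z0) with ha
  constructor
  · have h1 : -1 ≤ a := by nlinarith
    have h2 : -a * (1 / R ^ 2) ≤ 1 * (1 / R ^ 2) := by gcongr; linarith
    have h3 : (2 + 2 * (N : ℝ)) / R ^ 2 = 2 * (1 / R ^ 2) + N * (2 * (1 / R) ^ 2) := by ring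
    rw [h3]
    simp
    simp at h2
    linarith
  · have h1 : ∀ i : Fin N, (0 - 2 * (1 / R ^ 2 * 0) * a - ∑ j, 2 * (1 / R * if j = i then (1:ℝ) else 0) * (1 / R * Lx j (z - z0))) ^ 2
        = 4 / R ^ 2 * (((1 / R) * Lx i (z - z0)) * ((1 / R) * Lx i (z - z0))) := by
      intro i
      simp
      ring
    simp only [h1]
    rw [← Finset.mul_sum]
    calc 4 / R ^ 2 * ∑ i, ((1 / R) * Lx i (z - z0)) * ((1 / R) * Lx i (z - z0)) ≤ 4 / R ^ 2 * 1 := by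
          gcongr; linarith
      _ = _ := by ring

end cutoff

section claim
variable {E : Type*} [NormedAddCommGroup E] [NormedSpace ℝ E]
variable {N : ℕ} {τ : E} {e : Fin N → E} {u : E → ℝ} {p : ℝ}

lemma Qf_formula (hu : ContDiff ℝ (⊤ : ℕ∞) u) (hnn : ∀ z, 0 ≤ u z) {ε : ℝ} (hε : 0 < ε) (α β : ℝ) (z : E) :
    Qf u e ε p α β z = -((∑ i, dD (e i) (dD (e i) u) z) / (u z + ε)
      - (1 - α) * (∑ i, dD (e i) u z ^ 2) / (u z + ε) ^ 2 + β * (u z + ε) ^ (p - 1)) := by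
  have hv : 0 < u z + ε := by have := hnn z; positivity
  have h1 : ∑ i, dD (e i) u z ^ 2 = (u z + ε) ^ 2 * ∑ i, dD (e i) (lf u ε) z ^ 2 := by
    rw [Finset.mul_sum]
    refine Finset.sum_congr rfl fun i _ => ?_
    rw [dD_u hu hnn hε]; ring
  have h2 : ∑ i, dD (e i) (dD (e i) u) z = (u z + ε) * (∑ i, dD (e i) (dD (e i) (lf u ε)) z
      + ∑ i, dD (e i) (lf u ε) z ^ 2) := by
    rw [← Finset.sum_add_distrib, Finset.mul_sum]
    exact Finset.sum_congr rfl fun i _ => dD2_u hu hnn hε _ _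
  have hw : Real.exp ((p - 1) * lf u ε z) = (u z + ε) ^ (p - 1) := by
    rw [mul_comm, Real.exp_mul, lf_exp hnn hε]
  rw [h1, h2]
  simp only [Qf, hw]
  field_simp
  ring

lemma claim_pos (hp : 1 < p) (hN : 1 ≤ N) (hpn : (N : ℝ) * p * (p - 1) < (p + 1) ^ 2)
    (hu : ContDiff ℝ (⊤ : ℕ∞) u) (hnn : ∀ z, 0 ≤ u z)
    (heq : ∀ z, dD τ u z = ∑ i, dD (e i) (dD (e i) u) z + u z ^ p)
    (L0 : E →L[ℝ] ℝ) (Lx : Fin N → E →L[ℝ] ℝ)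
    (hτ0 : L0 τ = 1) (hτx : ∀ i, Lx i τ = 0) (he0 : ∀ i, L0 (e i) = 0)
    (hex : ∀ i j, Lx i (e j) = if i = j then 1 else 0)
    (hK : ∀ R : ℝ, 0 < R → ∀ z0, IsCompact {z | 0 ≤ cutF L0 Lx (1 / R ^ 2) (1 / R) z0 z}) :
    ∃ β : ℝ, β < 1 ∧ ∀ z, 0 < u z → 0 ≤ (∑ i, dD (e i) (dD (e i) u) z) / u z
      - (1 - (3 - p) / 4) * (∑ i, dD (e i) u z ^ 2) / u z ^ 2 + β * u z ^ (p - 1) := by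
  obtain ⟨β, s, r0, θ, hβ, hβ1, hs, hs1, hr0, hr01, hθ, hcore⟩ :=
    core_all hp (by exact_mod_cast hN : (1 : ℝ) ≤ N) hpn
  refine ⟨β, hβ1, fun z0 hz0 => ?_⟩
  by_contra hcon
  push Not at hcon
  set a := ∑ i, dD (e i) (dD (e i) u) z0 with ha
  set b := ∑ i, dD (e i) u z0 ^ 2 with hb
  set α := (3 - p) / 4 with hα
  set F : ℝ → ℝ := fun ε => -(a / (u z0 + ε) - (1 - α) * b / (u z0 + ε) ^ 2 + β * (u z0 + ε) ^ (p - 1))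
    / (1 + (u z0 + ε) ^ (-s)) with hF
  have hz0' : u z0 + 0 ≠ 0 := by simpa using hz0.ne'
  have hFc : ContinuousAt F 0 := by
    have c1 : ContinuousAt (fun ε : ℝ => u z0 + ε) 0 := by fun_prop
    have c2 : ContinuousAt (fun ε : ℝ => (u z0 + ε) ^ (p - 1)) 0 := c1.rpow_const (Or.inl hz0')
    have c3 : ContinuousAt (fun ε : ℝ => (u z0 + ε) ^ (-s)) 0 := c1.rpow_const (Or.inl hz0')
    refine ContinuousAt.div ?_ (continuousAt_const.add c3) ?_
    · exact (((continuousAt_const.div c1 hz0').sub (continuousAt_const.div (c1.pow 2) (pow_ne_zero 2 hz0'))).add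
        (continuousAt_const.mul c2)).neg
    · have : 0 < (u z0 + 0) ^ (-s) := by apply Real.rpow_pos_of_pos; simpa using hz0
      positivity
  have hF0 : 0 < F 0 := by
    simp only [hF, add_zero]
    have : 0 < (u z0) ^ (-s) := by positivity
    apply div_pos _ (by positivity)
    linarith
  set m1 := (F 0 / 2) ^ (1 / 4 : ℝ) with hm1
  have hm : 0 < m1 := by positivity
  have hm4 : m1 ^ 4 = F 0 / 2 := by
    rw [hm1, ← Real.rpow_natCast, ← Real.rpow_mul (by positivity)]; norm_num
  obtain ⟨c, hc, hcore⟩ := hcore m1 hm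
  have ev1 : ∀ᶠ ε in nhds (0:ℝ), m1 ^ 4 < F ε :=
    hFc.eventually (lt_mem_nhds (by rw [hm4]; linarith))
  have hc1 : Continuous (fun ε : ℝ => ε / (1 - r0)) := by fun_prop
  have ev2 : ∀ᶠ ε in nhds (0:ℝ), ε / (1 - r0) < 1 :=
    hc1.continuousAt.eventually (gt_mem_nhds (by simp))
  have ev3 : ∀ᶠ ε in nhds (0:ℝ), (ε / (1 - r0)) ^ (p - 1) < θ * m1 ^ 4 := by
    have : ContinuousAt (fun ε : ℝ => (ε / (1 - r0)) ^ (p - 1)) 0 :=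
      hc1.continuousAt.rpow_const (Or.inr (by linarith))
    refine this.eventually (gt_mem_nhds ?_)
    simp only [zero_div]
    rw [Real.zero_rpow (by linarith)]
    positivity
  have ev : ∀ᶠ ε in nhdsWithin (0:ℝ) (Set.Ioi 0), (m1 ^ 4 < F ε ∧ ε / (1 - r0) < 1 ∧
      (ε / (1 - r0)) ^ (p - 1) < θ * m1 ^ 4) ∧ 0 < ε :=
    ((ev1.and (ev2.and ev3)).filter_mono nhdsWithin_le_nhds).and self_mem_nhdsWithin
  obtain ⟨ε, ⟨hε1, hε2, hε3⟩, hε⟩ := ev.exists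
  have hsmall : ∀ v : ℝ, 0 < v → v ≤ ε / (1 - r0) → v ≤ 1 ∧ v ^ (p - 1) ≤ θ * m1 ^ 4 := by
    intro v hv hv1
    refine ⟨hv1.trans hε2.le, le_trans ?_ hε3.le⟩
    exact Real.rpow_le_rpow hv.le hv1 (by linarith)
  set C := (88 + 8 * (N : ℝ)) / m1 ^ 3 + 8 / m1 with hC
  have hC0 : 0 < C := by positivity
  set R := max 1 (C / c + 1) with hRd
  have hR : 1 ≤ R := le_max_left _ _
  have hR0 : 0 < R := by linarith
  have hRc : C / R < c := by
    have : C / c + 1 ≤ R := le_max_right _ _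
    rw [div_lt_iff₀ hR0, mul_comm, ← div_lt_iff₀ hc]
    linarith
  set Φ := cutF L0 Lx (1 / R ^ 2) (1 / R) z0 with hΦd
  have hΦ : ContDiff ℝ (⊤ : ℕ∞) Φ := cutF_smooth _ _ _ _ _
  have hf := lf_smooth hu hnn hε
  have hQs := Qf_smooth (e := e) (p := p) hu hnn hε α β
  set G : E → ℝ := fun z => Qf u e ε p α β z * Φ z ^ 4 / (1 + Real.exp ((-s) * lf u ε z)) with hG
  have hden : ∀ z, 0 < 1 + Real.exp ((-s) * lf u ε z) := fun z => by positivity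
  have hGc : Continuous G :=
    (hQs.continuous.mul (hΦ.continuous.pow 4)).div
      (continuous_const.add (sm_exp (-s) hf).continuous) fun z => (hden z).ne'
  have hz0K : z0 ∈ {z | 0 ≤ Φ z} := by
    show 0 ≤ Φ z0
    rw [hΦd, cutF_self]; norm_num
  obtain ⟨z1, hz1K, hz1⟩ := (hK R hR0 z0).exists_isMaxOn ⟨z0, hz0K⟩ hGc.continuousOn
  have hG0 : m1 ^ 4 ≤ G z0 := by
    have h1 : G z0 = F ε := by
      have e1 : Φ z0 = 1 := by rw [hΦd, cutF_self]
      have e2 : Real.exp ((-s) * lf u ε z0) = (u z0 + ε) ^ (-s) := by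
        rw [mul_comm, Real.exp_mul, lf_exp hnn hε]
      simp only [hG, hF]
      rw [e1, e2, Qf_formula hu hnn hε]
      simp [ha, hb]
    rw [h1]; exact hε1.le
  have hMm : m1 ^ 4 ≤ G z1 := hG0.trans (hz1 hz0K)
  have hm40 : 0 < m1 ^ 4 := by positivity
  have hz1K' : 0 ≤ Φ z1 := hz1K
  have hpos : 0 < Φ z1 := by
    rcases hz1K'.lt_or_eq with h | h
    · exact h
    · exfalso
      have : G z1 = 0 := by simp [hG, ← h]
      linarith
  have hM : Qf u e ε p α β z1 * Φ z1 ^ 4 = G z1 * (1 + Real.exp ((-s) * lf u ε z1)) := by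
    simp only [hG]; have := (hden z1).ne'; field_simp
  have hmax : IsLocalMax (fun z => Qf u e ε p α β z * Φ z ^ 4
      + (-G z1) * (1 + Real.exp ((-s) * lf u ε z))) z1 := by
    have ev : ∀ᶠ z in nhds z1, 0 < Φ z := hΦ.continuous.continuousAt.eventually (lt_mem_nhds hpos)
    filter_upwards [ev] with z hz
    have h1 : G z ≤ G z1 := hz1 (show 0 ≤ Φ z from hz.le)
    have h2 : Qf u e ε p α β z * Φ z ^ 4 ≤ G z1 * (1 + Real.exp ((-s) * lf u ε z)) :=
      (div_le_iff₀ (hden z)).mp h1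
    rw [hM]
    linarith
  obtain ⟨hT, hB⟩ := cutF_bounds (τ := τ) (e := e) L0 Lx z0 hτ0 hτx he0 hex hR0 z1 hz1K
  exact no_max (τ := τ) (e := e) hp hu hnn hε heq hβ hs hs1 hr01 hm hθ hcore hsmall hΦ hmax hM hMm hpos (cutF_le_one _ _ _ _ _ _) hR hT hB hRc

end claim

section conc
variable {N : ℕ}

/-- projection functionals -/
noncomputable def prX (i : Fin N) : ℝ × EuclideanSpace ℝ (Fin N) →L[ℝ] ℝ :=
  (EuclideanSpace.proj i : EuclideanSpace ℝ (Fin N) →L[ℝ] ℝ).comp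
    (ContinuousLinearMap.snd ℝ ℝ (EuclideanSpace ℝ (Fin N)))

lemma prX_apply (i : Fin N) (z : ℝ × EuclideanSpace ℝ (Fin N)) : prX i z = z.2 i := rfl

lemma cut_compact (R : ℝ) (hR : 0 < R) (z0 : ℝ × EuclideanSpace ℝ (Fin N)) :
    IsCompact {z | 0 ≤ cutF (ContinuousLinearMap.fst ℝ ℝ (EuclideanSpace ℝ (Fin N))) prX
      (1 / R ^ 2) (1 / R) z0 z} := by
  have hcl : IsClosed {z | 0 ≤ cutF (ContinuousLinearMap.fst ℝ ℝ (EuclideanSpace ℝ (Fin N))) prX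
      (1 / R ^ 2) (1 / R) z0 z} :=
    isClosed_le continuous_const (cutF_smooth _ _ _ _ _).continuous
  refine ((isCompact_closedBall z0.1 (R ^ 2)).prod (isCompact_closedBall z0.2 R)).of_isClosed_subset hcl ?_
  intro z hz
  have hz' : 0 ≤ cutF (ContinuousLinearMap.fst ℝ ℝ (EuclideanSpace ℝ (Fin N))) prX
      (1 / R ^ 2) (1 / R) z0 z := hz
  simp only [cutF, prX_apply, ContinuousLinearMap.coe_fst', Prod.fst_sub, Prod.snd_sub] at hz'
  have e1 : ∑ i, (1 / R * (z.2 - z0.2) i) * (1 / R * (z.2 - z0.2) i) = ‖z.2 - z0.2‖ ^ 2 / R ^ 2 := by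
    rw [EuclideanSpace.norm_sq_eq, Finset.sum_div]
    refine Finset.sum_congr rfl fun i _ => ?_
    rw [Real.norm_eq_abs, sq_abs]; ring
  rw [e1] at hz'
  have e2 : (1 / R ^ 2 * (z.1 - z0.1)) * (1 / R ^ 2 * (z.1 - z0.1)) = (z.1 - z0.1) ^ 2 / (R ^ 2) ^ 2 := by
    field_simp
  rw [e2] at hz'
  have p1 : 0 ≤ (z.1 - z0.1) ^ 2 / (R ^ 2) ^ 2 := by positivity
  have p2 : 0 ≤ ‖z.2 - z0.2‖ ^ 2 / R ^ 2 := by positivity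
  have q1 : (z.1 - z0.1) ^ 2 / (R ^ 2) ^ 2 ≤ 1 := by linarith
  have q2 : ‖z.2 - z0.2‖ ^ 2 / R ^ 2 ≤ 1 := by linarith
  rw [div_le_one (by positivity)] at q1 q2
  refine Set.mem_prod.mpr ⟨?_, ?_⟩
  · rw [Metric.mem_closedBall, Real.dist_eq]
    exact abs_le_of_sq_le_sq q1 (by positivity)
  · rw [Metric.mem_closedBall, dist_eq_norm]
    exact le_of_sq_le_sq q2 hR.le

lemma slice_fderiv {F : ℝ × EuclideanSpace ℝ (Fin N) → ℝ} (hF : ContDiff ℝ (⊤ : ℕ∞) F) (t : ℝ)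
    (y v : EuclideanSpace ℝ (Fin N)) :
    fderiv ℝ (fun y => F (t, y)) y v = dD ((0 : ℝ), v) F (t, y) := by
  have h := (sm_diff hF (t, y)).hasFDerivAt.comp y (hasFDerivAt_prodMk_right t y)
  have h' : HasFDerivAt (fun y => F (t, y)) _ y := h
  rw [h'.fderiv]
  simp [dD]

lemma slice_deriv {F : ℝ × EuclideanSpace ℝ (Fin N) → ℝ} (hF : ContDiff ℝ (⊤ : ℕ∞) F) (t : ℝ)
    (x : EuclideanSpace ℝ (Fin N)) :
    HasDerivAt (fun s => F (s, x)) (dD ((1 : ℝ), (0 : EuclideanSpace ℝ (Fin N))) F (t, x)) t := by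
  have h1 : HasDerivAt (fun s : ℝ => (s, x)) ((1 : ℝ), (0 : EuclideanSpace ℝ (Fin N))) t :=
    (hasDerivAt_id t).prodMk (hasDerivAt_const t x)
  exact (sm_diff hF (t, x)).hasFDerivAt.comp_hasDerivAt t h1

lemma eq_translate {u : ℝ × EuclideanSpace ℝ (Fin N) → ℝ} (hu : ContDiff ℝ (⊤ : ℕ∞) u) {p : ℝ}
    (heq : ∀ t x, partialT u t x = slap u t x + u (t, x) ^ p) (z : ℝ × EuclideanSpace ℝ (Fin N)) :
    dD ((1 : ℝ), (0 : EuclideanSpace ℝ (Fin N))) u z =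
      ∑ i, dD ((0 : ℝ), EuclideanSpace.single i (1 : ℝ)) (dD ((0 : ℝ), EuclideanSpace.single i (1 : ℝ)) u) z
        + u z ^ p := by
  obtain ⟨t, x⟩ := z
  have h := heq t x
  unfold partialT slap lap pd2 at h
  rw [(slice_deriv hu t x).deriv] at h
  simp only [slice_fderiv hu] at h
  simp only [slice_fderiv (dD_smooth hu _)] at h
  exact h

lemma pStar_ineq (hN : 1 ≤ N) {p : ℝ} (hp : 1 < p) (hp' : p < pStar N) :
    (N : ℝ) * p * (p - 1) < (p + 1) ^ 2 := by
  unfold pStar at hp'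
  split_ifs at hp' with h
  · have hN2 : (2 : ℝ) ≤ N := by exact_mod_cast h
    set S := Real.sqrt ((N : ℝ) ^ 2 + 8 * N) with hS
    have hSS : S ^ 2 = (N : ℝ) ^ 2 + 8 * N := Real.sq_sqrt (by positivity)
    have hS2 : (N : ℝ) + 2 ≤ S := Real.le_sqrt_of_sq_le (by nlinarith)
    rw [lt_div_iff₀ (by linarith)] at hp'
    have h1 : p * (2 * ((N : ℝ) - 1)) - (N + 2) < S := by linarith
    have h2 : -S < p * (2 * ((N : ℝ) - 1)) - (N + 2) := by nlinarith
    have h3 := sq_lt_sq' h2 h1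
    rw [hSS] at h3
    have h4 : 4 * ((N : ℝ) - 1) * ((N : ℝ) * p * (p - 1)) < 4 * ((N : ℝ) - 1) * ((p + 1) ^ 2) := by
      nlinarith
    exact lt_of_mul_lt_mul_left h4 (by linarith)
  · have : N = 1 := by omega
    subst this
    push_cast
    nlinarith

lemma blowup {φ φ' : ℝ → ℝ} {p κ : ℝ} (hp : 1 < p) (hκ : 0 < κ) (hφ : ∀ t, 0 ≤ φ t)
    (hd : ∀ t, HasDerivAt φ (φ' t) t) (hi : ∀ t, κ * φ t ^ p ≤ φ' t) (t0 : ℝ) : φ t0 = 0 := by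
  by_contra hne
  have h0 : 0 < φ t0 := lt_of_le_of_ne (hφ t0) (Ne.symm hne)
  have hmono : Monotone φ := by
    apply monotone_of_deriv_nonneg (fun t => (hd t).differentiableAt)
    intro t
    rw [(hd t).deriv]
    exact le_trans (by have := hφ t; positivity) (hi t)
  have hpos : ∀ t, t0 ≤ t → 0 < φ t := fun t ht => h0.trans_le (hmono ht)
  have hder : ∀ t, t0 ≤ t → HasDerivAt (fun t => φ t ^ (1 - p) + (p - 1) * κ * t)
      (φ' t * (1 - p) * φ t ^ (1 - p - 1) + (p - 1) * κ * 1) t := fun t ht =>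
    ((hd t).rpow_const (Or.inl (hpos t ht).ne')).add ((hasDerivAt_id t).const_mul _)
  have hanti : AntitoneOn (fun t => φ t ^ (1 - p) + (p - 1) * κ * t) (Set.Ici t0) := by
    apply antitoneOn_of_deriv_nonpos (convex_Ici t0)
    · exact fun t ht => (hder t ht).continuousAt.continuousWithinAt
    · intro t ht
      rw [interior_Ici] at ht
      exact (hder t (le_of_lt ht)).differentiableAt.differentiableWithinAt
    · intro t ht
      rw [interior_Ici] at ht
      have ht' : t0 ≤ t := le_of_lt ht
      rw [(hder t ht').deriv]
      have hP := hpos t ht'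
      have e1 : φ t ^ p * φ t ^ (1 - p - 1) = 1 := by
        rw [← Real.rpow_add hP]; ring_nf; exact Real.rpow_zero _
      have hX : 0 < φ t ^ (1 - p - 1) := by positivity
      have h1 : κ * φ t ^ p * φ t ^ (1 - p - 1) ≤ φ' t * φ t ^ (1 - p - 1) :=
        mul_le_mul_of_nonneg_right (hi t) hX.le
      rw [mul_assoc, e1] at h1
      have h2 := mul_le_mul_of_nonneg_left h1 (by linarith : 0 ≤ p - 1)
      linarith
  set A := φ t0 ^ (1 - p) + (p - 1) * κ * t0 with hA
  have hpk : 0 < (p - 1) * κ := mul_pos (by linarith) hκ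
  set T := max t0 (A / ((p - 1) * κ)) with hT
  have hT0 : t0 ≤ T := le_max_left _ _
  have h1 := hanti (Set.mem_Ici.mpr le_rfl) (Set.mem_Ici.mpr hT0) hT0
  have h2 : A / ((p - 1) * κ) ≤ T := le_max_right _ _
  rw [div_le_iff₀ hpk] at h2
  have h3 : 0 < φ T ^ (1 - p) := Real.rpow_pos_of_pos (hpos T hT0) _
  simp only at h1
  linarith

end conc

/-- Parabolic Liouville theorem (Euclidean case): for `1 < p < p_*(N)`, every smooth
nonnegative entire solution of `∂ₜ u = Δu + uᵖ` on `ℝ × ℝ^N` is identically zero. -/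
theorem parabolic_liouville_euclidean {N : ℕ} (hN : 1 ≤ N) (p : ℝ) (hp : 1 < p)
    (hp' : p < pStar N)
    (u : ℝ × EuclideanSpace ℝ (Fin N) → ℝ) (hu : ContDiff ℝ (⊤ : ℕ∞) u)
    (hnonneg : ∀ z, 0 ≤ u z)
    (heq : ∀ t x, partialT u t x = slap u t x + u (t, x) ^ p) :
    ∀ z, u z = 0 := by
  have heq' := eq_translate hu heq
  obtain ⟨β, hβ1, hQ⟩ := claim_pos (τ := ((1 : ℝ), (0 : EuclideanSpace ℝ (Fin N))))
    (e := fun i => ((0 : ℝ), EuclideanSpace.single i (1 : ℝ))) hp hN (pStar_ineq hN hp hp') hu hnonneg heq'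
    (ContinuousLinearMap.fst ℝ ℝ (EuclideanSpace ℝ (Fin N))) prX (by simp) (by simp [prX_apply])
    (by simp) (by intro i j; simp [prX_apply, Pi.single_apply]) cut_compact
  have hi : ∀ z, (1 - β) * u z ^ p ≤ dD ((1 : ℝ), (0 : EuclideanSpace ℝ (Fin N))) u z := by
    intro z
    rcases (hnonneg z).lt_or_eq with h | h
    · rw [heq']
      have h1 := hQ z h
      set a := ∑ i : Fin N, dD ((0 : ℝ), EuclideanSpace.single i (1 : ℝ)) (dD ((0 : ℝ), EuclideanSpace.single i (1 : ℝ)) u) z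
      have hb : 0 ≤ ∑ i : Fin N, dD ((0 : ℝ), EuclideanSpace.single i (1 : ℝ)) u z ^ 2 :=
        Finset.sum_nonneg fun i _ => sq_nonneg _
      set b := ∑ i : Fin N, dD ((0 : ℝ), EuclideanSpace.single i (1 : ℝ)) u z ^ 2
      have h2 : 0 ≤ (1 - (3 - p) / 4) * b / u z ^ 2 :=
        div_nonneg (mul_nonneg (by linarith) hb) (by positivity)
      have h3 : 0 ≤ a / u z + β * u z ^ (p - 1) := by linarith
      have h4 := mul_nonneg h3 h.le
      have h5 : u z ^ p = u z ^ (p - 1) * u z := by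
        rw [← Real.rpow_add_one h.ne']; ring_nf
      have h6 : (a / u z + β * u z ^ (p - 1)) * u z = a + β * u z ^ p := by
        rw [h5]; field_simp
      rw [h6] at h4
      linarith
    · have := (min_facts hp hu hnonneg heq' h.symm).1
      rw [this, ← h, Real.zero_rpow (by linarith)]
      simp
  rintro ⟨t, x⟩
  exact blowup (φ := fun t => u (t, x)) hp (by linarith : 0 < 1 - β) (fun t => hnonneg _)
    (fun t => slice_deriv hu t x) (fun t => hi (t, x)) t
end

section
/- Let N ≥ 1 be an integer and p a real with 1 < p < p_*(N). Then there is no smooth function u : EuclideanSpace ℝ (Fin N) → ℝ with u > 0 everywhere satisfying −Δu = u^p on all of ℝ^N. -/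
open scoped ContDiff

namespace LiouvilleAux

/-- Partial derivative in direction `i`. -/
noncomputable def dd {N : ℕ} (i : Fin N) (f : EuclideanSpace ℝ (Fin N) → ℝ)
    (x : EuclideanSpace ℝ (Fin N)) : ℝ :=
  fderiv ℝ f x (EuclideanSpace.single i 1)

variable {N : ℕ}

lemma dd_smooth (i : Fin N) {f : EuclideanSpace ℝ (Fin N) → ℝ} (hf : ContDiff ℝ ∞ f) :
    ContDiff ℝ ∞ (dd i f) := by
  have : ContDiff ℝ ∞ (fderiv ℝ f) := hf.fderiv_right (by simp)
  exact this.clm_apply contDiff_const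

lemma da {f : EuclideanSpace ℝ (Fin N) → ℝ} (hf : ContDiff ℝ ∞ f)
    (x : EuclideanSpace ℝ (Fin N)) : DifferentiableAt ℝ f x :=
  (hf.differentiable (by simp)) x

lemma dd_mul (i : Fin N) {f g : EuclideanSpace ℝ (Fin N) → ℝ} (hf : ContDiff ℝ ∞ f)
    (hg : ContDiff ℝ ∞ g) (x : EuclideanSpace ℝ (Fin N)) :
    dd i (fun y => f y * g y) x = dd i f x * g x + f x * dd i g x := by
  unfold dd
  rw [fderiv_fun_mul (da hf x) (da hg x)]
  simp
  ring

lemma dd_add (i : Fin N) {f g : EuclideanSpace ℝ (Fin N) → ℝ} (hf : ContDiff ℝ ∞ f)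
    (hg : ContDiff ℝ ∞ g) (x : EuclideanSpace ℝ (Fin N)) :
    dd i (fun y => f y + g y) x = dd i f x + dd i g x := by
  unfold dd
  rw [fderiv_fun_add (da hf x) (da hg x)]
  simp

lemma dd_const_sub (i : Fin N) {f : EuclideanSpace ℝ (Fin N) → ℝ} (c : ℝ)
    (x : EuclideanSpace ℝ (Fin N)) :
    dd i (fun y => c - f y) x = - dd i f x := by
  unfold dd
  rw [fderiv_const_sub]
  simp

lemma dd_const_mul (i : Fin N) {f : EuclideanSpace ℝ (Fin N) → ℝ} (hf : ContDiff ℝ ∞ f) (c : ℝ)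
    (x : EuclideanSpace ℝ (Fin N)) :
    dd i (fun y => c * f y) x = c * dd i f x := by
  unfold dd
  rw [fderiv_const_mul (da hf x)]
  simp

lemma dd_sum (i : Fin N) {f : Fin N → EuclideanSpace ℝ (Fin N) → ℝ}
    (hf : ∀ j, ContDiff ℝ ∞ (f j)) (x : EuclideanSpace ℝ (Fin N)) :
    dd i (fun y => ∑ j, f j y) x = ∑ j, dd i (f j) x := by
  unfold dd
  rw [fderiv_fun_sum (fun j _ => da (hf j) x)]
  simp

lemma dd_comp (i : Fin N) {f : EuclideanSpace ℝ (Fin N) → ℝ} (hf : ContDiff ℝ ∞ f)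
    {g : ℝ → ℝ} {g' : ℝ} (x : EuclideanSpace ℝ (Fin N)) (hg : HasDerivAt g g' (f x)) :
    dd i (fun y => g (f y)) x = g' * dd i f x := by
  unfold dd
  have := (hg.comp_hasFDerivAt x (da hf x).hasFDerivAt).fderiv
  simp only [Function.comp_def] at this
  rw [this]
  simp

lemma dd_coord (i j : Fin N) (x : EuclideanSpace ℝ (Fin N)) :
    dd i (fun y => y j) x = if i = j then 1 else 0 := by
  unfold dd
  have : (fun y : EuclideanSpace ℝ (Fin N) => y j) = EuclideanSpace.proj (𝕜 := ℝ) j := rfl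
  rw [this, ContinuousLinearMap.fderiv]
  simp [eq_comm]

lemma coord_smooth (j : Fin N) :
    ContDiff ℝ ∞ (fun y : EuclideanSpace ℝ (Fin N) => y j) :=
  (EuclideanSpace.proj (𝕜 := ℝ) j).contDiff

lemma dd_comm (i j : Fin N) {f : EuclideanSpace ℝ (Fin N) → ℝ} (hf : ContDiff ℝ ∞ f)
    (x : EuclideanSpace ℝ (Fin N)) : dd i (dd j f) x = dd j (dd i f) x := by
  have h1 : ContDiff ℝ ∞ (fderiv ℝ f) := hf.fderiv_right (by simp)
  have hd : DifferentiableAt ℝ (fderiv ℝ f) x := (h1.differentiable (by simp)) x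
  have key : ∀ a b : Fin N, dd a (dd b f) x =
      fderiv ℝ (fderiv ℝ f) x (EuclideanSpace.single a 1) (EuclideanSpace.single b 1) := by
    intro a b
    have : dd b f = fun y => fderiv ℝ f y (EuclideanSpace.single b 1) := rfl
    rw [this]
    unfold dd
    rw [fderiv_clm_apply hd (differentiableAt_const _)]
    simp
  rw [key, key]
  have hs : IsSymmSndFDerivAt ℝ f x := by
    apply (hf.contDiffAt).isSymmSndFDerivAt
    rw [minSmoothness_of_isRCLikeNormedField]
    exact WithTop.coe_le_coe.2 (le_top : (2 : ℕ∞) ≤ ⊤)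
  exact hs _ _

lemma dd_max (i : Fin N) {f : EuclideanSpace ℝ (Fin N) → ℝ}
    {x : EuclideanSpace ℝ (Fin N)} (hm : IsLocalMax f x) : dd i f x = 0 := by
  unfold dd
  rw [hm.fderiv_eq_zero]; simp

lemma dd_dd_max (i : Fin N) {f : EuclideanSpace ℝ (Fin N) → ℝ} (hf : ContDiff ℝ ∞ f)
    {x : EuclideanSpace ℝ (Fin N)} (hm : IsLocalMax f x) : dd i (dd i f) x ≤ 0 := by
  by_contra! hpos
  set e : EuclideanSpace ℝ (Fin N) := EuclideanSpace.single i 1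
  have hline : ∀ t : ℝ, HasDerivAt (fun t : ℝ => x + t • e) e t := by
    intro t
    simpa using ((hasDerivAt_id t).smul_const e).const_add x
  have hder : ∀ {g : EuclideanSpace ℝ (Fin N) → ℝ}, ContDiff ℝ ∞ g →
      deriv (fun t : ℝ => g (x + t • e)) = fun t => dd i g (x + t • e) := by
    intro g hg
    funext t
    exact ((da hg (x + t • e)).hasFDerivAt.comp_hasDerivAt t (hline t)).deriv
  set g : ℝ → ℝ := fun t => f (x + t • e) with hgdef
  have h1 : deriv g = fun t => dd i f (x + t • e) := hder hf
  have h2 : deriv (deriv g) = fun t => dd i (dd i f) (x + t • e) := by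
    rw [h1]; exact hder (dd_smooth i hf)
  have hcont : Continuous (fun t : ℝ => x + t • e) := by fun_prop
  have hmax : IsLocalMax g 0 := by
    have : Filter.Tendsto (fun t : ℝ => x + t • e) (nhds 0) (nhds x) := by
      have := hcont.tendsto 0
      simpa using this
    have h := this.eventually hm
    simpa [IsLocalMax, IsMaxFilter, hgdef] using h
  have hmin : IsLocalMin g 0 := by
    apply isLocalMin_of_deriv_deriv_pos
    · rw [h2]; simpa using hpos
    · exact hmax.deriv_eq_zero
    · exact (hf.continuous.comp hcont).continuousAt
  have hc : g =ᶠ[nhds 0] fun _ => g 0 := by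
    filter_upwards [hmax, hmin] with t h1 h2
    exact le_antisymm h1 h2
  have h3 : deriv (deriv g) 0 = 0 := by
    have := hc.deriv.deriv_eq
    rw [this]; simp
  rw [h2] at h3
  simp only [zero_smul, add_zero] at h3
  linarith

lemma cs_aux (a : Fin N → ℝ) (A : Fin N → Fin N → ℝ) (f K L : ℝ)
    (hf : f = ∑ i, a i ^ 2) (hK : K = ∑ i, ∑ j, a i * a j * A i j) (hL : L = ∑ i, A i i) :
    (f * L - K) ^ 2 ≤ ((N : ℝ) - 1) * f ^ 2 * ∑ i, ∑ j, A i j ^ 2 := by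
  set B : Fin N → Fin N → ℝ := fun i j => (if i = j then f else 0) - a i * a j with hB
  have h1 : ∑ z : Fin N × Fin N, A z.1 z.2 * B z.1 z.2 = f * L - K := by
    rw [Fintype.sum_prod_type, hK, hL]
    simp only [hB, mul_sub, Finset.sum_sub_distrib, mul_ite, mul_zero]
    simp only [Finset.sum_ite_eq, Finset.mem_univ, if_true]
    rw [Finset.mul_sum]
    congr 1
    · exact Finset.sum_congr rfl fun i _ => by ring
    · exact Finset.sum_congr rfl fun i _ => Finset.sum_congr rfl fun j _ => by ring
  have h2 : ∑ z : Fin N × Fin N, B z.1 z.2 ^ 2 = ((N : ℝ) - 1) * f ^ 2 := by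
    rw [Fintype.sum_prod_type]
    have : ∀ i j, B i j ^ 2 = (if i = j then f ^ 2 - 2 * f * (a i ^ 2) else 0)
        + a i ^ 2 * a j ^ 2 := by
      intro i j
      simp only [hB]
      split_ifs with h
      · subst h; ring
      · ring
    simp only [this, Finset.sum_add_distrib, Finset.sum_ite_eq, Finset.mem_univ, if_true,
      Finset.sum_sub_distrib, ← Finset.mul_sum, ← Finset.sum_mul, ← hf]
    simp
    ring
  have := Finset.sum_mul_sq_le_sq_mul_sq Finset.univ (fun z : Fin N × Fin N => A z.1 z.2)
    (fun z => B z.1 z.2)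
  rw [h1, h2, Fintype.sum_prod_type] at this
  linarith

lemma final_ineq {m p f q k S η R n β : ℝ} (hm : 0 ≤ m) (hp : 1 < p)
    (hβ : β = 2 - m * (p - 1) / 2) (hβ0 : 0 < β) (hf : 0 < f) (hq : 0 < q) (hη : 0 < η)
    (hn : 0 ≤ n)
    (hcs : (f + q + k) ^ 2 ≤ m * S) (hk : η ^ 2 * k ^ 2 ≤ 4 * R ^ 2 * f)
    (hmain : η ^ 2 * (2 * S - 4 * (k * f) - 2 * (p - 1) * q * f) ≤ (24 + 4 * n) * R ^ 2 * f) :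
    η ^ 2 * f ≤ (2 / β * (32 * (m + 1) ^ 2 / β + m * (24 + 4 * n))) * R ^ 2 := by
  set s := f + q with hs
  have hs0 : 0 < s := by positivity
  have hfs : f ≤ s := by linarith
  have hqf : q * f ≤ s ^ 2 / 4 := by nlinarith [sq_nonneg (f - q)]
  -- pointwise bound
  have hη2 : 0 < η ^ 2 := by positivity
  have e1 : η ^ 2 * (2 * (s + k) ^ 2 - 4 * m * (k * f) - 2 * m * (p - 1) * (q * f)) ≤
      m * (24 + 4 * n) * R ^ 2 * f := by
    have a1 := mul_le_mul_of_nonneg_left hmain hm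
    have a2 := mul_le_mul_of_nonneg_left hcs hη2.le
    nlinarith
  have e2 : 2 * m * (p - 1) * (q * f) ≤ m * (p - 1) / 2 * s ^ 2 := by
    have : 0 ≤ 2 * m * (p - 1) := by have := sub_pos.2 hp; positivity
    have := mul_le_mul_of_nonneg_left hqf this
    linarith
  have e3 : -(4 * s * k) + 4 * m * (k * f) ≤ 4 * (m + 1) * s * |k| := by
    have b1 : -(s * k) ≤ s * |k| := by nlinarith [neg_abs_le k]
    have b2 : k * f ≤ s * |k| := by
      have : k * f ≤ |k| * f := by nlinarith [le_abs_self k]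
      nlinarith [abs_nonneg k]
    nlinarith
  have e4 : 4 * (m + 1) * s * |k| ≤ β / 2 * s ^ 2 + 8 * (m + 1) ^ 2 / β * k ^ 2 := by
    have h : 0 ≤ (β * s - 4 * (m + 1) * |k|) ^ 2 / (2 * β) := by positivity
    have h' : (β * s - 4 * (m + 1) * |k|) ^ 2 / (2 * β) =
        β / 2 * s ^ 2 + 8 * (m + 1) ^ 2 / β * k ^ 2 - 4 * (m + 1) * s * |k| := by
      rw [← sq_abs k]; field_simp; ring
    linarith
  have e5 : β / 2 * s ^ 2 - 8 * (m + 1) ^ 2 / β * k ^ 2 ≤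
      2 * (s + k) ^ 2 - 4 * m * (k * f) - 2 * m * (p - 1) * (q * f) := by
    nlinarith [sq_nonneg k]
  have e6 := (mul_le_mul_of_nonneg_left e5 hη2.le).trans e1
  have e7 : 8 * (m + 1) ^ 2 / β * (η ^ 2 * k ^ 2) ≤ 8 * (m + 1) ^ 2 / β * (4 * R ^ 2 * f) :=
    mul_le_mul_of_nonneg_left hk (by positivity)
  generalize hD : 8 * (m + 1) ^ 2 / β = D at e6 e7
  have hD0 : 0 ≤ D := by rw [← hD]; positivity
  have hDe : 32 * (m + 1) ^ 2 / β = 4 * D := by rw [← hD]; ring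
  rw [hDe]
  have e8 : β / 2 * (η ^ 2 * s) * s ≤ (4 * D + m * (24 + 4 * n)) * R ^ 2 * s := by
    have : (4 * D + m * (24 + 4 * n)) * R ^ 2 * f ≤ (4 * D + m * (24 + 4 * n)) * R ^ 2 * s :=
      mul_le_mul_of_nonneg_left hfs (by positivity)
    linarith
  have e9 := le_of_mul_le_mul_right e8 hs0
  have e10 : η ^ 2 * f ≤ η ^ 2 * s := mul_le_mul_of_nonneg_left hfs hη2.le
  calc η ^ 2 * f ≤ η ^ 2 * s := e10
    _ = 2 / β * (β / 2 * (η ^ 2 * s)) := by field_simp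
    _ ≤ 2 / β * ((4 * D + m * (24 + 4 * n)) * R ^ 2) :=
      mul_le_mul_of_nonneg_left e9 (by positivity)
    _ = _ := by ring

/-- Pointwise inequality at an interior maximum. -/
lemma at_max (hN : 1 ≤ N) {p : ℝ} (hp : 1 < p) (hpN : ((N : ℝ) - 1) * (p - 1) < 4)
    {w q f η : EuclideanSpace ℝ (Fin N) → ℝ} (hw : ContDiff ℝ ∞ w)
    (hq : q = fun x => Real.exp ((p - 1) * w x))
    (hf : f = fun x => ∑ i, dd i w x * dd i w x)
    (hΔ : ∀ x, ∑ i, dd i (dd i w) x = - (f x + q x))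
    {R : ℝ} (hR : 0 < R) (hη : η = fun x => R ^ 2 - ∑ i, x i * x i)
    {x : EuclideanSpace ℝ (Fin N)} (hfx : 0 < f x) (hηx : 0 < η x)
    (hmax : IsLocalMax (fun y => (η y * η y) * f y) x)
    {β : ℝ} (hβ : β = 2 - ((N : ℝ) - 1) * (p - 1) / 2) :
    η x ^ 2 * f x ≤
      (2 / β * (32 * (((N : ℝ) - 1) + 1) ^ 2 / β + ((N : ℝ) - 1) * (24 + 4 * N))) * R ^ 2 := by
  have hN1 : (1 : ℝ) ≤ N := by exact_mod_cast hN
  have hqpos : 0 < q x := by rw [hq]; positivity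
  have hwi : ∀ i, ContDiff ℝ ∞ (dd i w) := fun i => dd_smooth i hw
  have hwij : ∀ i j, ContDiff ℝ ∞ (dd j (dd i w)) := fun i j => dd_smooth j (hwi i)
  have hfs : ContDiff ℝ ∞ f := by
    rw [hf]; exact ContDiff.sum fun i _ => (hwi i).mul (hwi i)
  have hqs : ContDiff ℝ ∞ q := by
    rw [hq]; exact (contDiff_const.mul hw).exp
  have hηs : ContDiff ℝ ∞ η := by
    rw [hη]; exact contDiff_const.sub (ContDiff.sum fun i _ => (coord_smooth i).mul (coord_smooth i))
  -- derivatives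
  have hqd : ∀ i y, dd i q y = (p - 1) * q y * dd i w y := by
    intro i y
    rw [hq]
    rw [dd_comp (g := Real.exp) i (contDiff_const.mul hw) y (Real.hasDerivAt_exp _),
      dd_const_mul i hw]
    ring
  have hfd : ∀ i, dd i f = fun y => ∑ j, 2 * (dd j w y * dd i (dd j w) y) := by
    intro i
    funext y
    rw [hf, dd_sum i (fun j => (hwi j).mul (hwi j))]
    refine Finset.sum_congr rfl fun j _ => ?_
    rw [dd_mul i (hwi j) (hwi j)]; ring
  have hηd : ∀ i, dd i η = fun y => (-2) * y i := by
    intro i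
    funext y
    rw [hη, dd_const_sub, dd_sum i (fun j => (coord_smooth j).mul (coord_smooth j))]
    have : ∀ j, dd i (fun z : EuclideanSpace ℝ (Fin N) => z j * z j) y
        = if i = j then 2 * y j else 0 := by
      intro j
      rw [dd_mul i (coord_smooth j) (coord_smooth j), dd_coord]
      split_ifs <;> ring
    simp [this]
  have hηdd : ∀ i y, dd i (dd i η) y = -2 := by
    intro i y
    rw [hηd, dd_const_mul i (coord_smooth i), dd_coord]; simp
  -- Bochner
  have hboch : ∑ i, dd i (dd i f) x = 2 * (∑ i, ∑ j, (dd i (dd j w) x) ^ 2)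
      - 2 * (∑ j, dd j w x * dd j f x) - 2 * (p - 1) * q x * f x := by
    have h1 : ∀ i, dd i (dd i f) x = 2 * (∑ j, (dd i (dd j w) x) ^ 2)
        + 2 * ∑ j, dd j w x * dd j (dd i (dd i w)) x := by
      intro i
      rw [hfd i, dd_sum i (fun j => contDiff_const.mul ((hwi j).mul (hwij j i))),
        Finset.mul_sum, Finset.mul_sum, ← Finset.sum_add_distrib]
      refine Finset.sum_congr rfl fun j _ => ?_
      rw [dd_const_mul i ((hwi j).mul (hwij j i)), dd_mul i (hwi j) (hwij j i)]
      have : dd i (dd i (dd j w)) x = dd j (dd i (dd i w)) x := by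
        have e : dd i (dd j w) = dd j (dd i w) := funext fun y => dd_comm i j hw y
        rw [e, dd_comm i j (hwi i)]
      rw [this]; ring
    have h2 : ∀ j, ∑ i, dd j (dd i (dd i w)) x = - (dd j f x + (p - 1) * q x * dd j w x) := by
      intro j
      rw [← dd_sum j (fun i => hwij i i)]
      have : (fun y => ∑ i, dd i (dd i w) y) = fun y => (-1) * (f y + q y) := by
        funext y; rw [hΔ]; ring
      rw [this, dd_const_mul j (hfs.add hqs), dd_add j hfs hqs, hqd]; ring
    have h3 : f x = ∑ j, dd j w x * dd j w x := by rw [hf]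
    simp only [h1, Finset.sum_add_distrib, ← Finset.mul_sum]
    rw [Finset.sum_comm (f := fun i j => dd j w x * dd j (dd i (dd i w)) x)]
    simp only [← Finset.mul_sum, h2]
    have h4 : ∑ j, dd j w x * -(dd j f x + (p - 1) * q x * dd j w x) =
        - (∑ j, dd j w x * dd j f x) - (p - 1) * q x * f x := by
      rw [h3, Finset.mul_sum, ← Finset.sum_neg_distrib, ← Finset.sum_sub_distrib]
      exact Finset.sum_congr rfl fun j _ => by ring
    rw [h4]; ring
  -- first order condition
  have hGs : ContDiff ℝ ∞ (fun y => η y * η y) := hηs.mul hηs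
  have hηηd : ∀ i, dd i (fun y => η y * η y) = fun y => (-4) * (y i * η y) := by
    intro i; funext y
    rw [dd_mul i hηs hηs, hηd]; ring
  have hηηdd : ∀ i, dd i (dd i (fun y => η y * η y)) x = 8 * (x i * x i) - 4 * η x := by
    intro i
    rw [hηηd, dd_const_mul i ((coord_smooth i).mul hηs), dd_mul i (coord_smooth i) hηs,
      dd_coord, hηd]
    simp; ring
  have hfirst : ∀ i, η x * dd i f x = 4 * x i * f x := by
    intro i
    have h := dd_max i hmax
    rw [dd_mul i hGs hfs, hηηd] at h
    have : η x * (η x * dd i f x - 4 * x i * f x) = 0 := by linarith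
    rcases mul_eq_zero.1 this with h0 | h0 <;> linarith
  have hGd : ∀ i, dd i (fun y => η y * η y * f y) =
      fun y => dd i (fun y => η y * η y) y * f y + (η y * η y) * dd i f y := by
    intro i; funext y; exact dd_mul i hGs hfs y
  have hsecond : ∀ i, η x ^ 2 * dd i (dd i f) x - 24 * (x i * x i) * f x - 4 * η x * f x ≤ 0 := by
    intro i
    have h := dd_dd_max i (hGs.mul hfs) hmax
    rw [hGd, dd_add i ((dd_smooth i hGs).mul hfs) (hGs.mul (dd_smooth i hfs)),
      dd_mul i (dd_smooth i hGs) hfs, dd_mul i hGs (dd_smooth i hfs), hηηdd, hηηd] at h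
    have e : (-4) * (x i * η x) * dd i f x = (-16) * (x i * x i) * f x := by
      have := hfirst i
      calc _ = (-4) * x i * (η x * dd i f x) := by ring
        _ = _ := by rw [this]; ring
    simp only [e] at h
    linarith
  have hX0 : 0 ≤ ∑ i, x i * x i := Finset.sum_nonneg fun i _ => mul_self_nonneg _
  have hXη : η x = R ^ 2 - ∑ i, x i * x i := by rw [hη]
  set X := ∑ i, x i * x i with hX
  have hsum : η x ^ 2 * (∑ i, dd i (dd i f) x) - 24 * X * f x - 4 * N * η x * f x ≤ 0 := by
    have := Finset.sum_nonpos (s := Finset.univ) fun i _ => hsecond i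
    simp only [Finset.sum_sub_distrib, ← Finset.mul_sum, ← Finset.sum_mul, ← hX] at this
    simp only [Finset.sum_const, Finset.card_univ, Fintype.card_fin, nsmul_eq_mul] at this
    linarith
  set S := ∑ i, ∑ j, (dd i (dd j w) x) ^ 2 with hS
  set K := ∑ i, ∑ j, dd i w x * dd j w x * dd i (dd j w) x with hK
  have hKf : ∑ j, dd j w x * dd j f x = 2 * K := by
    rw [hK, Finset.mul_sum]
    refine Finset.sum_congr rfl fun i _ => ?_
    rw [hfd, Finset.mul_sum, Finset.mul_sum]
    exact Finset.sum_congr rfl fun j _ => by ring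
  set P := ∑ i, x i * dd i w x with hP
  have hKP : η x * K = 2 * P * f x := by
    have : η x * (∑ j, dd j w x * dd j f x) = 4 * P * f x := by
      rw [Finset.mul_sum, hP, Finset.mul_sum, Finset.sum_mul]
      refine Finset.sum_congr rfl fun i _ => ?_
      calc _ = dd i w x * (η x * dd i f x) := by ring
        _ = _ := by rw [hfirst]; ring
    rw [hKf] at this
    linarith
  have hfsq : f x = ∑ i, dd i w x ^ 2 := by
    rw [hf]; exact Finset.sum_congr rfl fun i _ => by ring
  have hP2 : P ^ 2 ≤ X * f x := by
    have := Finset.sum_mul_sq_le_sq_mul_sq Finset.univ (fun i => x i) (fun i => dd i w x)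
    rw [← hfsq] at this
    have e : ∑ i, x i ^ 2 = X := by rw [hX]; exact Finset.sum_congr rfl fun i _ => by ring
    rw [e] at this
    exact this
  have hcs := cs_aux (fun i => dd i w x) (fun i j => dd i (dd j w) x) (f x) K
    (-(f x + q x)) hfsq hK (hΔ x).symm
  have hkf : K / f x * f x = K := by field_simp
  refine final_ineq (m := (N : ℝ) - 1) (p := p) (f := f x) (q := q x) (k := K / f x) (S := S)
    (η := η x) (R := R) (n := N) (by linarith) hp hβ (by linarith) hfx hqpos hηx (by linarith)
    ?_ ?_ ?_
  · have e : (f x + q x + K / f x) ^ 2 * f x ^ 2 = (f x * (-(f x + q x)) - K) ^ 2 := by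
      field_simp; ring
    have : (f x + q x + K / f x) ^ 2 * f x ^ 2 ≤ (((N : ℝ) - 1) * S) * f x ^ 2 := by
      rw [e]; linarith
    exact le_of_mul_le_mul_right this (by positivity)
  · have e : η x ^ 2 * (K / f x) ^ 2 = 4 * P ^ 2 := by
      have : η x * (K / f x) = 2 * P := by
        rw [← mul_div_assoc, hKP]; field_simp
      rw [← mul_pow, this]; ring
    rw [e]
    have : X * f x ≤ R ^ 2 * f x := mul_le_mul_of_nonneg_right (by linarith) hfx.le
    linarith
  · rw [hkf]
    rw [hboch, hKf] at hsum
    have a1 : X * f x ≤ R ^ 2 * f x := mul_le_mul_of_nonneg_right (by linarith) hfx.le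
    have a2 : N * (η x * f x) ≤ N * (R ^ 2 * f x) :=
      mul_le_mul_of_nonneg_left (mul_le_mul_of_nonneg_right (by linarith) hfx.le) (by linarith)
    linarith

lemma log_liouville (hN : 1 ≤ N) {p : ℝ} (hp : 1 < p) (hpN : ((N : ℝ) - 1) * (p - 1) < 4)
    {w : EuclideanSpace ℝ (Fin N) → ℝ} (hw : ContDiff ℝ ∞ w)
    (hΔ : ∀ x, ∑ i, dd i (dd i w) x =
      - ((∑ i, dd i w x * dd i w x) + Real.exp ((p - 1) * w x))) : False := by
  have hN1 : (1 : ℝ) ≤ N := by exact_mod_cast hN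
  obtain ⟨f, hf⟩ : ∃ f : EuclideanSpace ℝ (Fin N) → ℝ,
    f = fun x => ∑ i, dd i w x * dd i w x := ⟨_, rfl⟩
  obtain ⟨q, hq⟩ : ∃ q : EuclideanSpace ℝ (Fin N) → ℝ,
    q = fun x => Real.exp ((p - 1) * w x) := ⟨_, rfl⟩
  have hΔ' : ∀ x, ∑ i, dd i (dd i w) x = - (f x + q x) := by
    intro x; rw [hΔ, hf, hq]
  have hwi : ∀ i, ContDiff ℝ ∞ (dd i w) := fun i => dd_smooth i hw
  have hfs : ContDiff ℝ ∞ f := by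
    rw [hf]; exact ContDiff.sum fun i _ => (hwi i).mul (hwi i)
  have hf0 : ∀ x, 0 ≤ f x := by
    intro x; rw [hf]; exact Finset.sum_nonneg fun i _ => mul_self_nonneg _
  obtain ⟨β, hβ⟩ : ∃ β : ℝ, β = 2 - ((N : ℝ) - 1) * (p - 1) / 2 := ⟨_, rfl⟩
  have hβ0 : 0 < β := by linarith
  obtain ⟨C, hC⟩ : ∃ C : ℝ, C = 2 / β * (32 * (((N : ℝ) - 1) + 1) ^ 2 / β +
    ((N : ℝ) - 1) * (24 + 4 * N)) := ⟨_, rfl⟩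
  have hC0 : 0 ≤ C := by
    rw [hC]
    have : 0 ≤ (N : ℝ) - 1 := by linarith
    positivity
  have hest : ∀ R : ℝ, 0 < R → ∀ x0 : EuclideanSpace ℝ (Fin N), ‖x0‖ < R → 0 < f x0 →
      (R ^ 2 - ‖x0‖ ^ 2) ^ 2 * f x0 ≤ C * R ^ 2 := by
    intro R hR x0 hx0 hfx0
    have hnorm : ∀ x : EuclideanSpace ℝ (Fin N), ∑ i, x i * x i = ‖x‖ ^ 2 := by
      intro x
      rw [EuclideanSpace.real_norm_sq_eq]
      exact Finset.sum_congr rfl fun i _ => by ring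
    obtain ⟨η, hη⟩ : ∃ η : EuclideanSpace ℝ (Fin N) → ℝ,
      η = fun x => R ^ 2 - ∑ i, x i * x i := ⟨_, rfl⟩
    have hη' : ∀ x, η x = R ^ 2 - ‖x‖ ^ 2 := by intro x; rw [hη, ← hnorm]
    have hηs : ContDiff ℝ ∞ η := by
      rw [hη]
      exact contDiff_const.sub (ContDiff.sum fun i _ => (coord_smooth i).mul (coord_smooth i))
    have hGc : Continuous (fun y => (η y * η y) * f y) :=
      (hηs.continuous.mul hηs.continuous).mul hfs.continuous
    obtain ⟨x1, hx1, hmax⟩ := (isCompact_closedBall (0 : EuclideanSpace ℝ (Fin N)) R).exists_isMaxOn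
      ⟨x0, by simpa using hx0.le⟩ hGc.continuousOn
    have hle : (η x0 * η x0) * f x0 ≤ (η x1 * η x1) * f x1 := hmax (by simpa using hx0.le)
    have hη0 : 0 < η x0 := by
      rw [hη']; have := norm_nonneg x0; nlinarith
    have hG1 : 0 < (η x1 * η x1) * f x1 := lt_of_lt_of_le (by positivity) hle
    have hx1' : ‖x1‖ ≤ R := by simpa using hx1
    have hη1ne : η x1 ≠ 0 := by intro h; rw [h] at hG1; simp at hG1
    have hf1 : 0 < f x1 := by
      rcases (hf0 x1).lt_or_eq with h | h
      · exact h
      · rw [← h] at hG1; simp at hG1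
    have hx1R : ‖x1‖ < R := by
      rcases hx1'.lt_or_eq with h | h
      · exact h
      · exact absurd (by rw [hη', h]; ring) hη1ne
    have hη1 : 0 < η x1 := by
      rw [hη']; have := norm_nonneg x1; nlinarith
    have hloc : IsLocalMax (fun y => (η y * η y) * f y) x1 :=
      hmax.isLocalMax (Filter.mem_of_superset
        (Metric.isOpen_ball.mem_nhds (by simpa using hx1R)) Metric.ball_subset_closedBall)
    have := at_max hN hp hpN hw hq hf hΔ' hR hη hf1 hη1 hloc hβ
    rw [← hC] at this
    rw [← hη']
    linarith
  have hfz : ∀ x, f x = 0 := by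
    intro x0
    by_contra hne
    have hpos : 0 < f x0 := lt_of_le_of_ne (hf0 x0) (Ne.symm hne)
    obtain ⟨R, hRdef⟩ : ∃ R : ℝ, R = 1 + 2 * ‖x0‖ + 4 * C / f x0 := ⟨_, rfl⟩
    have hn := norm_nonneg x0
    have hc : 0 ≤ 4 * C / f x0 := by positivity
    have hR1 : 1 ≤ R := by linarith
    have h := hest R (by linarith) x0 (by linarith) hpos
    have h1 : R ^ 2 / 2 ≤ R ^ 2 - ‖x0‖ ^ 2 := by nlinarith
    have h2 : (R ^ 2 / 2) ^ 2 ≤ (R ^ 2 - ‖x0‖ ^ 2) ^ 2 := by gcongr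
    have h3 : (R ^ 2 / 2) ^ 2 * f x0 ≤ C * R ^ 2 :=
      (mul_le_mul_of_nonneg_right h2 hpos.le).trans h
    have h4 : (R ^ 2 * f x0) * R ^ 2 ≤ (4 * C) * R ^ 2 := by nlinarith
    have h5 := le_of_mul_le_mul_right h4 (by positivity)
    have h6 : 4 * C < R * f x0 := by
      have : 4 * C / f x0 < R := by linarith
      rwa [div_lt_iff₀ hpos] at this
    have h7 : R * f x0 ≤ R ^ 2 * f x0 := mul_le_mul_of_nonneg_right (by nlinarith) hpos.le
    linarith
  have hdz : ∀ i, dd i w = fun _ => 0 := by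
    intro i; funext x
    have h := hfz x
    rw [hf] at h
    have := (Finset.sum_eq_zero_iff_of_nonneg (fun i _ => mul_self_nonneg (dd i w x))).1 h i
      (Finset.mem_univ i)
    exact mul_self_eq_zero.1 this
  have h := hΔ' 0
  rw [hfz] at h
  have hz : ∀ i, dd i (dd i w) 0 = 0 := by
    intro i; rw [hdz]; simp [dd]
  simp only [hz, Finset.sum_const_zero] at h
  have : 0 < q 0 := by rw [hq]; positivity
  linarith

lemma pStar_bound (hN : 1 ≤ N) {p : ℝ} (hp' : p < pStar N) :
    ((N : ℝ) - 1) * (p - 1) < 4 := by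
  unfold pStar at hp'
  split_ifs at hp' with h
  · have h2 : (2 : ℝ) ≤ N := by exact_mod_cast h
    have hs : Real.sqrt ((N : ℝ) ^ 2 + 8 * N) ≤ N + 4 := by
      rw [Real.sqrt_le_left (by linarith)]; nlinarith
    rw [lt_div_iff₀ (by linarith)] at hp'
    nlinarith
  · have : N = 1 := by omega
    subst this; norm_num

end LiouvilleAux

open LiouvilleAux in
/-- Elliptic Liouville theorem of Gidas–Spruck type (Euclidean case): for
`1 < p < p_*(N)` there is no smooth positive solution of `−Δu = uᵖ` on `ℝ^N`. -/
theorem elliptic_liouville_euclidean {N : ℕ} (hN : 1 ≤ N) (p : ℝ) (hp : 1 < p)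
    (hp' : p < pStar N) :
    ¬ ∃ u : EuclideanSpace ℝ (Fin N) → ℝ, ContDiff ℝ (⊤ : ℕ∞) u ∧ (∀ x, 0 < u x) ∧
      (∀ x, -lap u x = u x ^ p) := by
  rintro ⟨u, hu, hpos, heq⟩
  have hw : ContDiff ℝ ∞ (fun x => Real.log (u x)) := hu.log fun x => (hpos x).ne'
  refine log_liouville hN hp (pStar_bound hN hp') hw ?_
  have h1 : ∀ i, dd i (fun x => Real.log (u x)) = fun x => (u x)⁻¹ * dd i u x := by
    intro i; funext x
    exact dd_comp i hu x (Real.hasDerivAt_log (hpos x).ne')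
  have hinv : ContDiff ℝ ∞ (fun x => (u x)⁻¹) := hu.inv fun x => (hpos x).ne'
  intro x
  have hx := hpos x
  have h2 : ∀ i, dd i (dd i (fun x => Real.log (u x))) x =
      (u x)⁻¹ * pd2 u i i x
        - dd i (fun x => Real.log (u x)) x * dd i (fun x => Real.log (u x)) x := by
    intro i
    rw [h1, dd_mul i hinv (dd_smooth i hu),
      dd_comp (g := fun t => t⁻¹) i hu x (hasDerivAt_inv hx.ne')]
    have : dd i (dd i u) x = pd2 u i i x := rfl
    rw [this]
    field_simp
    ring
  have hl : lap u x = - u x ^ p := by linarith [heq x]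
  have he : Real.exp ((p - 1) * Real.log (u x)) = (u x)⁻¹ * u x ^ p := by
    rw [mul_comm, ← Real.rpow_def_of_pos hx, Real.rpow_sub hx, Real.rpow_one]
    field_simp
  simp only [h2, Finset.sum_sub_distrib, ← Finset.mul_sum]
  have hl' : ∑ i, pd2 u i i x = - u x ^ p := hl
  rw [hl', he]
  ring
end

section
/- Let N ≥ 1. Every smooth function u : EuclideanSpace ℝ (Fin N) → ℝ with u ≥ 0 everywhere and Δu = 0 on all of ℝ^N is constant. -/
open MeasureTheory Set Filter Topology

/-- weight -/
noncomputable def wt {N : ℕ} (R : ℝ) (y : EuclideanSpace ℝ (Fin N)) : ℝ :=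
  max 0 (R - ‖y‖ ^ 2)

lemma wt_cont {N : ℕ} (R : ℝ) : Continuous (wt (N := N) R) := by
  unfold wt; fun_prop

lemma wt_nonneg {N : ℕ} (R : ℝ) (y : EuclideanSpace ℝ (Fin N)) : 0 ≤ wt R y :=
  le_max_left _ _

lemma wt_zero {N : ℕ} {R : ℝ} (hR : 0 ≤ R) (y : EuclideanSpace ℝ (Fin N))
    (hy : y ∉ Metric.closedBall (0 : EuclideanSpace ℝ (Fin N)) (R + 1)) : wt R y = 0 := by
  simp only [Metric.mem_closedBall, dist_zero_right, not_le] at hy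
  unfold wt
  apply max_eq_left
  nlinarith

lemma wt_supp {N : ℕ} {R : ℝ} (hR : 0 ≤ R) : HasCompactSupport (wt (N := N) R) :=
  HasCompactSupport.intro (isCompact_closedBall 0 (R + 1)) (fun y hy => wt_zero hR y hy)

lemma hasDerivAt_posSq (t : ℝ) : HasDerivAt (fun t : ℝ => (max 0 t) ^ 2) (2 * max 0 t) t := by
  rcases lt_trichotomy t 0 with h | h | h
  · rw [max_eq_left h.le, mul_zero]
    apply (hasDerivAt_const t (0 : ℝ)).congr_of_eventuallyEq
    filter_upwards [Iio_mem_nhds h] with s hs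
    simp [max_eq_left (le_of_lt (show s < 0 from hs))]
  · subst h
    simp only [max_self, mul_zero]
    rw [hasDerivAt_iff_isLittleO_nhds_zero]
    simp only [zero_add, max_self, smul_zero, sub_zero]
    have h1 : (fun h : ℝ => h ^ 2) =o[𝓝 0] fun h => h := by
      simpa using Asymptotics.isLittleO_pow_id (𝕜 := ℝ) (n := 2) (by norm_num)
    refine Asymptotics.IsBigO.trans_isLittleO (Asymptotics.IsBigO.of_bound 1 ?_) h1
    filter_upwards with s
    rcases le_total s 0 with h | h
    · simp [h, sq_nonneg]
    · simp [h]
  · rw [max_eq_right h.le]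
    have := hasDerivAt_pow 2 t
    simp only [Nat.cast_ofNat, Nat.add_one_sub_one, pow_one] at this
    apply this.congr_of_eventuallyEq
    filter_upwards [Ioi_mem_nhds h] with s hs
    simp [max_eq_right (le_of_lt (show 0 < s from hs))]

lemma hasFDerivAt_wtSq {N : ℕ} (R : ℝ) (y : EuclideanSpace ℝ (Fin N)) :
    HasFDerivAt (fun y => wt R y ^ 2) ((-4 * wt R y) • innerSL ℝ y) y := by
  have h1 : HasFDerivAt (fun y : EuclideanSpace ℝ (Fin N) => R - ‖y‖ ^ 2)
      (-(2 • innerSL ℝ y)) y := (hasStrictFDerivAt_norm_sq y).hasFDerivAt.const_sub R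
  have h2 := (hasDerivAt_posSq (R - ‖y‖ ^ 2)).comp_hasFDerivAt y h1
  refine h2.congr_fderiv ?_
  ext v
  simp [wt]
  ring

lemma ibp {N : ℕ} (u : EuclideanSpace ℝ (Fin N) → ℝ) (hu : ContDiff ℝ (⊤ : ℕ∞) u) {R : ℝ}
    (hR : 0 ≤ R) (x : EuclideanSpace ℝ (Fin N)) (r : ℝ) (i : Fin N) :
    ∫ y, fderiv ℝ u (x + r • y) (EuclideanSpace.single i 1) * (-4 * wt R y * y i) =
      - ∫ y, (r * pd2 u i i (x + r • y)) * wt R y ^ 2 := by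
  set e : EuclideanSpace ℝ (Fin N) := EuclideanSpace.single i 1 with he
  have hg : ContDiff ℝ (⊤ : ℕ∞) (fun y => fderiv ℝ u y e) :=
    (hu.fderiv_right (m := (⊤ : ℕ∞)) (by simp)).clm_apply contDiff_const
  have hgc := hg.continuous_fderiv (by simp)
  have hd : ∀ y, HasFDerivAt (fun y => fderiv ℝ u (x + r • y) e)
      (r • fderiv ℝ (fun y => fderiv ℝ u y e) (x + r • y)) y := by
    intro y
    have h1 : HasFDerivAt (fun y : EuclideanSpace ℝ (Fin N) => x + r • y)
      (r • ContinuousLinearMap.id ℝ _) y := ((hasFDerivAt_id y).const_smul r).const_add x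
    have h2 := ((hg.differentiable (by simp)) (x + r • y)).hasFDerivAt.comp y h1
    refine h2.congr_fderiv ?_
    ext v; simp
  have hwc := wt_cont (N := N) R
  have hgr : Continuous (fun y => fderiv ℝ u y e) := hg.continuous
  have hf1 : ∀ y, fderiv ℝ (fun y => fderiv ℝ u (x + r • y) e) y e = r * pd2 u i i (x + r • y) := by
    intro y
    rw [(hd y).fderiv]
    simp [pd2, he]
  have hf2 : ∀ y, fderiv ℝ (fun y => wt R y ^ 2) y e = -4 * wt R y * y i := by
    intro y
    rw [(hasFDerivAt_wtSq R y).fderiv]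
    simp [he, EuclideanSpace.inner_single_right]
  have hpc : Continuous (fun y => pd2 u i i y) := by
    unfold pd2
    exact hgc.clm_apply continuous_const
  have key := integral_mul_fderiv_eq_neg_fderiv_mul_of_integrable (μ := volume)
    (f := fun y => fderiv ℝ u (x + r • y) e) (g := fun y => wt R y ^ 2) (v := e) ?_ ?_ ?_
    (fun y _ => (hd y).differentiableAt) (fun y _ => (hasFDerivAt_wtSq R y).differentiableAt)
  · simp only [hf1, hf2] at key
    exact key
  · simp only [hf1]
    refine Continuous.integrable_of_hasCompactSupport ?_ ?_
    · exact (continuous_const.mul (hpc.comp (by fun_prop))).mul (hwc.pow 2)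
    · refine HasCompactSupport.intro (isCompact_closedBall 0 (R + 1)) (fun y hy => ?_)
      simp [wt_zero hR y hy]
  · simp only [hf2]
    refine Continuous.integrable_of_hasCompactSupport ?_ ?_
    · exact (hgr.comp (by fun_prop)).mul (by fun_prop)
    · refine HasCompactSupport.intro (isCompact_closedBall 0 (R + 1)) (fun y hy => ?_)
      simp [wt_zero hR y hy]
  · refine Continuous.integrable_of_hasCompactSupport ?_ ?_
    · exact (hgr.comp (by fun_prop)).mul (by fun_prop)
    · refine HasCompactSupport.intro (isCompact_closedBall 0 (R + 1)) (fun y hy => ?_)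
      simp [wt_zero hR y hy]

lemma deriv_mean {N : ℕ} (u : EuclideanSpace ℝ (Fin N) → ℝ) (hu : ContDiff ℝ (⊤ : ℕ∞) u) {R : ℝ}
    (hR : 0 ≤ R) (x : EuclideanSpace ℝ (Fin N)) (r₀ : ℝ) :
    HasDerivAt (fun r => ∫ y, u (x + r • y) * wt R y)
      (∫ y, fderiv ℝ u (x + r₀ • y) y * wt R y) r₀ := by
  have hc := hu.continuous
  have hwc := wt_cont (N := N) R
  have hdc : Continuous (fderiv ℝ u) := hu.continuous_fderiv (by simp)
  have hjc : Continuous (fun p : ℝ × EuclideanSpace ℝ (Fin N) =>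
      fderiv ℝ u (x + p.1 • p.2) p.2 * wt R p.2) :=
    ((hdc.comp (by fun_prop)).clm_apply continuous_snd).mul (hwc.comp continuous_snd)
  obtain ⟨C, hC⟩ := ((isCompact_closedBall r₀ 1).prod
    (isCompact_closedBall (0 : EuclideanSpace ℝ (Fin N)) (R + 1))).exists_bound_of_continuousOn
      hjc.continuousOn
  refine (hasDerivAt_integral_of_dominated_loc_of_deriv_le (μ := volume)
    (F := fun r y => u (x + r • y) * wt R y)
    (F' := fun r y => fderiv ℝ u (x + r • y) y * wt R y)
    (bound := (Metric.closedBall (0 : EuclideanSpace ℝ (Fin N)) (R + 1)).indicator (fun _ => C))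
    (Metric.closedBall_mem_nhds r₀ one_pos) ?_ ?_ ?_ ?_ ?_ ?_).2
  · refine Eventually.of_forall fun r => ?_
    exact Continuous.aestronglyMeasurable (by fun_prop)
  · refine Continuous.integrable_of_hasCompactSupport (by fun_prop) ?_
    exact HasCompactSupport.mul_left (wt_supp hR)
  · exact (hjc.comp (by fun_prop : Continuous fun y : EuclideanSpace ℝ (Fin N) =>
      (r₀, y))).aestronglyMeasurable
  · refine Eventually.of_forall fun y r hr => ?_
    by_cases hy : y ∈ Metric.closedBall (0 : EuclideanSpace ℝ (Fin N)) (R + 1)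
    · rw [indicator_of_mem hy]
      exact hC (r, y) ⟨hr, hy⟩
    · rw [indicator_of_notMem hy, wt_zero hR y hy]
      simp
  · rw [integrable_indicator_iff measurableSet_closedBall]
    exact integrableOn_const (isCompact_closedBall _ _).measure_lt_top.ne
  · refine Eventually.of_forall fun y r hr => ?_
    have h1 : HasDerivAt (fun r : ℝ => x + r • y) y r := by
      simpa using ((hasDerivAt_id r).smul_const y).const_add x
    have h2 := ((hu.differentiable (by simp)) (x + r • y)).hasFDerivAt.comp_hasDerivAt r h1
    exact h2.mul_const _

lemma mean_value {N : ℕ} (u : EuclideanSpace ℝ (Fin N) → ℝ) (hu : ContDiff ℝ (⊤ : ℕ∞) u)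
    (hharm : ∀ x, lap u x = 0) {R : ℝ}
    (hR : 0 ≤ R) (x : EuclideanSpace ℝ (Fin N)) (r : ℝ) :
    ∫ y, u (x + r • y) * wt R y = u x * ∫ y : EuclideanSpace ℝ (Fin N), wt R y := by
  have hwc := wt_cont (N := N) R
  have hdc : Continuous (fderiv ℝ u) := hu.continuous_fderiv (by simp)
  have hz : ∀ s : ℝ, ∫ y, fderiv ℝ u (x + s • y) y * wt R y = 0 := by
    intro s
    have h1 : ∀ y : EuclideanSpace ℝ (Fin N), fderiv ℝ u (x + s • y) y * wt R y =
        (-1 / 4) * ∑ i, fderiv ℝ u (x + s • y) (EuclideanSpace.single i 1) *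
          (-4 * wt R y * y i) := by
      intro y
      have hy : y = ∑ i, y i • (EuclideanSpace.single i (1 : ℝ)) := by
        have := (EuclideanSpace.basisFun (Fin N) ℝ).sum_repr y
        simpa using this.symm
      have h3 : fderiv ℝ u (x + s • y) y =
          ∑ i, y i * fderiv ℝ u (x + s • y) (EuclideanSpace.single i 1) := by
        conv_lhs => rw [hy]
        rw [map_sum, ← hy]
        simp
      rw [h3, Finset.sum_mul, Finset.mul_sum]
      refine Finset.sum_congr rfl fun i _ => ?_
      ring
    have hint : ∀ i : Fin N, Integrable (fun y : EuclideanSpace ℝ (Fin N) =>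
        fderiv ℝ u (x + s • y) (EuclideanSpace.single i 1) * (-4 * wt R y * y i)) := by
      intro i
      refine Continuous.integrable_of_hasCompactSupport ?_ ?_
      · exact ((hdc.comp (by fun_prop)).clm_apply continuous_const).mul (by fun_prop)
      · refine HasCompactSupport.intro (isCompact_closedBall 0 (R + 1)) (fun y hy => ?_)
        simp [wt_zero hR y hy]
    have hint2 : ∀ i : Fin N, Integrable (fun y : EuclideanSpace ℝ (Fin N) =>
        (s * pd2 u i i (x + s • y)) * wt R y ^ 2) := by
      intro i
      have hg : ContDiff ℝ (⊤ : ℕ∞) (fun y => fderiv ℝ u y (EuclideanSpace.single i 1)) :=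
        (hu.fderiv_right (m := (⊤ : ℕ∞)) (by simp)).clm_apply contDiff_const
      have hpc : Continuous (fun y => pd2 u i i y) := by
        unfold pd2
        exact (hg.continuous_fderiv (by simp)).clm_apply continuous_const
      refine Continuous.integrable_of_hasCompactSupport ?_ ?_
      · exact (continuous_const.mul (hpc.comp (by fun_prop))).mul (hwc.pow 2)
      · refine HasCompactSupport.intro (isCompact_closedBall 0 (R + 1)) (fun y hy => ?_)
        simp [wt_zero hR y hy]
    simp only [h1]
    rw [integral_const_mul, integral_finsetSum _ (fun i _ => hint i)]
    simp only [ibp u hu hR x s]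
    rw [Finset.sum_neg_distrib, ← integral_finsetSum _ (fun i _ => hint2 i)]
    have : ∀ y : EuclideanSpace ℝ (Fin N),
        ∑ i, (s * pd2 u i i (x + s • y)) * wt R y ^ 2 = 0 := by
      intro y
      rw [← Finset.sum_mul, ← Finset.mul_sum]
      have := hharm (x + s • y)
      unfold lap at this
      rw [this]; ring
    simp [this]
  have hconst := is_const_of_deriv_eq_zero (f := fun r : ℝ => ∫ y, u (x + r • y) * wt R y)
    (fun s => (deriv_mean u hu hR x s).differentiableAt)
    (fun s => by rw [(deriv_mean u hu hR x s).deriv, hz s]) r 0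
  simp only [zero_smul, add_zero] at hconst
  rw [hconst, integral_const_mul]

lemma harnack {N : ℕ} (u : EuclideanSpace ℝ (Fin N) → ℝ) (hu : ContDiff ℝ (⊤ : ℕ∞) u)
    (hnonneg : ∀ x, 0 ≤ u x) (hharm : ∀ x, lap u x = 0) (x y : EuclideanSpace ℝ (Fin N)) :
    u x * ∫ z : EuclideanSpace ℝ (Fin N), wt 1 z ≤
      u y * ∫ z : EuclideanSpace ℝ (Fin N), wt 5 z := by
  have hc := hu.continuous
  have w1 := wt_cont (N := N) 1
  have w5 := wt_cont (N := N) 5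
  rw [← mean_value u hu hharm zero_le_one x ‖x - y‖,
    ← mean_value u hu hharm (by norm_num : (0:ℝ) ≤ 5) y ‖x - y‖]
  obtain ⟨e, he1, he⟩ : ∃ e : EuclideanSpace ℝ (Fin N), ‖e‖ ≤ 1 ∧ ‖x - y‖ • e = x - y := by
    by_cases h : x - y = 0
    · exact ⟨0, by simp, by simp [h]⟩
    · have : ‖x - y‖ ≠ 0 := norm_ne_zero_iff.2 h
      refine ⟨‖x - y‖⁻¹ • (x - y), ?_, ?_⟩
      · rw [norm_smul, norm_inv, norm_norm, inv_mul_cancel₀ this]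
      · rw [smul_smul, mul_inv_cancel₀ this, one_smul]
  rw [← integral_sub_right_eq_self _ e]
  have hs : ∀ z, x + ‖x - y‖ • (z - e) = y + ‖x - y‖ • z := by
    intro z; rw [smul_sub, he]; abel
  simp only [hs]
  apply integral_mono
  · refine Continuous.integrable_of_hasCompactSupport (by fun_prop) ?_
    apply HasCompactSupport.mul_left
    exact (wt_supp zero_le_one).comp_homeomorph (Homeomorph.subRight e)
  · refine Continuous.integrable_of_hasCompactSupport (by fun_prop) ?_
    exact HasCompactSupport.mul_left (wt_supp (by norm_num))
  · intro z
    refine mul_le_mul_of_nonneg_left ?_ (hnonneg _)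
    by_cases h : ‖z - e‖ ≤ 1
    · have h2 : ‖z‖ ≤ 2 := by
        calc ‖z‖ = ‖(z - e) + e‖ := by simp
          _ ≤ _ := norm_add_le _ _
          _ ≤ 2 := by linarith
      unfold wt
      refine le_max_of_le_right (max_le ?_ ?_) <;> nlinarith [norm_nonneg z, norm_nonneg (z - e)]
    · have : wt 1 (z - e) = 0 := by
        unfold wt; apply max_eq_left; nlinarith
      rw [this]; exact wt_nonneg _ _

theorem yau_liouville_euclidean {N : ℕ} (hN : 1 ≤ N)
    (u : EuclideanSpace ℝ (Fin N) → ℝ) (hu : ContDiff ℝ (⊤ : ℕ∞) u)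
    (hnonneg : ∀ x, 0 ≤ u x) (hharm : ∀ x, lap u x = 0) :
    ∃ c : ℝ, ∀ x, u x = c := by
  have hbdd : BddBelow (range u) := ⟨0, by rintro _ ⟨x, rfl⟩; exact hnonneg x⟩
  set K1 := ∫ z : EuclideanSpace ℝ (Fin N), wt 1 z with hK1
  set K5 := ∫ z : EuclideanSpace ℝ (Fin N), wt 5 z with hK5
  have hK1p : 0 < K1 := by
    apply Continuous.integral_pos_of_hasCompactSupport_nonneg_nonzero (wt_cont 1)
      (wt_supp zero_le_one) (wt_nonneg 1) (x := 0)
    simp [wt]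
  have hK5p : 0 ≤ K5 := integral_nonneg (wt_nonneg 5)
  refine ⟨⨅ x, u x, fun x => le_antisymm ?_ (ciInf_le hbdd x)⟩
  set m := ⨅ x, u x with hm
  have hv : ∀ y, (u x - m) * K1 ≤ (u y - m) * K5 := by
    intro y
    refine harnack (fun z => u z - m) (hu.sub contDiff_const)
      (fun z => sub_nonneg.2 (ciInf_le hbdd z)) ?_ x y
    intro z
    rw [← hharm z]
    simp [lap, pd2, fderiv_sub_const]
  by_contra! hlt
  have hp : 0 < (u x - m) * K1 := mul_pos (by linarith) hK1p
  have hε : m < m + (u x - m) * K1 / (K5 + 1) := by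
    have : 0 < (u x - m) * K1 / (K5 + 1) := by positivity
    linarith
  obtain ⟨y, hy⟩ := exists_lt_of_ciInf_lt hε
  have h1 : (u y - m) * (K5 + 1) < (u x - m) * K1 := by
    rw [← lt_div_iff₀ (by positivity)]; linarith
  have h2 := hv y
  have h3 : 0 ≤ u y - m := sub_nonneg.2 (ciInf_le hbdd y)
  nlinarith
end

section
/- Let f : ℝ → ℝ be continuous with f(z) > 0 for every z > 0, and suppose that the function z ↦ 1/f(z) is integrable on [1, +∞). Then for every t₀ ∈ ℝ there is no differentiable function φ : ℝ → ℝ such that φ(t) > 0 and φ'(t) ≥ f(φ(t)) for all t ≥ t₀. -/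
/-- Osgood-type ODE nonexistence: if `f` is continuous, positive on `(0, ∞)`, and
`1/f` is integrable on `[1, ∞)`, then there is no differentiable `φ : ℝ → ℝ` with
`φ(t) > 0` and `φ'(t) ≥ f(φ(t))` for all `t ≥ t₀`. -/
theorem osgood_forward (f : ℝ → ℝ) (hf : Continuous f) (hfpos : ∀ z : ℝ, 0 < z → 0 < f z)
    (hint : MeasureTheory.IntegrableOn (fun z => 1 / f z) (Set.Ici (1 : ℝ))) (t₀ : ℝ) :
    ¬ ∃ φ : ℝ → ℝ, Differentiable ℝ φ ∧
      ∀ t : ℝ, t₀ ≤ t → 0 < φ t ∧ f (φ t) ≤ deriv φ t := by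
  rintro ⟨φ, hd, h⟩
  have ha : 0 < φ t₀ := (h t₀ le_rfl).1
  have hmeas : Measurable (fun z => 1 / f z) := measurable_const.div hf.measurable
  have hca : ∀ x : ℝ, 0 < x → ContinuousAt (fun z => 1 / f z) x := fun x hx =>
    continuousAt_const.div hf.continuousAt (hfpos x hx).ne'
  have hII : ∀ x : ℝ, 0 < x →
      IntervalIntegrable (fun z => 1 / f z) MeasureTheory.volume (φ t₀) x := by
    intro x hx
    apply ContinuousOn.intervalIntegrable
    intro y hy
    exact (hca y (lt_of_lt_of_le (lt_min ha hx) hy.1)).continuousWithinAt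
  have hInt : MeasureTheory.IntegrableOn (fun z => 1 / f z) (Set.Ici (φ t₀)) := by
    have h1 : MeasureTheory.IntegrableOn (fun z => 1 / f z) (Set.Icc (φ t₀) 1) := by
      apply ContinuousOn.integrableOn_Icc
      intro y hy
      exact (hca y (lt_of_lt_of_le ha hy.1)).continuousWithinAt
    refine (h1.union hint).mono_set ?_
    intro y hy
    rcases le_total y 1 with h2 | h2
    · exact Or.inl ⟨hy, h2⟩
    · exact Or.inr h2
  have hG : ∀ t, t₀ ≤ t → HasDerivAt (fun t => (∫ z in (φ t₀)..(φ t), 1 / f z) - t)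
      (1 / f (φ t) * deriv φ t - 1) t := by
    intro t ht
    have hp := (h t ht).1
    have h1 := intervalIntegral.integral_hasDerivAt_right (hII _ hp)
      (hmeas.stronglyMeasurable.stronglyMeasurableAtFilter) (hca _ hp)
    exact (h1.comp t (hd t).hasDerivAt).sub (hasDerivAt_id t)
  have hmono : MonotoneOn (fun t => (∫ z in (φ t₀)..(φ t), 1 / f z) - t) (Set.Ici t₀) := by
    apply monotoneOn_of_deriv_nonneg (convex_Ici t₀)
    · intro t ht
      exact (hG t ht).continuousAt.continuousWithinAt
    · intro t ht
      exact (hG t (interior_subset ht)).differentiableAt.differentiableWithinAt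
    · intro t ht
      have ht' : t₀ ≤ t := interior_subset ht
      rw [(hG t ht').deriv]
      have hp := hfpos _ (h t ht').1
      have : 1 ≤ 1 / f (φ t) * deriv φ t := by
        rw [one_div_mul_eq_div, le_div_iff₀ hp, one_mul]
        exact (h t ht').2
      linarith
  have hφ : MonotoneOn φ (Set.Ici t₀) := by
    apply monotoneOn_of_deriv_nonneg (convex_Ici t₀) hd.continuous.continuousOn
      hd.differentiableOn
    intro t ht
    have ht' : t₀ ≤ t := interior_subset ht
    exact (hfpos _ (h t ht').1).le.trans (h t ht').2
  set C := ∫ z in Set.Ici (φ t₀), 1 / f z with hC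
  have hC0 : 0 ≤ C := MeasureTheory.setIntegral_nonneg measurableSet_Ici
    fun z hz => (one_div_pos.2 (hfpos z (lt_of_lt_of_le ha hz))).le
  have hT : t₀ ≤ t₀ + C + 1 := by linarith
  have h1 := hmono (Set.mem_Ici.2 le_rfl) (Set.mem_Ici.2 hT) hT
  have h2 : (∫ z in (φ t₀)..(φ (t₀ + C + 1)), 1 / f z) ≤ C := by
    rw [intervalIntegral.integral_of_le (hφ (Set.mem_Ici.2 le_rfl) (Set.mem_Ici.2 hT) hT)]
    apply MeasureTheory.setIntegral_mono_set hInt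
    · refine (MeasureTheory.ae_restrict_mem measurableSet_Ici).mono ?_
      intro z hz
      exact (one_div_pos.2 (hfpos z (lt_of_lt_of_le ha hz))).le
    · exact Filter.Eventually.of_forall fun z hz => hz.1.le
  simp only [intervalIntegral.integral_same] at h1
  linarith
end

section
/- Let f : ℝ → ℝ be continuous with f(z) > 0 for every z < 0, and suppose that the function z ↦ 1/f(−z) is integrable on [1, +∞). Then for every t₀ ∈ ℝ there is no differentiable function φ : ℝ → ℝ such that φ(t) < 0 and φ'(t) ≥ f(φ(t)) for all t ≤ t₀. -/
/-- Backward-in-time Osgood-type ODE nonexistence: if `f` is continuous, positive on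
`(−∞, 0)`, and `z ↦ 1/f(−z)` is integrable on `[1, ∞)`, then there is no differentiable
`φ : ℝ → ℝ` with `φ(t) < 0` and `φ'(t) ≥ f(φ(t))` for all `t ≤ t₀`. -/
theorem osgood_backward (f : ℝ → ℝ) (hf : Continuous f) (hfpos : ∀ z : ℝ, z < 0 → 0 < f z)
    (hint : MeasureTheory.IntegrableOn (fun z => 1 / f (-z)) (Set.Ici (1 : ℝ))) (t₀ : ℝ) :
    ¬ ∃ φ : ℝ → ℝ, Differentiable ℝ φ ∧
      ∀ t : ℝ, t ≤ t₀ → φ t < 0 ∧ f (φ t) ≤ deriv φ t := by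
  rintro ⟨φ, hd, hφ⟩
  obtain ⟨c, hc⟩ : ∃ c, c = φ t₀ := ⟨_, rfl⟩
  have hc0 : c < 0 := hc ▸ (hφ t₀ le_rfl).1
  have hmeas : Measurable (fun z => 1 / f z) := by
    exact measurable_const.div hf.measurable
  have hcont : ∀ y < 0, ContinuousAt (fun z => 1 / f z) y := fun y hy =>
    continuousAt_const.div hf.continuousAt (hfpos y hy).ne'
  have h1 : MeasureTheory.IntegrableOn (fun z => 1 / f z) (Set.Iic (-1 : ℝ)) := by
    rw [← (MeasureTheory.Measure.measurePreserving_neg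
      (MeasureTheory.volume : MeasureTheory.Measure ℝ)).integrableOn_comp_preimage
      (MeasurableEquiv.neg ℝ).measurableEmbedding]
    have h0 : (Neg.neg : ℝ → ℝ) ⁻¹' Set.Iic (-1) = Set.Ici 1 := by
      ext x
      simp
    rw [h0]
    exact hint
  have h2 : MeasureTheory.IntegrableOn (fun z => 1 / f z) (Set.Iic c) := by
    have h3 : MeasureTheory.IntegrableOn (fun z => 1 / f z) (Set.Icc (-1) c) := by
      apply ContinuousOn.integrableOn_Icc
      intro y hy
      exact (hcont y (hy.2.trans_lt hc0)).continuousWithinAt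
    refine (h1.union h3).mono_set ?_
    intro x hx
    rcases le_total x (-1) with h | h
    · exact Or.inl h
    · exact Or.inr ⟨h, hx⟩
  have hGd : ∀ y < 0, HasDerivAt (fun y => ∫ z in c..y, 1 / f z) (1 / f y) y := by
    intro y hy
    refine intervalIntegral.integral_hasDerivAt_right ?_
      hmeas.stronglyMeasurable.stronglyMeasurableAtFilter (hcont y hy)
    apply ContinuousOn.intervalIntegrable
    intro x hx
    exact (hcont x (hx.2.trans_lt (max_lt hc0 hy))).continuousWithinAt
  have hcd : ∀ t ≤ t₀, HasDerivAt (fun t => (∫ z in c..φ t, 1 / f z) - t)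
      (1 / f (φ t) * deriv φ t - 1) t := fun t ht =>
    ((hGd _ (hφ t ht).1).comp t (hd t).hasDerivAt).sub (hasDerivAt_id t)
  have hmono : MonotoneOn (fun t => (∫ z in c..φ t, 1 / f z) - t) (Set.Iic t₀) := by
    apply monotoneOn_of_deriv_nonneg (convex_Iic _)
    · exact fun t ht => (hcd t ht).continuousAt.continuousWithinAt
    · exact fun t ht => (hcd t (Set.mem_Iic.1 (interior_subset ht))).differentiableAt.differentiableWithinAt
    · intro t ht
      have ht' : t ≤ t₀ := Set.mem_Iic.1 (interior_subset ht)
      rw [(hcd t ht').deriv, one_div_mul_eq_div, sub_nonneg,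
        one_le_div (hfpos _ (hφ t ht').1)]
      exact (hφ t ht').2
  have hφm : MonotoneOn φ (Set.Iic t₀) := by
    apply monotoneOn_of_deriv_nonneg (convex_Iic _) hd.continuous.continuousOn
      hd.differentiableOn
    intro t ht
    have ht' : t ≤ t₀ := Set.mem_Iic.1 (interior_subset ht)
    exact (hfpos _ (hφ t ht').1).le.trans (hφ t ht').2
  obtain ⟨I, hI⟩ : ∃ I, I = ∫ z in Set.Iic c, 1 / f z := ⟨_, rfl⟩
  have hnn : ∀ z ∈ Set.Iic c, 0 ≤ 1 / f z := fun z hz =>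
    (one_div_pos.2 (hfpos z (lt_of_le_of_lt hz hc0))).le
  have hI0 : 0 ≤ I := hI ▸ MeasureTheory.setIntegral_nonneg measurableSet_Iic hnn
  have ht : t₀ - I - 1 ≤ t₀ := by linarith
  have hm := hmono (show t₀ - I - 1 ∈ Set.Iic t₀ from ht) (Set.mem_Iic.2 le_rfl) ht
  have hle : φ (t₀ - I - 1) ≤ c :=
    hc ▸ hφm (show t₀ - I - 1 ∈ Set.Iic t₀ from ht) (Set.mem_Iic.2 le_rfl) ht
  have hb : ∫ z in φ (t₀ - I - 1)..c, 1 / f z ≤ I := by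
    rw [intervalIntegral.integral_of_le hle, hI]
    apply MeasureTheory.setIntegral_mono_set h2
    · exact (MeasureTheory.ae_restrict_iff' measurableSet_Iic).2 (Filter.Eventually.of_forall hnn)
    · exact (Set.Ioc_subset_Iic_self).eventuallyLE
  simp only [← hc, intervalIntegral.integral_same] at hm
  rw [intervalIntegral.integral_symm] at hm
  linarith
end

section
/- Let f : ℝ → ℝ be continuous with f(0) = 0, f(z) ≥ 0 for all z, and f(z) > 0 for all z ≠ 0, and suppose that the function z ↦ 1/f(z) + 1/f(−z) is integrable on [1, +∞). Then every differentiable function φ : ℝ → ℝ satisfying φ'(t) ≥ f(φ(t)) for all t ∈ ℝ is identically zero. -/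
open MeasureTheory Set in
lemma osgood_aux (f : ℝ → ℝ) (hf : Continuous f) 
    (hfnonneg : ∀ z : ℝ, 0 ≤ f z) (hfpos : ∀ z : ℝ, z ≠ 0 → 0 < f z)
    (hint : IntegrableOn (fun z => 1 / f z + 1 / f (-z)) (Ici (1 : ℝ)))
    (φ : ℝ → ℝ) (hφ : Differentiable ℝ φ) (hineq : ∀ t : ℝ, f (φ t) ≤ deriv φ t) (t₀ : ℝ) :
    φ t₀ ≤ 0 := by
  by_contra! hc
  set c := φ t₀ with hcdef
  have hmono : Monotone φ := monotone_of_deriv_nonneg hφ (fun t => (hfnonneg _).trans (hineq t))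
  have h1 : IntegrableOn (fun z => 1 / f z) (Ici (1 : ℝ)) := by
    refine Integrable.mono' hint ?_ ?_
    · exact (hf.measurable.const_div 1).aestronglyMeasurable
    · refine Filter.Eventually.of_forall fun z => ?_
      have a := hfnonneg z
      have b := hfnonneg (-z)
      rw [Real.norm_of_nonneg (by positivity)]
      have : 0 ≤ 1 / f (-z) := by positivity
      linarith
  let h : ℝ → ℝ := fun z => 1 / f (max z c)
  have hpos : ∀ z, 0 < f (max z c) := fun z => hfpos _ (lt_of_lt_of_le hc (le_max_right _ _)).ne'
  have hcont : Continuous h := by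
    refine continuous_const.div (hf.comp (continuous_id.max continuous_const)) fun z => (hpos z).ne'
  have hnn : ∀ z, 0 ≤ h z := fun z => by have := hpos z; simp only [h]; positivity
  have hI : IntegrableOn h (Ioi c) := by
    have a : IntegrableOn h (Icc c (max 1 c)) := hcont.continuousOn.integrableOn_Icc
    have b : IntegrableOn h (Ici (max 1 c)) := by
      refine (h1.mono_set (Ici_subset_Ici.2 (le_max_left 1 c))).congr_fun ?_ measurableSet_Ici
      intro z hz
      have : c ≤ z := (le_max_right _ _).trans hz
      simp [h, max_eq_left this]
    refine (a.union b).mono_set fun z hz => ?_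
    rcases le_total z (max 1 c) with h' | h'
    · exact Or.inl ⟨le_of_lt hz, h'⟩
    · exact Or.inr h'
  let G : ℝ → ℝ := fun x => ∫ z in c..x, h z
  have hG : ∀ x, HasDerivAt G (h x) x := fun x => hcont.integral_hasStrictDerivAt c x |>.hasDerivAt
  have hGb : ∀ x, c ≤ x → G x ≤ ∫ z in Ioi c, h z := fun x hx => by
    simp only [G]
    rw [intervalIntegral.integral_of_le hx]
    exact setIntegral_mono_set hI (Filter.Eventually.of_forall hnn)
      (Filter.Eventually.of_forall fun z hz => hz.1)
  have hd : ∀ t, HasDerivAt (fun t => G (φ t) - t) (h (φ t) * deriv φ t - 1) t := fun t =>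
    ((hG (φ t)).comp t (hφ t).hasDerivAt).sub (hasDerivAt_id t)
  have hM : MonotoneOn (fun t => G (φ t) - t) (Ici t₀) := by
    refine monotoneOn_of_deriv_nonneg (convex_Ici t₀)
      (fun t _ => (hd t).continuousAt.continuousWithinAt)
      (fun t _ => (hd t).differentiableAt.differentiableWithinAt) fun t ht => ?_
    rw [interior_Ici] at ht
    rw [(hd t).deriv]
    have hct : c ≤ φ t := hmono (le_of_lt ht)
    have hp : 0 < f (φ t) := hfpos _ (hc.trans_le hct).ne'
    simp only [h, max_eq_left hct]
    rw [sub_nonneg, one_div, inv_mul_eq_div, le_div_iff₀ hp, one_mul]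
    exact hineq t
  have hIn : 0 ≤ ∫ z in Ioi c, h z := integral_nonneg hnn
  have hle : t₀ ≤ t₀ + (∫ z in Ioi c, h z) + 1 := by linarith
  have := hM (mem_Ici.2 le_rfl) (mem_Ici.2 hle) hle
  have h2 := hGb _ (hmono hle)
  have h3 : G (φ t₀) = 0 := intervalIntegral.integral_same
  simp only [h3] at this
  linarith

/-- ODE core of Lemma 2.1: if `f` is continuous, vanishes only at `0`, is nonnegative, and
`z ↦ 1/f(z) + 1/f(−z)` is integrable on `[1, ∞)`, then every differentiable `φ : ℝ → ℝ`
with `φ'(t) ≥ f(φ(t))` for all `t` is identically zero. -/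
theorem osgood_entire (f : ℝ → ℝ) (hf : Continuous f) (hf0 : f 0 = 0)
    (hfnonneg : ∀ z : ℝ, 0 ≤ f z) (hfpos : ∀ z : ℝ, z ≠ 0 → 0 < f z)
    (hint : MeasureTheory.IntegrableOn (fun z => 1 / f z + 1 / f (-z)) (Set.Ici (1 : ℝ)))
    (φ : ℝ → ℝ) (hφ : Differentiable ℝ φ) (hineq : ∀ t : ℝ, f (φ t) ≤ deriv φ t) :
    ∀ t : ℝ, φ t = 0 := by

  intro t
  refine le_antisymm (osgood_aux f hf hfnonneg hfpos hint φ hφ hineq t) ?_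
  have key := osgood_aux (fun z => f (-z)) (hf.comp continuous_neg) (fun z => hfnonneg _)
    (fun z hz => hfpos _ (neg_ne_zero.2 hz)) (by simpa [add_comm] using hint)
    (fun s => -φ (-s)) ((hφ.comp differentiable_neg).neg) (fun s => ?_) (-t)
  · simpa using key
  · have : HasDerivAt (fun s => -φ (-s)) (deriv φ (-s)) s := by
      have := ((hφ (-s)).hasDerivAt.comp s (hasDerivAt_neg s)).neg
      rw [mul_neg_one, neg_neg] at this
      exact this
    rw [this.deriv]
    simpa using hineq (-s)
end

section
/- Let p > 1, a > 0, b > 0 be reals, and let u : ℝ → ℝ be differentiable with u(t) > 0 and u'(t) ≥ b·u(t)^p − a·u(t) for all t ∈ ℝ. Then u(t) ≤ (2a/b)^{1/(p−1)} for all t ∈ ℝ. -/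
/-- ODE core of Lemma 5.1: a global-in-time positive differentiable solution of
`u' ≥ b uᵖ − a u` (`p > 1`, `a, b > 0`) satisfies `u(t) ≤ (2a/b)^{1/(p−1)}` for all `t`. -/
theorem ode_global_bound (p a b : ℝ) (hp : 1 < p) (ha : 0 < a) (hb : 0 < b)
    (u : ℝ → ℝ) (hu : Differentiable ℝ u) (hpos : ∀ t : ℝ, 0 < u t)
    (hineq : ∀ t : ℝ, b * u t ^ p - a * u t ≤ deriv u t) :
    ∀ t : ℝ, u t ≤ (2 * a / b) ^ (1 / (p - 1)) := by
  have hq : 0 < p - 1 := by linarith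
  set c := (p - 1) * a with hc
  have hcpos : 0 < c := mul_pos hq ha
  have hd : ∀ t, HasDerivAt (fun t => (u t ^ (1 - p) - b / a) * Real.exp (-(c * t)))
      ((deriv u t * (1 - p) * u t ^ (1 - p - 1)) * Real.exp (-(c * t))
        + (u t ^ (1 - p) - b / a) * (Real.exp (-(c * t)) * (-(c * 1)))) t := by
    intro t
    have h1 := ((hu t).hasDerivAt.rpow_const (p := 1 - p) (Or.inl (hpos t).ne')).sub_const (b / a)
    have h2 := (((hasDerivAt_id t).const_mul c).neg).exp
    exact h1.mul h2
  have hanti : Antitone (fun t => (u t ^ (1 - p) - b / a) * Real.exp (-(c * t))) := by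
    apply antitone_of_deriv_nonpos (fun t => (hd t).differentiableAt)
    intro t
    rw [(hd t).deriv]
    have hut := hpos t
    have e1 : u t ^ (1 - p - 1) * u t ^ p = 1 := by
      rw [← Real.rpow_add hut]; norm_num
    have e2 : u t ^ (1 - p - 1) * u t = u t ^ (1 - p) := by
      rw [← Real.rpow_add_one hut.ne']; congr 1; ring
    have hz : 0 < u t ^ (1 - p - 1) := Real.rpow_pos_of_pos hut _
    have h3 := mul_le_mul_of_nonneg_left (hineq t) (mul_pos hz hq).le
    have h4 : (u t ^ (1 - p - 1) * (p - 1)) * (b * u t ^ p - a * u t)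
        = (p - 1) * b - c * u t ^ (1 - p) := by
      rw [← e2, hc]; linear_combination (p - 1) * b * e1
    have h5 : c * (b / a) = (p - 1) * b := by rw [hc]; field_simp
    have h6 : (deriv u t * (1 - p) * u t ^ (1 - p - 1)) - c * (u t ^ (1 - p) - b / a) ≤ 0 := by
      nlinarith
    have := mul_nonpos_of_nonpos_of_nonneg h6 (Real.exp_pos (-(c * t))).le
    linarith
  intro t0
  have key : b / a ≤ u t0 ^ (1 - p) := by
    by_contra! hlt
    set w := (u t0 ^ (1 - p) - b / a) * Real.exp (-(c * t0)) with hw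
    have hw0 : w < 0 := mul_neg_of_neg_of_pos (by linarith) (Real.exp_pos _)
    set K := (b / a) / (-w) with hK
    set t := max t0 (K / c) with ht
    have hle := hanti (le_max_left t0 (K / c))
    simp only [← ht, ← hw] at hle
    have h1 : K ≤ c * t := by
      have := le_max_right t0 (K / c)
      rw [div_le_iff₀ hcpos] at this
      linarith
    have h2 : K < Real.exp (c * t) := by linarith [Real.add_one_le_exp (c * t)]
    rw [hK, div_lt_iff₀ (by linarith)] at h2
    have h3 : Real.exp (-(c * t)) * Real.exp (c * t) = 1 := by
      rw [← Real.exp_add]; simp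
    have h4 := mul_le_mul_of_nonneg_right hle (Real.exp_pos (c * t)).le
    rw [mul_assoc, h3] at h4
    have := Real.rpow_pos_of_pos (hpos t) (1 - p)
    linarith
  have hut := hpos t0
  have e : u t0 ^ (1 - p) * u t0 ^ (p - 1) = 1 := by
    rw [← Real.rpow_add hut]; norm_num
  have hy : 0 < u t0 ^ (p - 1) := Real.rpow_pos_of_pos hut _
  have h7 := mul_le_mul_of_nonneg_right key hy.le
  rw [e, div_mul_eq_mul_div, div_le_one ha] at h7
  have h8 : u t0 ^ (p - 1) ≤ 2 * a / b := by
    rw [le_div_iff₀ hb]; linarith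
  have h9 := Real.rpow_le_rpow hy.le h8 (one_div_pos.mpr hq).le
  rwa [← Real.rpow_mul hut.le, mul_one_div_cancel hq.ne', Real.rpow_one] at h9
end
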